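/- Assume ν satisfies Condition M. Then the ground state GS_N = min_{σ ∈ S^{N-1}(√N)} H_N(σ) satisfies lim_{N→∞} GS_N / N = −E_0(ν) almost surely. -/

import Mathlib

open MeasureTheory ProbabilityTheory Real Filter Set Matrix
open scoped ENNReal

noncomputable section

namespace SpinGlass


/-- Coefficient decay: `limsup p⁻¹ log γ_p < 0`. -/
def GammaDecay (γ : ℕ → ℝ) : Prop :=
  (∀ p, 0 ≤ γ p) ∧ ∃ ρ : ℝ, 0 < ρ ∧ ρ < 1 ∧ ∀ᶠ p in atTop, γ p ≤ ρ ^ p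

/-- ν(x) = Σ_{p≥2} γ_p² xᵖ. -/
def nuF (γ : ℕ → ℝ) (x : ℝ) : ℝ := ∑' p : ℕ, if 2 ≤ p then γ p ^ 2 * x ^ p else 0

/-- ν′(x), termwise. -/
def nuD1 (γ : ℕ → ℝ) (x : ℝ) : ℝ :=
  ∑' p : ℕ, if 2 ≤ p then γ p ^ 2 * p * x ^ (p - 1) else 0

/-- ν″(x), termwise. -/
def nuD2 (γ : ℕ → ℝ) (x : ℝ) : ℝ :=
  ∑' p : ℕ, if 2 ≤ p then γ p ^ 2 * p * ((p : ℝ) - 1) * x ^ (p - 2) else 0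

/-- ν is mixed (not a monomial). -/
def Mixed (γ : ℕ → ℝ) : Prop :=
  ∃ p q : ℕ, 2 ≤ p ∧ 2 ≤ q ∧ p ≠ q ∧ γ p ≠ 0 ∧ γ q ≠ 0

/-- The logarithmic potential Ω of the semicircle law. -/
def Omega (x : ℝ) : ℝ :=
  if |x| ≤ 2 then x ^ 2 / 4 - 1 / 2
  else x ^ 2 / 4 - 1 / 2 -
    (|x| / 4 * Real.sqrt (x ^ 2 - 4) - Real.log (Real.sqrt (x ^ 2 / 4 - 1) + |x| / 2))

/-- The 2×2 covariance matrix Σ_q. -/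
def SigmaQ (γ : ℕ → ℝ) (q : ℝ) : Matrix (Fin 2) (Fin 2) ℝ :=
  !![nuF γ (q ^ 2), q ^ 2 * nuD1 γ (q ^ 2);
     q ^ 2 * nuD1 γ (q ^ 2), q ^ 4 * nuD2 γ (q ^ 2) + q ^ 2 * nuD1 γ (q ^ 2)]

/-- The complexity function Θ_{ν,q}(u,x). -/
def Theta (γ : ℕ → ℝ) (q u x : ℝ) : ℝ :=
  1 / 2 + 1 / 2 * Real.log (q ^ 2 * nuD2 γ (q ^ 2) / nuD1 γ (q ^ 2))
    - 1 / 2 * (![u, x] ⬝ᵥ ((SigmaQ γ q)⁻¹ *ᵥ ![u, x]))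
    + Omega (x / (q * Real.sqrt (nuD2 γ (q ^ 2))))

/-- −E₀(ν) is the minimal E with sup_x Θ_{ν,1}(E,x) = 0. -/
def E0 (γ : ℕ → ℝ) : ℝ := - sInf {E : ℝ | (⨆ x : ℝ, Theta γ 1 E x) = 0}

/-- −x₀(ν) is the (unique) maximizer of x ↦ Θ_{ν,1}(−E₀(ν),x). -/
def x0 (γ : ℕ → ℝ) : ℝ :=
  - sSup {x : ℝ | ∀ y : ℝ, Theta γ 1 (-(E0 γ)) y ≤ Theta γ 1 (-(E0 γ)) x}

/-- The coefficients of ν_q(x) = Σ γ_p² q^{2p} xᵖ. -/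
def gammaScale (γ : ℕ → ℝ) (q : ℝ) : ℕ → ℝ := fun p => γ p * q ^ p

def E0q (γ : ℕ → ℝ) (q : ℝ) : ℝ := E0 (gammaScale γ q)

def x0q (γ : ℕ → ℝ) (q : ℝ) : ℝ := q⁻¹ * x0 (gammaScale γ q)

/-- d(r,q₁,q₂) = rν′(q₁q₂r) − q₁q₂ν″(q₁q₂r)(1−r²). -/
def dA (γ : ℕ → ℝ) (r q1 q2 : ℝ) : ℝ :=
  r * nuD1 γ (q1 * q2 * r) - q1 * q2 * nuD2 γ (q1 * q2 * r) * (1 - r ^ 2)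

def a2 (γ : ℕ → ℝ) (r q1 q2 : ℝ) : ℝ :=
  nuD1 γ (q2 ^ 2) / (nuD1 γ (q1 ^ 2) * nuD1 γ (q2 ^ 2) - dA γ r q1 q2 ^ 2)

def a4 (γ : ℕ → ℝ) (r q1 q2 : ℝ) : ℝ :=
  -dA γ r q1 q2 / (nuD1 γ (q1 ^ 2) * nuD1 γ (q2 ^ 2) - dA γ r q1 q2 ^ 2)

/-- υ(r,q₁,q₂) = q₁q₂rν″(q₁q₂r) + ν′(q₁q₂r). -/
def ups (γ : ℕ → ℝ) (r q1 q2 : ℝ) : ℝ :=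
  q1 * q2 * r * nuD2 γ (q1 * q2 * r) + nuD1 γ (q1 * q2 * r)

def SigmaU (γ : ℕ → ℝ) (r q1 q2 : ℝ) : Matrix (Fin 2) (Fin 2) ℝ :=
  !![nuF γ (q1 ^ 2) - q1 ^ 2 * a2 γ r q2 q1 * nuD1 γ (q1 * q2 * r) ^ 2 * (1 - r ^ 2),
     nuF γ (q1 * q2 * r) + q1 * q2 * a4 γ r q1 q2 * nuD1 γ (q1 * q2 * r) ^ 2 * (1 - r ^ 2);
     nuF γ (q1 * q2 * r) + q1 * q2 * a4 γ r q1 q2 * nuD1 γ (q1 * q2 * r) ^ 2 * (1 - r ^ 2),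
     nuF γ (q2 ^ 2) - q2 ^ 2 * a2 γ r q1 q2 * nuD1 γ (q1 * q2 * r) ^ 2 * (1 - r ^ 2)]

def SigmaX (γ : ℕ → ℝ) (r q1 q2 : ℝ) : Matrix (Fin 2) (Fin 2) ℝ :=
  !![q1 ^ 2 * nuD2 γ (q1 ^ 2) + nuD1 γ (q1 ^ 2)
        - ups γ r q1 q2 ^ 2 * (1 - r ^ 2) * a2 γ r q2 q1,
     q1 * q2 * r ^ 2 * nuD2 γ (q1 * q2 * r) + r * nuD1 γ (q1 * q2 * r)
        + ups γ r q1 q2 ^ 2 * (1 - r ^ 2) * a4 γ r q1 q2;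
     q1 * q2 * r ^ 2 * nuD2 γ (q1 * q2 * r) + r * nuD1 γ (q1 * q2 * r)
        + ups γ r q1 q2 ^ 2 * (1 - r ^ 2) * a4 γ r q1 q2,
     q2 ^ 2 * nuD2 γ (q2 ^ 2) + nuD1 γ (q2 ^ 2)
        - ups γ r q1 q2 ^ 2 * (1 - r ^ 2) * a2 γ r q1 q2]

def SigmaB (γ : ℕ → ℝ) (r q1 q2 : ℝ) : Matrix (Fin 2) (Fin 2) ℝ :=
  !![q1 * nuD1 γ (q1 ^ 2)
        - q1 * (1 - r ^ 2) * nuD1 γ (q1 * q2 * r) * ups γ r q1 q2 * a2 γ r q2 q1,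
     q1 * r * nuD1 γ (q1 * q2 * r)
        + q1 * (1 - r ^ 2) * nuD1 γ (q1 * q2 * r) * ups γ r q1 q2 * a4 γ r q1 q2;
     q2 * r * nuD1 γ (q1 * q2 * r)
        + q2 * (1 - r ^ 2) * nuD1 γ (q1 * q2 * r) * ups γ r q2 q1 * a4 γ r q2 q1,
     q2 * nuD1 γ (q2 ^ 2)
        - q2 * (1 - r ^ 2) * nuD1 γ (q1 * q2 * r) * ups γ r q2 q1 * a2 γ r q1 q2]

/-- The 4×4 covariance matrix Σ_{U,X}(r,q₁,q₂), as a block matrix. -/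
def SigmaUX (γ : ℕ → ℝ) (r q1 q2 : ℝ) :
    Matrix (Fin 2 ⊕ Fin 2) (Fin 2 ⊕ Fin 2) ℝ :=
  Matrix.fromBlocks (SigmaU γ r q1 q2) (SigmaB γ r q1 q2)
    (SigmaB γ r q1 q2)ᵀ (SigmaX γ r q1 q2)

/-- The pair complexity Ψ_{ν,q₁,q₂}(r,u₁,u₂,x₁,x₂). -/
def Psi (γ : ℕ → ℝ) (q1 q2 r u1 u2 x1 x2 : ℝ) : ℝ :=
  1 + 1 / 2 * Real.log ((1 - r ^ 2) *
        (q1 ^ 2 * q2 ^ 2 * nuD2 γ (q1 ^ 2) * nuD2 γ (q2 ^ 2)) /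
        (nuD1 γ (q1 ^ 2) * nuD1 γ (q2 ^ 2) - nuD1 γ (q1 * q2 * r) ^ 2))
    - 1 / 2 * ((Sum.elim ![u1, u2] ![x1, x2]) ⬝ᵥ
        ((SigmaUX γ r q1 q2)⁻¹ *ᵥ (Sum.elim ![u1, u2] ![x1, x2])))
    + Omega (x1 / (q1 * Real.sqrt (nuD2 γ (q1 ^ 2))))
    + Omega (x2 / (q2 * Real.sqrt (nuD2 γ (q2 ^ 2))))

/-- Ψ⁰_ν(r). -/
def Psi0 (γ : ℕ → ℝ) (r : ℝ) : ℝ :=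
  Psi γ 1 1 r (-(E0 γ)) (-(E0 γ)) (-(x0 γ)) (-(x0 γ))

/-- G(ν). -/
def Gfun (γ : ℕ → ℝ) : ℝ :=
  Real.log (nuD2 γ 1 / nuD1 γ 1) -
    (nuD2 γ 1 + nuD1 γ 1) * (nuD2 γ 1 * nuF γ 1 + nuD1 γ 1 ^ 2 - nuD1 γ 1 * nuF γ 1) /
      (nuD2 γ 1 * nuD1 γ 1 ^ 2)

/-- ν is pure-like. -/
def PureLike (γ : ℕ → ℝ) : Prop := 0 < Gfun γ

/-- Condition M. -/
def ConditionM (γ : ℕ → ℝ) : Prop :=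
  Mixed γ ∧ PureLike γ ∧
    iteratedDeriv 2 (Psi0 γ) 0 < 0 ∧
    (∀ r ∈ Set.Ioo (-1 : ℝ) 1, r ≠ 0 → Psi0 γ r < Psi0 γ 0) ∧
    Filter.limsup (fun r : ℝ => (Psi0 γ r : EReal)) (nhdsWithin 1 (Set.Ioo (-1 : ℝ) 1))
      < ((Psi0 γ 0 : ℝ) : EReal) ∧
    Filter.limsup (fun r : ℝ => (Psi0 γ r : EReal)) (nhdsWithin (-1) (Set.Ioo (-1 : ℝ) 1))
      < ((Psi0 γ 0 : ℝ) : EReal)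
abbrev Idx : Type := ℕ × ((p : ℕ) × (Fin p → ℕ))

variable {ΩS : Type*} [MeasurableSpace ΩS]

/-- The mixed p-spin Hamiltonian of size `N` built from the disorder `J`. -/
def HamN (γ : ℕ → ℝ) (J : Idx → ΩS → ℝ) (N : ℕ) (ω : ΩS)
    (σ : EuclideanSpace ℝ (Fin N)) : ℝ :=
  ∑' p : ℕ, if 2 ≤ p then
    γ p * (Real.sqrt ((N : ℝ) ^ (p - 1)))⁻¹ *
      ∑ i : Fin p → Fin N, J (N, ⟨p, fun k => (i k : ℕ)⟩) ω * ∏ k, σ (i k)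
  else 0

/-- Disorder: independent standard Gaussians. -/
def StdGaussianDisorder (J : Idx → ΩS → ℝ) (P : Measure ΩS) : Prop :=
  (∀ i, Measurable (J i)) ∧
    iIndepFun J P ∧
    ∀ i, Measure.map (J i) P = gaussianReal 0 1

/-- σ is a critical point of `H` restricted to the sphere through σ. -/
def IsCritPt (γ : ℕ → ℝ) (J : Idx → ΩS → ℝ) (N : ℕ) (ω : ΩS)
    (σ : EuclideanSpace ℝ (Fin N)) : Prop :=
  ∀ v : EuclideanSpace ℝ (Fin N), (inner ℝ v σ : ℝ) = 0 → fderiv ℝ (HamN γ J N ω) σ v = 0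

/-- The radial derivative (d/dR)H_N(σ). -/
def radDeriv (γ : ℕ → ℝ) (J : Idx → ΩS → ℝ) (N : ℕ) (ω : ΩS)
    (σ : EuclideanSpace ℝ (Fin N)) : ℝ :=
  ‖σ‖⁻¹ * deriv (fun t : ℝ => HamN γ J N ω (t • σ)) 1

/-- The set 𝒞_{N,q}(N·B, √N·D) of q-critical points with constrained value and
radial derivative. -/
def CritSet (γ : ℕ → ℝ) (J : Idx → ΩS → ℝ) (N : ℕ) (q : ℝ) (B D : Set ℝ) (ω : ΩS) :
    Set (EuclideanSpace ℝ (Fin N)) :=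
  {σ | ‖σ‖ = q * Real.sqrt N ∧ IsCritPt γ J N ω σ ∧
    HamN γ J N ω σ / N ∈ B ∧ radDeriv γ J N ω σ / Real.sqrt N ∈ D}

/-- The overlap R(σ,σ′). -/
def overlap {N : ℕ} (σ τ : EuclideanSpace ℝ (Fin N)) : ℝ := (inner ℝ σ τ : ℝ) / (‖σ‖ * ‖τ‖)

/-- The uniform probability measure on the unit sphere of ℝᴺ. -/
def unifSphere (N : ℕ) : Measure (Metric.sphere (0 : EuclideanSpace ℝ (Fin N)) 1) :=
  ((volume : Measure (EuclideanSpace ℝ (Fin N))).toSphere Set.univ)⁻¹ •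
    (volume : Measure (EuclideanSpace ℝ (Fin N))).toSphere

/-- The partition function Z_{N,β} (in unit-sphere coordinates σ = √N·u). -/
def ZN (γ : ℕ → ℝ) (J : Idx → ΩS → ℝ) (N : ℕ) (β : ℝ) (ω : ΩS) : ℝ :=
  ∫ u : Metric.sphere (0 : EuclideanSpace ℝ (Fin N)) 1,
    Real.exp (-β * HamN γ J N ω (Real.sqrt N • (u : EuclideanSpace ℝ (Fin N))))
      ∂(unifSphere N)

/-- The partition function restricted to a subset of the sphere. -/
def ZNset (γ : ℕ → ℝ) (J : Idx → ΩS → ℝ) (N : ℕ) (β : ℝ) (ω : ΩS)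
    (S : Set (Metric.sphere (0 : EuclideanSpace ℝ (Fin N)) 1)) : ℝ :=
  ∫ u in S,
    Real.exp (-β * HamN γ J N ω (Real.sqrt N • (u : EuclideanSpace ℝ (Fin N))))
      ∂(unifSphere N)

/-- The Gibbs measure G_{N,β} (in unit-sphere coordinates). -/
def Gibbs (γ : ℕ → ℝ) (J : Idx → ΩS → ℝ) (N : ℕ) (β : ℝ) (ω : ΩS) :
    Measure (Metric.sphere (0 : EuclideanSpace ℝ (Fin N)) 1) :=
  (unifSphere N).withDensity fun u =>
    ENNReal.ofReal
      (Real.exp (-β * HamN γ J N ω (Real.sqrt N • (u : EuclideanSpace ℝ (Fin N)))) /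
        ZN γ J N β ω)

/-- `√N·u ∈ Band(σ₀, ε)`. -/
def InBand {N : ℕ} (u : Metric.sphere (0 : EuclideanSpace ℝ (Fin N)) 1)
    (σ0 : EuclideanSpace ℝ (Fin N)) (ε : ℝ) : Prop :=
  |overlap (Real.sqrt N • (u : EuclideanSpace ℝ (Fin N))) σ0 - ‖σ0‖ / Real.sqrt N| ≤ ε

/-- The ground state GS_N = min_{σ∈S^{N-1}(√N)} H_N(σ). -/
def GS (γ : ℕ → ℝ) (J : Idx → ΩS → ℝ) (N : ℕ) (ω : ΩS) : ℝ :=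
  sInf (HamN γ J N ω '' {σ : EuclideanSpace ℝ (Fin N) | ‖σ‖ = Real.sqrt N})

lemma summ1 {γ : ℕ → ℝ} (hγ : GammaDecay γ) (k : ℕ) :
    Summable (fun p : ℕ => γ p * (p : ℝ) ^ k) := by
  obtain ⟨h0, ρ, hρ0, hρ1, hev⟩ := hγ
  have hs : Summable (fun p : ℕ => (p : ℝ) ^ k * ρ ^ p) :=
    summable_pow_mul_geometric_of_norm_lt_one k (by rwa [Real.norm_of_nonneg hρ0.le])
  refine Summable.of_norm_bounded_eventually_nat hs ?_
  filter_upwards [hev] with p hp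
  rw [Real.norm_of_nonneg (mul_nonneg (h0 p) (by positivity)), mul_comm]
  gcongr

lemma summ2 {γ : ℕ → ℝ} (hγ : GammaDecay γ) (k : ℕ) :
    Summable (fun p : ℕ => γ p ^ 2 * (p : ℝ) ^ k) := by
  have h0 := hγ.1
  obtain ⟨_, ρ, hρ0, hρ1, hev⟩ := id hγ
  refine Summable.of_norm_bounded_eventually_nat (summ1 hγ k) ?_
  filter_upwards [hev] with p hp
  have h1 : γ p ≤ 1 := hp.trans (pow_le_one₀ hρ0.le hρ1.le)
  rw [Real.norm_of_nonneg (mul_nonneg (by positivity) (by positivity))]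
  gcongr
  nlinarith [h0 p]

/-- terms -/
def tF (γ : ℕ → ℝ) (x : ℝ) (p : ℕ) : ℝ := if 2 ≤ p then γ p ^ 2 * x ^ p else 0
def tD1 (γ : ℕ → ℝ) (x : ℝ) (p : ℕ) : ℝ := if 2 ≤ p then γ p ^ 2 * p * x ^ (p - 1) else 0
def tD2 (γ : ℕ → ℝ) (x : ℝ) (p : ℕ) : ℝ :=
  if 2 ≤ p then γ p ^ 2 * p * ((p : ℝ) - 1) * x ^ (p - 2) else 0

lemma tF_bd (γ : ℕ → ℝ) {x : ℝ} (hx : |x| ≤ 1) (p : ℕ) : ‖tF γ x p‖ ≤ γ p ^ 2 * (p : ℝ) ^ 0 := by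
  unfold tF
  split_ifs
  · rw [norm_mul, norm_pow, norm_pow, Real.norm_eq_abs, Real.norm_eq_abs, sq_abs, pow_zero]
    gcongr
    exact pow_le_one₀ (abs_nonneg _) hx
  · simp; positivity
lemma tD1_bd (γ : ℕ → ℝ) {x : ℝ} (hx : |x| ≤ 1) (p : ℕ) : ‖tD1 γ x p‖ ≤ γ p ^ 2 * (p : ℝ) ^ 1 := by
  unfold tD1
  split_ifs
  · rw [norm_mul, norm_mul, norm_pow, norm_pow, Real.norm_eq_abs (γ p), Real.norm_eq_abs x, sq_abs, pow_one,
      Real.norm_natCast]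
    exact mul_le_of_le_one_right (by positivity) (pow_le_one₀ (abs_nonneg _) hx)
  · simp; positivity
lemma tD2_bd (γ : ℕ → ℝ) {x : ℝ} (hx : |x| ≤ 1) (p : ℕ) : ‖tD2 γ x p‖ ≤ γ p ^ 2 * (p : ℝ) ^ 2 := by
  unfold tD2
  split_ifs with h
  · have h2 : (2:ℝ) ≤ p := by exact_mod_cast h
    rw [norm_mul, norm_mul, norm_mul, norm_pow, norm_pow, Real.norm_eq_abs (γ p), Real.norm_eq_abs x, sq_abs,
      Real.norm_natCast, Real.norm_of_nonneg (by linarith)]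
    refine (mul_le_of_le_one_right (mul_nonneg (by positivity) (by linarith)) (pow_le_one₀ (abs_nonneg _) hx)).trans ?_
    rw [mul_assoc]
    gcongr
    nlinarith
  · simp; positivity

lemma hsF {γ : ℕ → ℝ} (hγ : GammaDecay γ) {x : ℝ} (hx : |x| ≤ 1) : HasSum (tF γ x) (nuF γ x) :=
  (Summable.of_norm_bounded (summ2 hγ 0) (tF_bd γ hx)).hasSum
lemma hsD1 {γ : ℕ → ℝ} (hγ : GammaDecay γ) {x : ℝ} (hx : |x| ≤ 1) : HasSum (tD1 γ x) (nuD1 γ x) :=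
  (Summable.of_norm_bounded (summ2 hγ 1) (tD1_bd γ hx)).hasSum
lemma hsD2 {γ : ℕ → ℝ} (hγ : GammaDecay γ) {x : ℝ} (hx : |x| ≤ 1) : HasSum (tD2 γ x) (nuD2 γ x) :=
  (Summable.of_norm_bounded (summ2 hγ 2) (tD2_bd γ hx)).hasSum

lemma contF {γ : ℕ → ℝ} (hγ : GammaDecay γ) : ContinuousOn (nuF γ) (Icc (-1) 1) := by
  refine continuousOn_tsum (u := fun p => γ p ^ 2 * (p : ℝ) ^ 0) (fun p => ?_) (summ2 hγ 0) (fun p x hx => tF_bd γ (abs_le.2 hx) p)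
  split_ifs <;> fun_prop
lemma contD1 {γ : ℕ → ℝ} (hγ : GammaDecay γ) : ContinuousOn (nuD1 γ) (Icc (-1) 1) := by
  refine continuousOn_tsum (u := fun p => γ p ^ 2 * (p : ℝ) ^ 1) (fun p => ?_) (summ2 hγ 1) (fun p x hx => tD1_bd γ (abs_le.2 hx) p)
  split_ifs <;> fun_prop
lemma contD2 {γ : ℕ → ℝ} (hγ : GammaDecay γ) : ContinuousOn (nuD2 γ) (Icc (-1) 1) := by
  refine continuousOn_tsum (u := fun p => γ p ^ 2 * (p : ℝ) ^ 2) (fun p => ?_) (summ2 hγ 2) (fun p x hx => tD2_bd γ (abs_le.2 hx) p)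
  split_ifs <;> fun_prop

lemma abs1 : |(1:ℝ)| ≤ 1 := by simp

/-- tangent line inequality -/
lemma nu_tangent {γ : ℕ → ℝ} (hγ : GammaDecay γ) {r : ℝ} (hr : |r| ≤ 1) :
    nuD1 γ 1 * r ≤ nuF γ r + (nuD1 γ 1 - nuF γ 1) := by
  have h := ((hsD1 hγ abs1).mul_right r)
  have h' := (hsF hγ hr).add ((hsD1 hγ abs1).sub (hsF hγ abs1))
  refine hasSum_le (fun p => ?_) h h'
  unfold tD1 tF
  split_ifs with hp
  · have : -2 ≤ r - 1 := by linarith [(abs_le.1 hr).1]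
    have hb := one_add_mul_le_pow this p
    have := mul_le_mul_of_nonneg_left hb (sq_nonneg (γ p))
    simp only [one_pow, add_sub_cancel] at *
    linarith
  · simp

lemma nuD1_abs_le {γ : ℕ → ℝ} (hγ : GammaDecay γ) {r : ℝ} (hr : |r| ≤ 1) :
    |nuD1 γ r| ≤ |r| * nuD1 γ 1 := by
  have h := ((hsD1 hγ abs1).mul_left |r|)
  rw [← (hsD1 hγ hr).tsum_eq, ← Real.norm_eq_abs]
  refine tsum_of_norm_bounded h fun p => ?_
  unfold tD1
  split_ifs with hp
  · obtain ⟨q, rfl⟩ := Nat.exists_eq_add_of_le hp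
    rw [show 2 + q - 1 = q + 1 by omega, norm_mul, norm_pow, Real.norm_eq_abs r, pow_succ |r|, one_pow,
      Real.norm_of_nonneg (show 0 ≤ γ (2+q)^2 * ((2+q : ℕ):ℝ) by positivity)]
    have := pow_le_one₀ (n := q) (abs_nonneg r) hr
    have h3 : 0 ≤ γ (2+q)^2 * ((2+q : ℕ):ℝ) := by positivity
    nlinarith [mul_le_mul_of_nonneg_left this (mul_nonneg h3 (abs_nonneg r))]
  · simp

lemma nuF_abs_le {γ : ℕ → ℝ} (hγ : GammaDecay γ) {r : ℝ} (hr : |r| ≤ 1) :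
    |nuF γ r| ≤ nuF γ 1 := by
  have h := (hsF hγ abs1)
  rw [← (hsF hγ hr).tsum_eq, ← Real.norm_eq_abs]
  refine tsum_of_norm_bounded h fun p => ?_
  have := tF_bd γ hr p
  unfold tF at *
  split_ifs with hp <;> simp_all

lemma nuD2_abs_le {γ : ℕ → ℝ} (hγ : GammaDecay γ) {r : ℝ} (hr : |r| ≤ 1) :
    |nuD2 γ r| ≤ nuD2 γ 1 := by
  have h := (hsD2 hγ abs1)
  rw [← (hsD2 hγ hr).tsum_eq, ← Real.norm_eq_abs]
  refine tsum_of_norm_bounded h fun p => ?_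
  unfold tD2
  split_ifs with hp
  · have h2 : (2:ℝ) ≤ p := by exact_mod_cast hp
    rw [norm_mul, Real.norm_of_nonneg (mul_nonneg (by positivity) (by linarith)), norm_pow]
    have := pow_le_one₀ (n := p - 2) (norm_nonneg r) hr
    have h3 : 0 ≤ γ p^2 * (p:ℝ) * ((p:ℝ)-1) := mul_nonneg (by positivity) (by linarith)
    rw [one_pow]
    exact mul_le_mul_of_nonneg_left this h3
  · simp

lemma nu_zero (γ : ℕ → ℝ) : nuF γ 0 = 0 ∧ nuD1 γ 0 = 0 := by
  constructor
  · unfold nuF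
    convert tsum_zero (α := ℝ) (β := ℕ) with p
    split_ifs with h
    · rw [zero_pow (by omega), mul_zero]
    · rfl
  · unfold nuD1
    convert tsum_zero (α := ℝ) (β := ℕ) with p
    split_ifs with h
    · rw [zero_pow (by omega), mul_zero]
    · rfl

lemma two_nuF_le {γ : ℕ → ℝ} (hγ : GammaDecay γ) : 2 * nuF γ 1 ≤ nuD1 γ 1 := by
  refine hasSum_le (fun p => ?_) ((hsF hγ abs1).mul_left 2) (hsD1 hγ abs1)
  unfold tF tD1
  split_ifs with hp
  · have h2 : (2:ℝ) ≤ p := by exact_mod_cast hp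
    simp only [one_pow, mul_one]
    nlinarith [sq_nonneg (γ p)]
  · simp

lemma nu_cs {γ : ℕ → ℝ} (hγ : GammaDecay γ) (hm : Mixed γ) (hn : nuF γ 1 = 1) :
    0 < nuD2 γ 1 + nuD1 γ 1 - nuD1 γ 1 ^ 2 := by
  set n1 := nuD1 γ 1 with hn1
  have h : HasSum (fun p => (tD2 γ 1 p + tD1 γ 1 p) - 2 * n1 * tD1 γ 1 p + n1 ^ 2 * tF γ 1 p)
      ((nuD2 γ 1 + nuD1 γ 1) - 2 * n1 * nuD1 γ 1 + n1 ^ 2 * nuF γ 1) :=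
    ((((hsD2 hγ abs1).add (hsD1 hγ abs1)).sub ((hsD1 hγ abs1).mul_left (2*n1))).add ((hsF hγ abs1).mul_left (n1^2)))
  have heq : ∀ p, (tD2 γ 1 p + tD1 γ 1 p) - 2 * n1 * tD1 γ 1 p + n1 ^ 2 * tF γ 1 p =
      if 2 ≤ p then γ p ^ 2 * ((p:ℝ) - n1) ^ 2 else 0 := by
    intro p
    unfold tD2 tD1 tF
    split_ifs <;> simp <;> ring
  simp_rw [heq] at h
  rw [hn] at h
  have hval : nuD2 γ 1 + nuD1 γ 1 - 2 * n1 * nuD1 γ 1 + n1 ^ 2 * 1 = nuD2 γ 1 + n1 - n1 ^ 2 := by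
    rw [← hn1]; ring
  rw [hval] at h
  obtain ⟨p, q, hp, hq, hpq, h1, h2⟩ := hm
  have key : ∃ p : ℕ, 2 ≤ p ∧ γ p ≠ 0 ∧ (p : ℝ) ≠ n1 := by
    by_cases hc : (p:ℝ) = n1
    · exact ⟨q, hq, h2, fun h => hpq (by exact_mod_cast hc.trans h.symm)⟩
    · exact ⟨p, hp, h1, hc⟩
  obtain ⟨k, hk, hk1, hk2⟩ := key
  have := hasSum_lt (f := fun _ : ℕ => (0:ℝ)) (i := k) (fun p => ?_) ?_ hasSum_zero h
  · exact this
  · dsimp only; split_ifs <;> positivity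
  · simp only [hk, if_true]
    have : (k:ℝ) - n1 ≠ 0 := sub_ne_zero.2 hk2
    positivity

/-- bounds near one -/
lemma nu_diff {γ : ℕ → ℝ} (hγ : GammaDecay γ) {r : ℝ} (h0 : 0 ≤ r) (h1 : r ≤ 1) :
    (1 - r) * nuD2 γ r ≤ nuD1 γ 1 - nuD1 γ r ∧ nuD1 γ 1 - nuD1 γ r ≤ (1 - r) * nuD2 γ 1 := by
  have hr : |r| ≤ 1 := abs_le.2 ⟨by linarith, h1⟩
  have key : ∀ q : ℕ, (1 - r) * ((q:ℝ) + 1) * r ^ q ≤ 1 - r ^ (q+1) ∧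
      1 - r ^ (q+1) ≤ (1 - r) * ((q:ℝ)+1) := by
    intro q
    induction q with
    | zero => simp
    | succ n ih =>
      have hA := pow_le_one₀ (n := n+1) h0 h1
      have hB := pow_nonneg h0 (n+1)
      have hC := pow_nonneg h0 n
      push_cast
      rw [pow_succ r (n+1)]
      constructor
      · have := mul_le_mul_of_nonneg_right ih.1 h0
        rw [pow_succ] at this hA hB ⊢
        nlinarith [mul_nonneg (sub_nonneg.2 h1) hB]
      · nlinarith [mul_nonneg (sub_nonneg.2 h1) (sub_nonneg.2 hA)]
  constructor
  · refine hasSum_le (fun p => ?_) ((hsD2 hγ hr).mul_left (1 - r)) ((hsD1 hγ abs1).sub (hsD1 hγ hr))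
    unfold tD1 tD2
    split_ifs with hp
    · obtain ⟨q, rfl⟩ := Nat.exists_eq_add_of_le hp
      rw [show 2 + q - 1 = q + 1 by omega, show 2 + q - 2 = q by omega]
      have := mul_le_mul_of_nonneg_left (key q).1 (show 0 ≤ γ (2+q)^2 * ((2+q:ℕ):ℝ) by positivity)
      push_cast at *
      rw [one_pow]
      nlinarith [this]
    · simp
  · refine hasSum_le (fun p => ?_) ((hsD1 hγ abs1).sub (hsD1 hγ hr)) ((hsD2 hγ abs1).mul_left (1 - r))
    unfold tD1 tD2
    split_ifs with hp
    · obtain ⟨q, rfl⟩ := Nat.exists_eq_add_of_le hp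
      rw [show 2 + q - 1 = q + 1 by omega, show 2 + q - 2 = q by omega]
      have := mul_le_mul_of_nonneg_left (key q).2 (show 0 ≤ γ (2+q)^2 * ((2+q:ℕ):ℝ) by positivity)
      push_cast at *
      rw [one_pow, one_pow]
      nlinarith [this]
    · simp

/-- all odd coefficients vanish: parity -/
lemma nu_even {γ : ℕ → ℝ} (h : ∀ p, 2 ≤ p → Odd p → γ p = 0) (r : ℝ) :
    nuF γ (-r) = nuF γ r ∧ nuD1 γ (-r) = - nuD1 γ r ∧ nuD2 γ (-r) = nuD2 γ r := by
  refine ⟨?_, ?_, ?_⟩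
  · unfold nuF
    congr 1; ext p
    split_ifs with hp
    · rcases Nat.even_or_odd p with he | ho
      · rw [he.neg_pow]
      · simp [h p hp ho]
    · rfl
  · unfold nuD1
    rw [← tsum_neg]
    congr 1; ext p
    split_ifs with hp
    · rcases Nat.even_or_odd p with he | ho
      · rw [Odd.neg_pow]
        · ring
        · exact Nat.Even.sub_odd (by omega) he odd_one
      · simp [h p hp ho]
    · simp
  · unfold nuD2
    congr 1; ext p
    split_ifs with hp
    · rcases Nat.even_or_odd p with he | ho
      · rw [Even.neg_pow]
        exact (Nat.even_sub hp).2 (by simp [he])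
      · simp [h p hp ho]
    · rfl

lemma nu_odd {γ : ℕ → ℝ} (h : ∀ p, 2 ≤ p → Even p → γ p = 0) : nuF γ (-1) = - nuF γ 1 := by
  unfold nuF
  rw [← tsum_neg]
  congr 1; ext p
  split_ifs with hp
  · rcases Nat.even_or_odd p with he | ho
    · simp [h p hp he]
    · rw [ho.neg_pow]; ring
  · simp

lemma nu_both {γ : ℕ → ℝ} (hγ : GammaDecay γ) {p q : ℕ} (hp : 2 ≤ p) (hp1 : Odd p) (hp2 : γ p ≠ 0)
    (hq : 2 ≤ q) (hq1 : Even q) (hq2 : γ q ≠ 0) : |nuD1 γ (-1)| < nuD1 γ 1 := by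
  have hm : |(-1:ℝ)| ≤ 1 := by simp
  have hp0 : 0 < γ p ^ 2 * p := by positivity
  have hq0 : 0 < γ q ^ 2 * q := by positivity
  have hpo : Even (p - 1) := Nat.Odd.sub_odd hp1 odd_one
  have hqo : Odd (q - 1) := Nat.Even.sub_odd (by omega) hq1 odd_one
  rw [abs_lt]
  constructor
  · refine hasSum_lt (i := p) (fun k => ?_) ?_ (hsD1 hγ abs1).neg (hsD1 hγ hm)
    · unfold tD1; split_ifs
      · rcases neg_one_pow_eq_or ℝ (k-1) with h | h <;> rw [h] <;> simp
        have : 0 ≤ γ k ^ 2 * k := by positivity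
        linarith
      · simp
    · unfold tD1; rw [if_pos hp, if_pos hp, hpo.neg_pow]; simp; linarith
  · refine hasSum_lt (i := q) (fun k => ?_) ?_ (hsD1 hγ hm) (hsD1 hγ abs1)
    · unfold tD1; split_ifs
      · rcases neg_one_pow_eq_or ℝ (k-1) with h | h <;> rw [h] <;> simp
        have : 0 ≤ γ k ^ 2 * k := by positivity
        linarith
      · simp
    · unfold tD1; rw [if_pos hq, if_pos hq, hqo.neg_pow]; simp; linarith

lemma nuD2_pos {γ : ℕ → ℝ} (hγ : GammaDecay γ) (hm : Mixed γ) (hn : nuF γ 1 = 1) : 0 < nuD2 γ 1 := by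
  have := nu_cs hγ hm hn
  have h2 := two_nuF_le hγ
  rw [hn] at h2
  nlinarith

lemma Omega_neg (x : ℝ) : Omega (-x) = Omega x := by
  unfold Omega; simp

lemma Omega_param {s : ℝ} (h0 : 0 < s) (h1 : s ≤ 1) : Omega (s + 1 / s) = s ^ 2 / 2 - Real.log s := by
  rcases h1.eq_or_lt with rfl | h1
  · norm_num [Omega]
  · have hs1 : 1 < 1 / s := by rw [lt_div_iff₀ h0]; linarith
    have hX : 2 < s + 1 / s := by
      have : 0 < (1 - s) ^ 2 / s := by have : 0 < 1 - s := by linarith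
                                       positivity
      have h3 : (1 - s) ^ 2 / s = s + 1 / s - 2 := by field_simp; ring
      linarith
    have hpos : 0 < s + 1 / s := by linarith
    unfold Omega
    rw [abs_of_pos hpos, if_neg (not_le.2 hX)]
    have e1 : (s + 1 / s) ^ 2 - 4 = (1 / s - s) ^ 2 := by field_simp; ring
    have e2 : (s + 1 / s) ^ 2 / 4 - 1 = ((1 / s - s) / 2) ^ 2 := by field_simp; ring
    rw [e1, e2, Real.sqrt_sq (by linarith), Real.sqrt_sq (by linarith)]
    have e3 : (1 / s - s) / 2 + (s + 1 / s) / 2 = s⁻¹ := by field_simp; ring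
    rw [e3, Real.log_inv]
    field_simp
    ring

/-- auxiliary function -/
def hAux (X s : ℝ) : ℝ := -s ^ 2 / 4 - 1 / 2 - Real.log s + X / 2 * (s - 1 / s) + X ^ 2 / 4 + 1 / (4 * s ^ 2)

lemma hAux_deriv (X : ℝ) {s : ℝ} (hs : 0 < s) :
    HasDerivAt (hAux X) (1 / 2 * (1 + 1 / s ^ 2) * (X - s - 1 / s)) s := by
  have hs' : s ≠ 0 := hs.ne'
  have h1 := ((hasDerivAt_pow 2 s).neg.div_const 4).sub_const (1/2)
  have h2 := h1.sub (Real.hasDerivAt_log hs')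
  have h3 := h2.add (((hasDerivAt_id s).sub (hasDerivAt_inv hs')).const_mul (X/2))
  have h4 := h3.add_const (X^2/4)
  have h5 := h4.add ((((hasDerivAt_pow 2 s)).inv (by positivity)).const_mul (1/4))
  refine HasDerivAt.congr_deriv (f := hAux X)
    (h5.congr_of_eventuallyEq (Eventually.of_forall fun z => ?_)) ?_
  · simp [hAux]; ring
  · simp; field_simp; ring

lemma hAux_ge {q s : ℝ} (hq0 : 0 < q) (hq1 : q ≤ 1) (hs0 : 0 < s) (hs1 : s ≤ 1) :
    q ^ 2 / 2 - Real.log q ≤ hAux (q + 1 / q) s := by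
  have hqq : hAux (q + 1 / q) q = q ^ 2 / 2 - Real.log q := by
    unfold hAux; field_simp; ring
  rw [← hqq]
  have fac : ∀ z, 0 < z → q + 1 / q - z - 1 / z = (q - z) * (q * z - 1) / (q * z) := by
    intro z hz; field_simp; ring
  rcases le_total s q with h | h
  · have : AntitoneOn (hAux (q + 1/q)) (Icc s q) := by
      refine antitoneOn_of_deriv_nonpos (convex_Icc _ _) ?_ ?_ ?_
      · exact fun z hz => (hAux_deriv _ (hs0.trans_le hz.1)).continuousAt.continuousWithinAt
      · rw [interior_Icc]; exact fun z hz => (hAux_deriv _ (hs0.trans hz.1)).differentiableAt.differentiableWithinAt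
      · rw [interior_Icc]; intro z hz
        have hz0 := hs0.trans hz.1
        rw [(hAux_deriv _ hz0).deriv, fac z hz0]
        refine mul_nonpos_of_nonneg_of_nonpos (by positivity) ?_
        refine div_nonpos_of_nonpos_of_nonneg ?_ (by positivity)
        refine mul_nonpos_of_nonneg_of_nonpos (by linarith [hz.2]) ?_
        nlinarith [hz.2]
    exact this ⟨le_rfl, h⟩ ⟨h, le_rfl⟩ h
  · have : MonotoneOn (hAux (q + 1/q)) (Icc q s) := by
      refine monotoneOn_of_deriv_nonneg (convex_Icc _ _) ?_ ?_ ?_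
      · exact fun z hz => (hAux_deriv _ (hq0.trans_le hz.1)).continuousAt.continuousWithinAt
      · rw [interior_Icc]; exact fun z hz => (hAux_deriv _ (hq0.trans hz.1)).differentiableAt.differentiableWithinAt
      · rw [interior_Icc]; intro z hz
        have hz0 := hq0.trans hz.1
        rw [(hAux_deriv _ hz0).deriv, fac z hz0]
        refine mul_nonneg (by positivity) ?_
        refine div_nonneg ?_ (by positivity)
        refine mul_nonneg_of_nonpos_of_nonpos (by linarith [hz.1]) ?_
        nlinarith [hz.2]
    exact this ⟨le_rfl, h⟩ ⟨h, le_rfl⟩ h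

lemma exists_param {X : ℝ} (hX : 2 < X) : ∃ q : ℝ, 0 < q ∧ q ≤ 1 ∧ X = q + 1 / q := by
  have h4 : 0 < X ^ 2 - 4 := by nlinarith
  have hs := Real.sq_sqrt h4.le
  have hsp := Real.sqrt_pos.2 h4
  set w := Real.sqrt (X ^ 2 - 4)
  have hp : 0 < (X - w) / 2 := by nlinarith
  refine ⟨(X - w) / 2, hp, by nlinarith, ?_⟩
  have : 1 / ((X - w) / 2) = (X + w) / 2 := by
    rw [div_eq_iff hp.ne']; nlinarith
  rw [this]; ring

lemma Omega_le_hAux {s : ℝ} (hs0 : 0 < s) (hs1 : s ≤ 1) (X : ℝ) : Omega X ≤ hAux X s := by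
  have hneg : s - 1 / s ≤ 0 := by
    have : 1 ≤ 1 / s := by rw [le_div_iff₀ hs0]; linarith
    linarith
  have big : ∀ X, 2 < X → Omega X ≤ hAux X s := by
    intro X hX
    obtain ⟨q, h0, h1, rfl⟩ := exists_param hX
    rw [Omega_param h0 h1]
    exact hAux_ge h0 h1 hs0 hs1
  by_cases h : |X| ≤ 2
  · have h2 := hAux_ge one_pos le_rfl hs0 hs1
    unfold Omega
    rw [if_pos h]
    unfold hAux at *
    norm_num at *
    have := (abs_le.1 h).2
    nlinarith
  · push Not at h
    rcases lt_abs.1 h with h | h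
    · exact big X h
    · have h2 := big _ h
      rw [Omega_neg] at h2
      refine h2.trans ?_
      unfold hAux
      nlinarith

lemma Omega_quad {s : ℝ} (hs0 : 0 < s) (hs1 : s ≤ 1) (X : ℝ) :
    Omega X ≤ s ^ 2 / 2 - Real.log s + s * (X - (s + 1 / s)) + 1 / 4 * (X - (s + 1 / s)) ^ 2 := by
  refine (Omega_le_hAux hs0 hs1 X).trans (le_of_eq ?_)
  unfold hAux; field_simp; ring

lemma Theta_form (γ : ℕ → ℝ) (hn : nuF γ 1 = 1) (u x : ℝ) :
    Theta γ 1 u x = 1 / 2 + 1 / 2 * Real.log (nuD2 γ 1 / nuD1 γ 1)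
      - 1 / 2 * (((nuD2 γ 1 + nuD1 γ 1) * u ^ 2 - 2 * nuD1 γ 1 * u * x + x ^ 2) /
        (nuD2 γ 1 + nuD1 γ 1 - nuD1 γ 1 ^ 2)) + Omega (x / Real.sqrt (nuD2 γ 1)) := by
  unfold Theta SigmaQ
  simp only [one_pow, one_mul, hn]
  rw [Matrix.inv_def, Matrix.det_fin_two_of, Matrix.adjugate_fin_two_of]
  simp [Matrix.mulVec, dotProduct, Fin.sum_univ_two]
  rw [show nuD2 γ 1 + nuD1 γ 1 - nuD1 γ 1 * nuD1 γ 1 = nuD2 γ 1 + nuD1 γ 1 - nuD1 γ 1 ^ 2 by ring]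
  ring

lemma Theta_neg (γ : ℕ → ℝ) (hn : nuF γ 1 = 1) (u x : ℝ) : Theta γ 1 (-u) (-x) = Theta γ 1 u x := by
  rw [Theta_form γ hn, Theta_form γ hn, neg_div, Omega_neg]
  ring_nf

lemma zrel {n1 m : ℝ} (hn1 : 0 < n1) (hm : 0 < m) :
    (1 / (n1 * m) - m) * (1 / (n1 * m) - m + n1 * m)
      = (1 - n1 * m ^ 2) ^ 2 / (n1 * (n1 * m ^ 2)) + (1 - n1 * m ^ 2) := by
  field_simp

lemma exists_s {n1 n2 : ℝ} (hn1 : 2 ≤ n1) (hn2 : n1 < n2)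
    (hG : 0 < Real.log (n2 / n1) - (n2 + n1) * (n2 + n1 ^ 2 - n1) / (n2 * n1 ^ 2)) :
    ∃ m : ℝ, 0 < m ∧ n2 * m ^ 2 < 1 ∧
      (1 / (n1 * m) - m) * (1 / (n1 * m) - m + n1 * m) = - Real.log (n1 * m ^ 2) := by
  have hn1p : 0 < n1 := by linarith
  have hn2p : 0 < n2 := by linarith
  let T : ℝ → ℝ := fun m => - Real.log (n1 * m ^ 2) - (1 / (n1 * m) - m) * (1 / (n1 * m) - m + n1 * m)
  have hsq : Real.sqrt n2 ^ 2 = n2 := Real.sq_sqrt hn2p.le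
  have hsp : 0 < Real.sqrt n2 := Real.sqrt_pos.2 hn2p
  set w := Real.sqrt n2 with hw
  have hm1 : 0 < 1 / w := by positivity
  have hm0 : 0 < 1 / (8 * n1 * w) := by positivity
  have hle : 1 / (8 * n1 * w) ≤ 1 / w := by
    apply one_div_le_one_div_of_le hsp; nlinarith
  have hcont : ContinuousOn T (Icc (1 / (8 * n1 * w)) (1 / w)) := by
    intro z hz
    have hz0 : 0 < z := hm0.trans_le hz.1
    have h1 : n1 * z ^ 2 ≠ 0 := by positivity
    have h2 : n1 * z ≠ 0 := by positivity
    apply ContinuousAt.continuousWithinAt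
    have hlog : ContinuousAt (fun m : ℝ => Real.log (n1 * m ^ 2)) z := ContinuousAt.log (by fun_prop) h1
    have hdiv : ContinuousAt (fun m : ℝ => 1 / (n1 * m)) z := ContinuousAt.div (by fun_prop) (by fun_prop) h2
    exact hlog.neg.sub ((hdiv.sub continuousAt_id).mul ((hdiv.sub continuousAt_id).add (by fun_prop)))
  have hT1 : 0 < T (1 / w) := by
    simp only [T]
    rw [zrel hn1p hm1]
    have e : n1 * (1 / w) ^ 2 = n1 / n2 := by rw [div_pow, hsq]; ring
    rw [e, ← Real.log_inv, inv_div]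
    have : (1 - n1 / n2) ^ 2 / (n1 * (n1 / n2)) + (1 - n1 / n2) = (n2 - n1) * (n2 + n1 ^ 2 - n1) / (n2 * n1 ^ 2) := by
      field_simp; ring
    rw [this]
    have h3 : (n2 - n1) * (n2 + n1 ^ 2 - n1) / (n2 * n1 ^ 2) ≤ (n2 + n1) * (n2 + n1 ^ 2 - n1) / (n2 * n1 ^ 2) := by
      have : 0 ≤ n2 + n1 ^ 2 - n1 := by nlinarith
      gcongr; linarith
    linarith
  have hT0 : T (1 / (8 * n1 * w)) ≤ 0 := by
    simp only [T]
    rw [zrel hn1p hm0]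
    set z := n1 * (1 / (8 * n1 * w)) ^ 2 with hz
    have hzv : z = 1 / (64 * n1 * n2) := by
      rw [hz, div_pow, mul_pow, mul_pow, hsq]; field_simp; norm_num
    have hzpos : 0 < z := by rw [hzv]; positivity
    have hzle : z ≤ 1 / (64 * n1 ^ 2) := by
      rw [hzv]; apply one_div_le_one_div_of_le (by positivity); nlinarith
    have hzh : z ≤ 1 / 2 := by
      refine hzle.trans ?_
      rw [div_le_div_iff₀ (by positivity) (by norm_num)]; nlinarith
    have hsz := Real.sqrt_pos.2 hzpos
    have hsz2 := Real.sq_sqrt hzpos.le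
    set q := Real.sqrt z with hq
    have hqle : q ≤ 1 / (8 * n1) := by
      have : q ^ 2 ≤ (1 / (8 * n1)) ^ 2 := by rw [hsz2]; refine hzle.trans (le_of_eq ?_); field_simp; norm_num
      exact (pow_le_pow_iff_left₀ hsz.le (by positivity) two_ne_zero).1 this
    have hlog : - Real.log z ≤ 2 * (1 / q) := by
      rw [← hsz2, Real.log_pow]
      have := Real.log_le_sub_one_of_pos (inv_pos.2 hsz)
      rw [Real.log_inv] at this
      push_cast
      rw [one_div]; linarith
    have hmain : 2 * (1 / q) ≤ (1 - z) ^ 2 / (n1 * z) := by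
      rw [← hsz2] at hzh ⊢
      rw [mul_one_div, div_le_div_iff₀ hsz (by positivity)]
      have h8 : q * (8 * n1) ≤ 1 := by rwa [le_div_iff₀ (by positivity)] at hqle
      have h9 : 1 / 4 ≤ (1 - q ^ 2) ^ 2 := by nlinarith
      nlinarith [mul_le_mul_of_nonneg_left h8 hsz.le, mul_le_mul_of_nonneg_right h9 hsz.le]
    linarith
  obtain ⟨m, hm, hmT⟩ := intermediate_value_Icc hle hcont ⟨hT0, hT1.le⟩
  have hmpos := hm0.trans_le hm.1
  refine ⟨m, hmpos, ?_, by simp only [T] at hmT; linarith⟩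
  have hne : m ≠ 1 / w := by rintro rfl; exact hT1.ne' hmT
  have hlt : m < 1 / w := lt_of_le_of_ne hm.2 hne
  rw [lt_div_iff₀ hsp] at hlt
  rw [← hsq]; nlinarith [mul_pos hmpos hsp]

/-- The parameters y, m. -/
structure Pars (γ : ℕ → ℝ) (y m : ℝ) : Prop where
  y_pos : 0 < y
  m_pos : 0 < m
  hs : nuD2 γ 1 * m ^ 2 < 1
  n1_ge : 2 ≤ nuD1 γ 1
  n12 : nuD1 γ 1 < nuD2 γ 1
  e : E0 γ = y + nuD1 γ 1 * m
  x : x0 γ = nuD1 γ 1 * y + (nuD1 γ 1 + nuD2 γ 1) * m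
  rel : nuD1 γ 1 * m * (y + m) = 1
  ye : y * E0 γ = - Real.log (nuD1 γ 1 * m ^ 2)
  th : Theta γ 1 (-(E0 γ)) (-(x0 γ)) = 0
  om : Omega (x0 γ / Real.sqrt (nuD2 γ 1)) = nuD2 γ 1 * m ^ 2 / 2 - Real.log (Real.sqrt (nuD2 γ 1) * m)

set_option maxHeartbeats 1000000 in
lemma exists_pars {γ : ℕ → ℝ} (hγ : GammaDecay γ) (hn : nuF γ 1 = 1) (hm : Mixed γ) (hP : PureLike γ) :
    ∃ y m, Pars γ y m := by
  have hD := nu_cs hγ hm hn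
  have hn1 := two_nuF_le hγ
  have hn2p := nuD2_pos hγ hm hn
  have hTh := Theta_form γ hn
  have hThn := Theta_neg γ hn
  rw [hn] at hn1
  unfold PureLike Gfun at hP
  rw [hn] at hP
  set n1 := nuD1 γ 1
  set n2 := nuD2 γ 1
  have hn1p : 0 < n1 := by linarith
  have h12 : n1 < n2 := by
    by_contra hcon
    push Not at hcon
    have h1 : Real.log (n2 / n1) ≤ 0 := Real.log_nonpos (by positivity) (by rw [div_le_one hn1p]; exact hcon)
    have h2 : 0 ≤ (n2 + n1) * (n2 * 1 + n1 ^ 2 - n1 * 1) / (n2 * n1 ^ 2) := by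
      have : 0 ≤ n2 * 1 + n1 ^ 2 - n1 * 1 := by nlinarith
      positivity
    linarith
  obtain ⟨m, hm0, hm1, hmT⟩ := exists_s (by linarith) h12 (by simpa using hP)
  set y := 1 / (n1 * m) - m with hy
  have hrel : n1 * m * (y + m) = 1 := by rw [hy]; field_simp; ring
  have hypos : 0 < y := by
    have : n1 * m ^ 2 < 1 := by nlinarith [sq_nonneg m]
    have h3 : 0 < n1 * m * y := by nlinarith
    exact pos_of_mul_pos_right h3 (by positivity)
  set u := y + n1 * m with hu
  set x := n1 * y + (n1 + n2) * m with hx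
  have hsq : Real.sqrt n2 ^ 2 = n2 := Real.sq_sqrt hn2p.le
  have hsp : 0 < Real.sqrt n2 := Real.sqrt_pos.2 hn2p
  set w := Real.sqrt n2 with hw
  set s := w * m with hs
  have hs0 : 0 < s := by positivity
  have hss : s ^ 2 = n2 * m ^ 2 := by rw [hs, mul_pow, hsq]
  have hs1 : s ≤ 1 := by nlinarith
  have hX0 : x / w = s + 1 / s := by
    have e0 : s + 1 / s = (s ^ 2 + 1) / s := by field_simp
    rw [e0, hss, hs, div_eq_div_iff hsp.ne' (by positivity), hx]
    linear_combination w * hrel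
  have hom : Omega (x / w) = n2 * m ^ 2 / 2 - Real.log s := by rw [hX0, Omega_param hs0 hs1, hss]
  have hmx : m * x = 1 + n2 * m ^ 2 := by rw [hx]; nlinarith
  -- quadratic expansion
  have hDne : n2 + n1 - n1 ^ 2 ≠ 0 := hD.ne'
  have hlog : 1 / 2 * Real.log (n2 / n1) - Real.log s = 1 / 2 * (- Real.log (n1 * m ^ 2)) := by
    have e1 : Real.log s = 1/2 * Real.log (n2 * m ^ 2) := by
      rw [← hss, Real.log_pow]; push_cast; ring
    rw [e1, Real.log_div hn2p.ne' hn1p.ne', Real.log_mul hn2p.ne' (by positivity), Real.log_mul hn1p.ne' (by positivity)]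
    ring
  have main : ∀ u' x', Theta γ 1 u' x' ≤ - y * (u' - u) - 1 / 2 * (((n2 + n1) * (u' - u) ^ 2 - 2 * n1 * (u' - u) * (x' - x) + (x' - x) ^ 2) /
        (n2 + n1 - n1 ^ 2)) + (x' - x) ^ 2 / (4 * n2) := by
    intro u' x'
    rw [hTh]
    have h1 := Omega_quad hs0 hs1 (x' / w)
    rw [← hX0, ← sub_div, div_pow, hsq] at h1
    have e1 : s * ((x' - x) / w) = m * (x' - x) := by rw [hs]; field_simp
    rw [e1] at h1
    have e2 : ((n2 + n1) * u' ^ 2 - 2 * n1 * u' * x' + x' ^ 2) / (n2 + n1 - n1 ^ 2)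
      = ((n2 + n1) * (u' - u) ^ 2 - 2 * n1 * (u' - u) * (x' - x) + (x' - x) ^ 2) /
        (n2 + n1 - n1 ^ 2) + 2 * (y * (u' - u) + m * (x' - x)) + (y * u + m * x) := by
      rw [hx, hu]; field_simp; ring
    rw [e2]
    have e3 : (x' - x) ^ 2 / (4 * n2) = 1 / 4 * ((x' - x) ^ 2 / n2) := by field_simp
    rw [e3]
    linarith
  have hform : ∀ a b : ℝ, - (1 / 2 * (((n2 + n1) * a ^ 2 - 2 * n1 * a * b + b ^ 2) /
        (n2 + n1 - n1 ^ 2))) + b ^ 2 / (4 * n2) ≤ 0 := by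
    intro a b
    have : 1 / 2 * (((n2 + n1) * a ^ 2 - 2 * n1 * a * b + b ^ 2) / (n2 + n1 - n1 ^ 2)) - b ^ 2 / (4 * n2)
       = (2 * n2 * ((n2 + n1) * a ^ 2 - 2 * n1 * a * b + b ^ 2) - b ^ 2 * (n2 + n1 - n1 ^ 2)) / (4 * n2 * (n2 + n1 - n1 ^ 2)) := by
      field_simp; ring
    have h2 : 0 ≤ (n2 + n1) * (2 * n2 * ((n2 + n1) * a ^ 2 - 2 * n1 * a * b + b ^ 2) - b ^ 2 * (n2 + n1 - n1 ^ 2)) := by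
      have : (n2 + n1) * (2 * n2 * ((n2 + n1) * a ^ 2 - 2 * n1 * a * b + b ^ 2) - b ^ 2 * (n2 + n1 - n1 ^ 2))
        = 2 * n2 * ((n2 + n1) * a - n1 * b) ^ 2 + (n2 - n1) * (n2 + n1 - n1 ^ 2) * b ^ 2 := by ring
      rw [this]
      have := mul_nonneg (mul_nonneg (sub_nonneg.2 h12.le) hD.le) (sq_nonneg b)
      positivity
    have h3 := nonneg_of_mul_nonneg_right h2 (by positivity)
    have h4 : 0 ≤ (2 * n2 * ((n2 + n1) * a ^ 2 - 2 * n1 * a * b + b ^ 2) - b ^ 2 * (n2 + n1 - n1 ^ 2)) / (4 * n2 * (n2 + n1 - n1 ^ 2)) :=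
      div_nonneg h3 (by positivity)
    linarith
  have main2 : ∀ u' x', Theta γ 1 u' x' ≤ - y * (u' - u) := fun u' x' => by
    have := main u' x'; have := hform (u' - u) (x' - x); linarith
  have hval : Theta γ 1 u x = 0 := by
    rw [hTh, hom]
    have e2 : ((n2 + n1) * u ^ 2 - 2 * n1 * u * x + x ^ 2) / (n2 + n1 - n1 ^ 2) = y * u + m * x := by
      rw [hx, hu]; field_simp; ring
    rw [e2]
    linarith
  have hvaln : Theta γ 1 (-u) (-x) = 0 := by rw [hThn, hval]
  have main3 : ∀ u' x', Theta γ 1 u' x' ≤ y * (u' + u) := fun u' x' => by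
    have := main2 (-u') (-x'); rw [hThn] at this; linarith
  have hE : E0 γ = u := by
    unfold E0
    have : IsLeast {E : ℝ | (⨆ x : ℝ, Theta γ 1 E x) = 0} (-u) := by
      constructor
      · apply le_antisymm
        · exact ciSup_le fun z => by have := main3 (-u) z; simpa using this
        · rw [← hvaln]
          exact le_ciSup (f := fun z => Theta γ 1 (-u) z) ⟨0, by rintro _ ⟨z, rfl⟩; have := main3 (-u) z; simpa using this⟩ (-x)
      · intro E hE
        by_contra hc
        push Not at hc
        have : (⨆ x : ℝ, Theta γ 1 E x) ≤ y * (E + u) := ciSup_le fun z => main3 E z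
        rw [hE] at this
        nlinarith
    rw [this.csInf_eq, neg_neg]
  have hX : x0 γ = x := by
    unfold x0
    rw [hE]
    have : {z : ℝ | ∀ y : ℝ, Theta γ 1 (-u) y ≤ Theta γ 1 (-u) z} = {-x} := by
      ext z
      simp only [mem_ofPred_eq, mem_singleton_iff]
      constructor
      · intro h
        have h1 := h (-x)
        rw [hvaln] at h1
        have h2 := main u (-z)
        rw [← hThn, neg_neg] at h2
        have h3 := h1.trans h2
        by_contra hne
        have h5 : 0 < (-z - x) ^ 2 := by
          have : -z - x ≠ 0 := fun h => hne (by linarith)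
          positivity
        have h6 : (-z - x) ^ 2 / (4 * n2) < 1 / 2 * ((-z - x) ^ 2 / (n2 + n1 - n1 ^ 2)) := by
          rw [div_lt_iff₀ (by positivity)]
          have : n2 + n1 - n1 ^ 2 ≤ n2 := by nlinarith
          have h7 : (-z - x) ^ 2 / n2 ≤ (-z - x) ^ 2 / (n2 + n1 - n1 ^ 2) := by gcongr
          have h8 : (-z - x) ^ 2 / n2 * n2 = (-z - x) ^ 2 := by field_simp
          nlinarith
        simp at h3
        rw [one_div] at h6
        linarith
      · rintro rfl z
        rw [hvaln]
        have := main3 (-u) z; simpa using this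
    rw [this, csSup_singleton, neg_neg]
  refine ⟨y, m, hypos, hm0, hm1, by linarith, h12, hE, hX, hrel, ?_, ?_, ?_⟩
  · rw [hE]; exact hmT
  · rw [hE, hX]; exact hvaln
  · rw [hX]; exact hom

/-- quadratic form V in terms of numbers -/
def VV (n0 n1 n2 A B C r a b c : ℝ) : ℝ :=
  2 * a ^ 2 * (n0 + A) + 4 * b ^ 2 * (1 + r) * (n1 + B + (1 + r) / 2 * (n2 + C))
    + 4 * c ^ 2 * (1 - r) * (n1 - B + (1 - r) / 2 * (n2 + C))
    + 4 * a * b * (1 + r) * (n1 + B) + 4 * a * c * (1 - r) * (n1 - B)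
    + 4 * b * c * (1 - r ^ 2) * (n2 - C)

/-- exponent F -/
def FF (δ n0 n1 n2 A B C u x Q r a b c : ℝ) : ℝ :=
  1 / 2 * Real.log (1 - r ^ 2) - 1 / 2 * Real.log ((n1 + δ ^ 2) ^ 2 - B ^ 2) + Real.log (n1 + δ ^ 2)
    - (2 * a * u + 2 * b * (1 + r) * x + 2 * c * (1 - r) * x) + 1 / 2 * VV n0 n1 n2 A B C r a b c
    + δ ^ 2 * (a ^ 2 + 2 * b ^ 2 * (1 + r) + 2 * c ^ 2 * (1 - r)) + 2 * Q

def Ff (γ : ℕ → ℝ) (δ u x Q r a b c : ℝ) : ℝ :=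
  FF δ (nuF γ 1) (nuD1 γ 1) (nuD2 γ 1) (nuF γ r) (nuD1 γ r) (nuD2 γ r) u x Q r a b c

def Q1 (γ : ℕ → ℝ) (y m : ℝ) : ℝ :=
  (nuF γ 1 * y ^ 2 + 2 * nuD1 γ 1 * y * m + (nuD1 γ 1 + nuD2 γ 1) * m ^ 2) / 2

lemma Q1_eq {γ : ℕ → ℝ} (hn : nuF γ 1 = 1) {y m : ℝ} (h : Pars γ y m) :
    2 * Q1 γ y m = y * E0 γ + m * x0 γ ∧
    2 * Q1 γ y m = 1 + Real.log (nuD2 γ 1 / nuD1 γ 1) + 2 * Omega (x0 γ / Real.sqrt (nuD2 γ 1)) := by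
  have h1 : 2 * Q1 γ y m = y * E0 γ + m * x0 γ := by
    rw [h.e, h.x]; unfold Q1; rw [hn]; ring
  refine ⟨h1, ?_⟩
  have hn1 : 0 < nuD1 γ 1 := by linarith [h.n1_ge]
  have hn2 : 0 < nuD2 γ 1 := by linarith [h.n12]
  have hm := h.m_pos
  have hmx : m * x0 γ = 1 + nuD2 γ 1 * m ^ 2 := by rw [h.x]; linear_combination h.rel
  have hs : 0 < Real.sqrt (nuD2 γ 1) := Real.sqrt_pos.2 hn2
  have e1 : Real.log (Real.sqrt (nuD2 γ 1)) = Real.log (nuD2 γ 1) / 2 := Real.log_sqrt hn2.le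
  rw [h1, h.ye, hmx, h.om, Real.log_mul hs.ne' hm.ne', e1, Real.log_div hn2.ne' hn1.ne',
    Real.log_mul hn1.ne' (by positivity), Real.log_pow]
  push_cast; ring

/-- algebraic identity for interior point -/
lemma VV_interior (n0 n1 n2 A B C r w1 w2 h : ℝ) (hh : h ^ 2 * (n1 - (r * B - C * (1 - r ^ 2))) = h) :
    ∃ b c : ℝ, b * (1 + r) + c * (1 - r) = w2 ∧
    VV n0 n1 n2 A B C r w1 b c = 2 * w1 ^ 2 * (n0 + A - h * B ^ 2 * (1 - r ^ 2))
      + 4 * w1 * w2 * (n1 + r * B - h * (1 - r ^ 2) * B * (r * C + B))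
      + 2 * w2 ^ 2 * (n2 + n1 + r ^ 2 * C + r * B - h * (r * C + B) ^ 2 * (1 - r ^ 2)) := by
  have hk := hh
  set k : ℝ := - h * (w1 * B + w2 * (r * C + B)) with hkdef
  refine ⟨(w2 + k * (1 - r)) / 2, (w2 - k * (1 + r)) / 2, by ring, ?_⟩
  have e : VV n0 n1 n2 A B C r w1 ((w2 + k * (1 - r)) / 2) ((w2 - k * (1 + r)) / 2) =
     2 * w1 ^ 2 * (n0 + A) + 4 * w1 * w2 * (n1 + r * B) + 2 * w2 ^ 2 * (n2 + n1 + r ^ 2 * C + r * B)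
      + 4 * (1 - r ^ 2) * k * (w1 * B + w2 * (r * C + B)) + 2 * (1 - r ^ 2) * (n1 - (r * B - C * (1 - r ^ 2))) * k ^ 2 := by
    unfold VV; ring
  rw [e, hkdef]
  linear_combination 2 * (1 - r ^ 2) * (w1 * B + w2 * (r * C + B)) ^ 2 * hh

lemma SigmaUX_swap (γ : ℕ → ℝ) (r : ℝ) :
    (SigmaUX γ r 1 1).submatrix (Equiv.sumCongr (Equiv.swap (0 : Fin 2) 1) (Equiv.swap (0 : Fin 2) 1))
      (Equiv.sumCongr (Equiv.swap (0 : Fin 2) 1) (Equiv.swap (0 : Fin 2) 1)) = SigmaUX γ r 1 1 := by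
  ext i j
  rcases i with i | i <;> rcases j with j | j <;> fin_cases i <;> fin_cases j <;>
    simp [SigmaUX, SigmaU, SigmaB, SigmaX]

lemma interior_exists {γ : ℕ → ℝ} (hn : nuF γ 1 = 1) (r u x : ℝ) :
    ∃ a b c : ℝ, - (2 * a * u + 2 * b * (1 + r) * x + 2 * c * (1 - r) * x)
      + 1 / 2 * VV (nuF γ 1) (nuD1 γ 1) (nuD2 γ 1) (nuF γ r) (nuD1 γ r) (nuD2 γ r) r a b c
      = - (1 / 2) * ((Sum.elim ![-u, -u] ![-x, -x]) ⬝ᵥ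
        ((SigmaUX γ r 1 1)⁻¹ *ᵥ (Sum.elim ![-u, -u] ![-x, -x]))) := by
  set S := SigmaUX γ r 1 1 with hS
  set z : Fin 2 ⊕ Fin 2 → ℝ := Sum.elim ![u, u] ![x, x] with hz
  have hzn : (Sum.elim ![-u, -u] ![-x, -x] : Fin 2 ⊕ Fin 2 → ℝ) = -z := by
    ext i; rcases i with i | i <;> fin_cases i <;> simp [z]
  set w := S⁻¹ *ᵥ z with hw
  set e := (Equiv.sumCongr (Equiv.swap (0 : Fin 2) 1) (Equiv.swap (0 : Fin 2) 1)) with he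
  have hze : z ∘ e = z := by
    ext i; rcases i with i | i <;> fin_cases i <;> simp [z, e]
  have hwe : w ∘ e = w := by
    have h1 : S⁻¹.submatrix e e = S⁻¹ := by
      rw [← Matrix.inv_submatrix_equiv, hS, SigmaUX_swap]
    have h2 : (S⁻¹.submatrix e e) *ᵥ (z ∘ e) = w ∘ e := by
      rw [Matrix.submatrix_mulVec_equiv]
      congr 2
      ext i; simp
    rw [← h2, h1, hze]
  have hw1 : w (Sum.inl 1) = w (Sum.inl 0) := by
    have := congrFun hwe (Sum.inl 0); simpa [e] using this
  have hw2 : w (Sum.inr 1) = w (Sum.inr 0) := by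
    have := congrFun hwe (Sum.inr 0); simpa [e] using this
  have hquad : w ⬝ᵥ (S *ᵥ w) = w ⬝ᵥ z := by
    by_cases hd : IsUnit S.det
    · rw [hw, Matrix.mulVec_mulVec, Matrix.mul_nonsing_inv S hd, Matrix.one_mulVec]
    · have : w = 0 := by rw [hw, Matrix.nonsing_inv_apply_not_isUnit _ hd, Matrix.zero_mulVec]
      rw [this]; simp
  set B := nuD1 γ r
  set C := nuD2 γ r
  set n1 := nuD1 γ 1
  set h := a2 γ r 1 1 - a4 γ r 1 1 with hh
  have hd : dA γ r 1 1 = r * B - C * (1 - r ^ 2) := by simp [dA, B, C]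
  have hcond : h ^ 2 * (n1 - (r * B - C * (1 - r ^ 2))) = h := by
    rw [← hd]
    have : h = (n1 + dA γ r 1 1) / (n1 * n1 - dA γ r 1 1 ^ 2) := by
      simp only [hh, a2, a4, one_pow]; ring
    rw [this]
    by_cases h0 : n1 * n1 - dA γ r 1 1 ^ 2 = 0
    · rw [h0]; simp
    · rw [div_pow, div_mul_eq_mul_div, div_eq_div_iff (pow_ne_zero 2 h0) h0]; ring
  obtain ⟨b, c, hbc, hV⟩ := VV_interior (nuF γ 1) n1 (nuD2 γ 1) (nuF γ r) B C r (w (Sum.inl 0)) (w (Sum.inr 0)) h hcond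
  refine ⟨w (Sum.inl 0), b, c, ?_⟩
  rw [hV, hzn, Matrix.mulVec_neg, neg_dotProduct_neg, ← hw, dotProduct_comm z w]
  have hwz : w ⬝ᵥ z = 2 * w (Sum.inl 0) * u + 2 * w (Sum.inr 0) * x := by
    simp only [dotProduct, Fintype.sum_sum_type, Fin.sum_univ_two, hw1, hw2]
    simp [z]; ring
  have hlin : 2 * w (Sum.inl 0) * u + 2 * b * (1 + r) * x + 2 * c * (1 - r) * x = w ⬝ᵥ z := by
    rw [hwz, ← hbc]; ring
  have hq : w ⬝ᵥ (S *ᵥ w) = 2 * w (Sum.inl 0) ^ 2 * (nuF γ 1 + nuF γ r - h * B ^ 2 * (1 - r ^ 2))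
      + 4 * w (Sum.inl 0) * w (Sum.inr 0) * (n1 + r * B - h * (1 - r ^ 2) * B * (r * C + B))
      + 2 * w (Sum.inr 0) ^ 2 * (nuD2 γ 1 + n1 + r ^ 2 * C + r * B - h * (r * C + B) ^ 2 * (1 - r ^ 2)) := by
    simp only [dotProduct, Matrix.mulVec, Fintype.sum_sum_type, Fin.sum_univ_two, hw1, hw2]
    simp [S, SigmaUX, SigmaU, SigmaB, SigmaX, ups]
    rw [hh]
    ring
  rw [hlin, ← hq, hquad]
  ring

lemma Ff_interior {γ : ℕ → ℝ} (hγ : GammaDecay γ) (hn : nuF γ 1 = 1) {y m : ℝ} (hp : Pars γ y m)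
    {r : ℝ} (hr : r ∈ Ioo (-1 : ℝ) 1) :
    ∃ a b c : ℝ, Ff γ 0 (E0 γ) (x0 γ) (Q1 γ y m) r a b c = Psi0 γ r := by
  obtain ⟨a, b, c, h⟩ := interior_exists (γ := γ) hn r (E0 γ) (x0 γ)
  refine ⟨a, b, c, ?_⟩
  have hn1 : 0 < nuD1 γ 1 := by linarith [hp.n1_ge]
  have hn2 : 0 < nuD2 γ 1 := by linarith [hp.n12]
  have hr1 : |r| < 1 := abs_lt.2 hr
  have hr2 : 0 < 1 - r ^ 2 := by have := (sq_lt_one_iff_abs_lt_one r).2 hr1; linarith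
  have hB : nuD1 γ r ^ 2 < nuD1 γ 1 ^ 2 := by
    rw [sq_lt_sq, abs_of_pos hn1]
    exact (nuD1_abs_le hγ hr1.le).trans_lt (by nlinarith)
  have hB' : 0 < nuD1 γ 1 ^ 2 - nuD1 γ r ^ 2 := by linarith
  unfold Ff FF Psi0 Psi
  simp only [one_pow, one_mul, mul_one]
  have e0 : (nuD1 γ 1 + 0 ^ 2) = nuD1 γ 1 := by ring
  rw [e0, neg_div, Omega_neg]
  have e1 : nuD1 γ 1 * nuD1 γ 1 - nuD1 γ r ^ 2 = nuD1 γ 1 ^ 2 - nuD1 γ r ^ 2 := by ring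
  rw [e1, Real.log_div (by positivity) hB'.ne', Real.log_mul hr2.ne' (by positivity), Real.log_mul hn2.ne' hn2.ne']
  have e2 := (Q1_eq hn hp).2
  rw [Real.log_div hn2.ne' hn1.ne'] at e2
  linarith

lemma Psi0_zero {γ : ℕ → ℝ} (hγ : GammaDecay γ) (hn : nuF γ 1 = 1) (hm : Mixed γ) {y m : ℝ} (hp : Pars γ y m) : Psi0 γ 0 = 0 := by
  have hth := hp.th
  have hD := nu_cs hγ hm hn
  have hn1 : 0 < nuD1 γ 1 := by linarith [hp.n1_ge]
  have hn2 : 0 < nuD2 γ 1 := by linarith [hp.n12]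
  rw [Theta_form γ hn] at hth
  unfold Psi0 Psi
  simp only [one_pow, one_mul, mul_one, mul_zero]
  obtain ⟨z0, z1⟩ := nu_zero γ
  set u := E0 γ
  set x := x0 γ
  set n1 := nuD1 γ 1
  set n2 := nuD2 γ 1
  set D := n2 + n1 - n1 ^ 2
  have hS : SigmaUX γ 0 1 1 = Matrix.fromBlocks 1 (n1 • (1 : Matrix (Fin 2) (Fin 2) ℝ)) (n1 • (1 : Matrix (Fin 2) (Fin 2) ℝ)) ((n1 + n2) • (1 : Matrix (Fin 2) (Fin 2) ℝ)) := by
    ext i j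
    rcases i with i | i <;> rcases j with j | j <;> fin_cases i <;> fin_cases j <;>
      simp [SigmaUX, SigmaU, SigmaB, SigmaX, ups, z0, z1, hn, n1, n2, add_comm]
  have hinv : (SigmaUX γ 0 1 1)⁻¹ = Matrix.fromBlocks (((n1 + n2) / D) • (1 : Matrix (Fin 2) (Fin 2) ℝ)) ((-n1 / D) • (1 : Matrix (Fin 2) (Fin 2) ℝ)) ((-n1 / D) • (1 : Matrix (Fin 2) (Fin 2) ℝ)) ((1 / D) • (1 : Matrix (Fin 2) (Fin 2) ℝ)) := by
    apply Matrix.inv_eq_right_inv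
    rw [hS, Matrix.fromBlocks_multiply, ← Matrix.fromBlocks_one]
    have hDne : D ≠ 0 := hD.ne'
    congr 1
    · ext i j; fin_cases i <;> fin_cases j <;> simp; all_goals field_simp; simp only [D]; ring
    · ext i j; fin_cases i <;> fin_cases j <;> simp; all_goals field_simp; ring
    · ext i j; fin_cases i <;> fin_cases j <;> simp; all_goals field_simp; ring
    · ext i j; fin_cases i <;> fin_cases j <;> simp; all_goals field_simp; simp only [D]; ring
  have hq : (Sum.elim ![-u, -u] ![-x, -x] : Fin 2 ⊕ Fin 2 → ℝ) ⬝ᵥ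
        ((SigmaUX γ 0 1 1)⁻¹ *ᵥ (Sum.elim ![-u, -u] ![-x, -x])) = 2 * (((n2 + n1) * (-u) ^ 2 - 2 * n1 * (-u) * (-x) + (-x) ^ 2) / D) := by
    rw [hinv]
    simp only [dotProduct, Matrix.mulVec, Fintype.sum_sum_type, Fin.sum_univ_two]
    simp
    ring
  rw [hq, z1]
  have e : Real.log ((1 - 0 ^ 2) * (n2 * n2) / (n1 * n1 - 0 ^ 2)) = 2 * Real.log (n2 / n1) := by
    rw [show (1 - 0 ^ 2) * (n2 * n2) / (n1 * n1 - 0 ^ 2) = (n2 / n1) ^ 2 by field_simp; ring, Real.log_pow]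
    push_cast; ring
  rw [e]
  linarith

lemma log_ineq {w q : ℝ} (hw0 : 0 < w) (hw1 : w ≤ 1) (hq0 : 0 < q) (hq1 : q ≤ 1) :
    Real.log w - Real.log q ≤ (1 + q) * (w - q) / (q * (1 + w)) := by
  let g : ℝ → ℝ := fun w => (1 + q) * (w - q) / (q * (1 + w)) - Real.log w
  have hder : ∀ z, 0 < z → HasDerivAt g ((z - q) * (1 - q * z) / (q * z * (1 + z) ^ 2)) z := by
    intro z hz
    have h1 : HasDerivAt (fun w : ℝ => (1 + q) * (w - q)) ((1 + q) * 1) z :=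
      ((hasDerivAt_id z).sub_const q).const_mul (1 + q)
    have h2 : HasDerivAt (fun w : ℝ => q * (1 + w)) (q * 1) z :=
      ((hasDerivAt_id z).const_add 1).const_mul q
    have h3 := (h1.div h2 (by positivity)).sub (Real.hasDerivAt_log hz.ne')
    refine (h3.congr_of_eventuallyEq (Eventually.of_forall fun z => rfl)).congr_deriv ?_
    field_simp; ring
  have hgq : g q = - Real.log q := by simp [g]
  suffices h : g q ≤ g w by
    rw [hgq] at h; simp only [g] at h; linarith
  rcases le_total w q with h | h
  · have : AntitoneOn g (Icc w q) := by
      refine antitoneOn_of_deriv_nonpos (convex_Icc _ _) ?_ ?_ ?_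
      · exact fun z hz => (hder _ (hw0.trans_le hz.1)).continuousAt.continuousWithinAt
      · rw [interior_Icc]; exact fun z hz => (hder _ (hw0.trans hz.1)).differentiableAt.differentiableWithinAt
      · rw [interior_Icc]; intro z hz
        have hz0 := hw0.trans hz.1
        rw [(hder _ hz0).deriv]
        refine div_nonpos_of_nonpos_of_nonneg ?_ (by positivity)
        refine mul_nonpos_of_nonpos_of_nonneg (by linarith [hz.2]) ?_
        nlinarith [hz.2]
    exact this ⟨le_rfl, h⟩ ⟨h, le_rfl⟩ h
  · have : MonotoneOn g (Icc q w) := by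
      refine monotoneOn_of_deriv_nonneg (convex_Icc _ _) ?_ ?_ ?_
      · exact fun z hz => (hder _ (hq0.trans_le hz.1)).continuousAt.continuousWithinAt
      · rw [interior_Icc]; exact fun z hz => (hder _ (hq0.trans hz.1)).differentiableAt.differentiableWithinAt
      · rw [interior_Icc]; intro z hz
        have hz0 := hq0.trans hz.1
        rw [(hder _ hz0).deriv]
        refine div_nonneg ?_ (by positivity)
        refine mul_nonneg (by linarith [hz.1]) ?_
        nlinarith [hz.2]
    exact this ⟨le_rfl, h⟩ ⟨h, le_rfl⟩ h

set_option maxHeartbeats 1000000 in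
lemma near1_bound {n1 n2 A B C u x Q y m t δ : ℝ} (hn1 : 0 < n1) (hn2 : 0 < n2) (hy : 0 < y) (hm : 0 < m)
    (hq : n2 * m ^ 2 < 1) (hu : u = y + n1 * m) (hx : x = n1 * y + (n1 + n2) * m)
    (hrel : n1 * m * (y + m) = 1) (hyu : y * u = - Real.log (n1 * m ^ 2))
    (hQ : 2 * Q = y * u + m * x) (ht0 : 0 < t) (ht1 : t ≤ 1) (hδ : 0 < δ) (hA : A ≤ 1)
    (hC0 : 0 < C) (hC : C ≤ n2) (hB0 : 0 ≤ B) (hB1 : B ≤ n1) (hd1 : t * C ≤ n1 - B) (hd2 : n1 - B ≤ t * n2) :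
    FF δ 1 n1 n2 A B C u x Q (1 - t) (y / 2) (m / 4) (x / (4 * t * n2 + 2 * δ ^ 2)) ≤
      m * t * x / 2 + y * x * t / 4 + m * x * (n2 - C) / (4 * n2) + δ ^ 2 * (y ^ 2 + m ^ 2) / 4
       + 1 / 2 * Real.log (2 * (n1 + δ ^ 2) ^ 2 / (n1 * (n1 + δ ^ 2 + B))) + 1 / 2 * Real.log (n2 / C) := by
  have hxp : 0 < x := by rw [hx]; positivity
  have hden : 0 < 4 * t * n2 + 2 * δ ^ 2 := by positivity
  set c := x / (4 * t * n2 + 2 * δ ^ 2) with hc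
  have hcp : 0 < c := by positivity
  have hcx : c * (4 * t * n2 + 2 * δ ^ 2) = x := by rw [hc]; field_simp
  have hct : c * t ≤ x / (4 * n2) := by
    rw [le_div_iff₀ (by positivity)]
    have : 0 < c * (2 * δ ^ 2) := by positivity
    linarith
  set q := n2 * m ^ 2 with hqdef
  have hq0 : 0 < q := by positivity
  have hmx : m * x = 1 + q := by rw [hx, hqdef]; linear_combination hrel
  have hQu : 2 * Q = y ^ 2 + 2 * n1 * y * m + (n1 + n2) * m ^ 2 := by rw [hQ, hu, hx]; ring
  have h2t : 0 ≤ 2 - t := by linarith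
  -- polynomial part
  have p1 : (y / 2) ^ 2 * (1 + A) ≤ y ^ 2 / 2 := by linarith [mul_nonneg (sq_nonneg y) (sub_nonneg.2 hA)]
  have p2 : 2 * (m / 4) ^ 2 * (2 - t) * (n1 + B + (2 - t) / 2 * (n2 + C)) ≤ (n1 + n2) * m ^ 2 / 2 := by
    have h1 : n1 + B + (2 - t) / 2 * (n2 + C) ≤ 2 * n1 + 2 * n2 := by
      linarith [mul_le_mul_of_nonneg_left hC h2t, mul_pos ht0 hn2]
    have h0 : 0 ≤ n1 + B + (2 - t) / 2 * (n2 + C) := by positivity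
    have h3 : (2 - t) * (n1 + B + (2 - t) / 2 * (n2 + C)) ≤ 2 * (2 * n1 + 2 * n2) := by
      linarith [mul_le_mul_of_nonneg_left h1 h2t, mul_pos ht0 hn1, mul_pos ht0 hn2]
    linarith [mul_le_mul_of_nonneg_left h3 (sq_nonneg m)]
  have p3 : 2 * c ^ 2 * t * (n1 - B + t / 2 * (n2 + C)) ≤ 4 * c ^ 2 * t ^ 2 * n2 := by
    have h1 : n1 - B + t / 2 * (n2 + C) ≤ 2 * t * n2 := by linarith [mul_le_mul_of_nonneg_left hC ht0.le]
    linarith [mul_le_mul_of_nonneg_left h1 (show 0 ≤ c ^ 2 * t by positivity)]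
  have p4 : 2 * (y / 2) * (m / 4) * (2 - t) * (n1 + B) ≤ y * m * n1 := by
    have h3 : (2 - t) * (n1 + B) ≤ 4 * n1 := by linarith [mul_nonneg h2t (sub_nonneg.2 hB1), mul_pos ht0 hn1]
    linarith [mul_le_mul_of_nonneg_left h3 (show 0 ≤ y * m by positivity)]
  have p5 : 2 * (y / 2) * c * t * (n1 - B) ≤ y * x * t / 4 := by
    have h1 : c * t * (n1 - B) ≤ x / (4 * n2) * (t * n2) := by gcongr
    have h2 : x / (4 * n2) * (t * n2) = x * t / 4 := by field_simp
    rw [h2] at h1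
    linarith [mul_le_mul_of_nonneg_left h1 hy.le]
  have p6 : 2 * (m / 4) * c * (t * (2 - t)) * (n2 - C) ≤ m * x * (n2 - C) / (4 * n2) := by
    have h0 : 0 ≤ n2 - C := by linarith
    have h1 : (c * t) * (2 - t) ≤ x / (4 * n2) * 2 := by gcongr; linarith
    have h2 : m * x * (n2 - C) / (4 * n2) = 2 * (m / 4) * (x / (4 * n2) * 2) * (n2 - C) := by field_simp; norm_num
    rw [h2]
    have := mul_le_mul_of_nonneg_left h1 (show 0 ≤ 2 * (m / 4) * (n2 - C) by positivity)
    linarith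
  have p7 : δ ^ 2 * ((y / 2) ^ 2 + 2 * (m / 4) ^ 2 * (2 - t)) ≤ δ ^ 2 * (y ^ 2 + m ^ 2) / 4 := by
    have : (y / 2) ^ 2 + 2 * (m / 4) ^ 2 * (2 - t) ≤ (y ^ 2 + m ^ 2) / 4 := by linarith [mul_nonneg ht0.le (sq_nonneg m)]
    linarith [mul_le_mul_of_nonneg_left this (sq_nonneg δ)]
  have p8 : 4 * c ^ 2 * t ^ 2 * n2 + δ ^ 2 * (2 * c ^ 2 * t) = c * t * x := by
    rw [← hcx]; ring
  set w := t * n2 / (t * n2 + δ ^ 2) with hw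
  have hw0 : 0 < w := by positivity
  have hw1 : w ≤ 1 := by rw [hw, div_le_one (by positivity)]; linarith [sq_nonneg δ]
  have hctx : c * t * x = (1 + q) ^ 2 / q * w / (2 * (1 + w)) := by
    have e1 : (1 + q) ^ 2 / q = x ^ 2 / n2 := by
      rw [← hmx, hqdef]; field_simp
    rw [e1, hc, hw]; field_simp; ring
  have hli := log_ineq hw0 hw1 hq0 hq.le
  -- log part
  have hD : 0 < δ ^ 2 + t * C := by positivity
  have hE : 0 < n1 + δ ^ 2 + B := by positivity
  have hlogmain : 1 / 2 * Real.log (1 - (1 - t) ^ 2) - 1 / 2 * Real.log ((n1 + δ ^ 2) ^ 2 - B ^ 2) + Real.log (n1 + δ ^ 2)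
      ≤ 1 / 2 * Real.log w + 1 / 2 * (Real.log n1 - Real.log n2) + 1 / 2 * Real.log (2 * (n1 + δ ^ 2) ^ 2 / (n1 * (n1 + δ ^ 2 + B))) + 1 / 2 * Real.log (n2 / C) := by
    have l1 : Real.log (1 - (1 - t) ^ 2) ≤ Real.log t + Real.log 2 := by
      rw [← Real.log_mul ht0.ne' (by norm_num)]
      apply Real.log_le_log <;> linarith [mul_pos ht0 ht0, mul_nonneg ht0.le (sub_nonneg.2 ht1)]
    have l2 : Real.log (δ ^ 2 + t * C) + Real.log (n1 + δ ^ 2 + B) ≤ Real.log ((n1 + δ ^ 2) ^ 2 - B ^ 2) := by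
      rw [← Real.log_mul hD.ne' hE.ne']
      apply Real.log_le_log (by positivity)
      rw [show (n1 + δ ^ 2) ^ 2 - B ^ 2 = (n1 + δ ^ 2 - B) * (n1 + δ ^ 2 + B) by ring]
      gcongr; linarith
    have l3 : Real.log C - Real.log n2 + Real.log (t * n2 + δ ^ 2) ≤ Real.log (δ ^ 2 + t * C) := by
      rw [← Real.log_div hC0.ne' hn2.ne', ← Real.log_mul (by positivity) (by positivity)]
      apply Real.log_le_log (by positivity)
      rw [div_mul_eq_mul_div, div_le_iff₀ hn2]
      linarith [mul_le_mul_of_nonneg_right hC (sq_nonneg δ)]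
    have l4 : Real.log w = Real.log t + Real.log n2 - Real.log (t * n2 + δ ^ 2) := by
      rw [hw, Real.log_div (by positivity) (by positivity), Real.log_mul ht0.ne' hn2.ne']
    have l5 : Real.log (2 * (n1 + δ ^ 2) ^ 2 / (n1 * (n1 + δ ^ 2 + B))) = Real.log 2 + 2 * Real.log (n1 + δ ^ 2) - Real.log n1 - Real.log (n1 + δ ^ 2 + B) := by
      rw [Real.log_div (by positivity) (by positivity), Real.log_mul (by norm_num) (by positivity), Real.log_mul hn1.ne' hE.ne', Real.log_pow]
      push_cast; ring
    have l6 : Real.log (n2 / C) = Real.log n2 - Real.log C := Real.log_div hn2.ne' hC0.ne'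
    rw [l4, l5, l6]
    linarith
  have hQlog : 2 * Q = 1 + q + (Real.log n2 - Real.log n1) - Real.log q := by
    rw [hQ, hyu, hmx, hqdef, Real.log_mul hn2.ne' (by positivity), Real.log_mul hn1.ne' (by positivity)]
    ring
  have hfin : 1 / 2 * Real.log w - (1 + q) ^ 2 / q * w / (2 * (1 + w)) + (1 + q) / 2 - 1 / 2 * Real.log q ≤ 0 := by
    have : (1 + q) * (w - q) / (q * (1 + w)) = 2 * ((1 + q) ^ 2 / q * w / (2 * (1 + w))) - (1 + q) := by
      field_simp; ring
    rw [this] at hli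
    linarith
  unfold FF VV
  rw [show (1:ℝ) - (1 - t) = t by ring, show (1:ℝ) + (1 - t) = 2 - t by ring,
    show (1:ℝ) - (1 - t) ^ 2 = t * (2 - t) by ring]
  rw [show (1:ℝ) - (1 - t) ^ 2 = t * (2 - t) by ring] at hlogmain
  linarith [p1, p2, p3, p4, p5, p6, p7, p8, hctx, hlogmain, hQlog, hfin, hQu]

open Topology in
/-- local property -/
def PC (F : ℝ → ℝ → ℝ → ℝ → ℝ → ℝ) (ε : ℝ) (S : Set ℝ) : Prop :=
  ∃ δ0 > 0, ∀ δ, 0 < δ → δ < δ0 → ∃ B, ∀ r ∈ S, r ∈ Ioo (-1 : ℝ) 1 →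
    ∃ a b c : ℝ, |a| ≤ B ∧ |b| ≤ B ∧ |c| ≤ B ∧ F δ r a b c ≤ ε

open Topology in
lemma PC_of_ev {F : ℝ → ℝ → ℝ → ℝ → ℝ → ℝ} {ε r0 : ℝ} (B : ℝ → ℝ)
    (h : ∀ᶠ q in 𝓝[Ioo (-1) 1] r0 ×ˢ 𝓝[>] (0 : ℝ), ∃ a b c, |a| ≤ B q.2 ∧ |b| ≤ B q.2 ∧ |c| ≤ B q.2 ∧
      F q.2 q.1 a b c ≤ ε) : ∃ t ∈ 𝓝 r0, PC F ε t := by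
  obtain ⟨pa, hpa, pb, hpb, hab⟩ := eventually_prod_iff.1 h
  rw [eventually_nhdsWithin_iff] at hpa
  refine ⟨_, hpa, ?_⟩
  obtain ⟨δ0, hδ0, hsub⟩ := (mem_nhdsGT_iff_exists_Ioo_subset).1 hpb
  refine ⟨δ0, hδ0, fun δ h1 h2 => ⟨B δ, fun r hr hr1 => ?_⟩⟩
  exact hab (hr hr1) (hsub ⟨h1, h2⟩)

lemma PC_union {F : ℝ → ℝ → ℝ → ℝ → ℝ → ℝ} {ε : ℝ} {s t : Set ℝ} (hs : PC F ε s) (ht : PC F ε t) : PC F ε (s ∪ t) := by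
  obtain ⟨d1, h1, H1⟩ := hs
  obtain ⟨d2, h2, H2⟩ := ht
  refine ⟨min d1 d2, lt_min h1 h2, fun δ hδ hlt => ?_⟩
  obtain ⟨B1, K1⟩ := H1 δ hδ (hlt.trans_le (min_le_left _ _))
  obtain ⟨B2, K2⟩ := H2 δ hδ (hlt.trans_le (min_le_right _ _))
  refine ⟨max B1 B2, fun r hr hr1 => ?_⟩
  rcases hr with hr | hr
  · obtain ⟨a, b, c, ha, hb, hc, hF⟩ := K1 r hr hr1
    exact ⟨a, b, c, ha.trans (le_max_left _ _), hb.trans (le_max_left _ _), hc.trans (le_max_left _ _), hF⟩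
  · obtain ⟨a, b, c, ha, hb, hc, hF⟩ := K2 r hr hr1
    exact ⟨a, b, c, ha.trans (le_max_right _ _), hb.trans (le_max_right _ _), hc.trans (le_max_right _ _), hF⟩

open Topology in
lemma PC_compact {F : ℝ → ℝ → ℝ → ℝ → ℝ → ℝ} {ε : ℝ}
    (h : ∀ r0 ∈ Icc (-1 : ℝ) 1, ∃ t ∈ 𝓝 r0, PC F ε t) : PC F ε (Icc (-1) 1) := by
  refine isCompact_Icc.induction_on (p := PC F ε) ?_ ?_ ?_ ?_
  · exact ⟨1, one_pos, fun δ _ _ => ⟨0, by simp⟩⟩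
  · rintro s t hst ⟨d, hd, H⟩
    refine ⟨d, hd, fun δ h1 h2 => ?_⟩
    obtain ⟨B, hB⟩ := H δ h1 h2
    exact ⟨B, fun r hr => hB r (hst hr)⟩
  · intro s t hs ht; exact PC_union hs ht
  · intro r hr
    obtain ⟨t, ht, hP⟩ := h r hr
    exact ⟨t, mem_nhdsWithin_of_mem_nhds ht, hP⟩

section
variable {γ : ℕ → ℝ}

lemma contAt_int (hγ : GammaDecay γ) {r : ℝ} (hr : r ∈ Ioo (-1:ℝ) 1) :
    ContinuousAt (nuF γ) r ∧ ContinuousAt (nuD1 γ) r ∧ ContinuousAt (nuD2 γ) r := by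
  have := Icc_mem_nhds hr.1 hr.2
  exact ⟨(contF hγ).continuousAt this, (contD1 hγ).continuousAt this, (contD2 hγ).continuousAt this⟩

open Topology in
lemma loc_int (hγ : GammaDecay γ) (hn : nuF γ 1 = 1) {y m : ℝ} (hp : Pars γ y m)
    (hPsi : ∀ r ∈ Ioo (-1:ℝ) 1, Psi0 γ r ≤ 0) {ε : ℝ} (hε : 0 < ε) {r : ℝ} (hr : r ∈ Ioo (-1:ℝ) 1) :
    ∃ t ∈ 𝓝 r, PC (fun δ r a b c => Ff γ δ (E0 γ) (x0 γ) (Q1 γ y m) r a b c) ε t := by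
  obtain ⟨a, b, c, h⟩ := Ff_interior hγ hn hp hr
  have hle := hPsi r hr
  rw [← h] at hle
  have hn1 : 0 < nuD1 γ 1 := by linarith [hp.n1_ge]
  have hr1 : |r| < 1 := abs_lt.2 hr
  have hr2 : 0 < 1 - r ^ 2 := by have := (sq_lt_one_iff_abs_lt_one r).2 hr1; linarith
  have hB : nuD1 γ r ^ 2 < nuD1 γ 1 ^ 2 := by
    rw [sq_lt_sq, abs_of_pos hn1]
    exact (nuD1_abs_le hγ hr1.le).trans_lt (by nlinarith)
  obtain ⟨c0, c1, c2⟩ := contAt_int hγ hr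
  have hcont : ContinuousAt (fun q : ℝ × ℝ => Ff γ q.2 (E0 γ) (x0 γ) (Q1 γ y m) q.1 a b c) (r, 0) := by
    have d0 : ContinuousAt (fun q : ℝ × ℝ => nuF γ q.1) (r, 0) := Filter.Tendsto.comp (show Tendsto _ (nhds r) _ from c0) (show Tendsto (Prod.fst : ℝ × ℝ → ℝ) (nhds (r, (0:ℝ))) (nhds r) from continuousAt_fst)
    have d1 : ContinuousAt (fun q : ℝ × ℝ => nuD1 γ q.1) (r, 0) := Filter.Tendsto.comp (show Tendsto _ (nhds r) _ from c1) (show Tendsto (Prod.fst : ℝ × ℝ → ℝ) (nhds (r, (0:ℝ))) (nhds r) from continuousAt_fst)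
    have d2 : ContinuousAt (fun q : ℝ × ℝ => nuD2 γ q.1) (r, 0) := Filter.Tendsto.comp (show Tendsto _ (nhds r) _ from c2) (show Tendsto (Prod.fst : ℝ × ℝ → ℝ) (nhds (r, (0:ℝ))) (nhds r) from continuousAt_fst)
    have l1 : ContinuousAt (fun q : ℝ × ℝ => Real.log (1 - q.1 ^ 2)) (r, 0) :=
      ContinuousAt.log (by fun_prop) hr2.ne'
    have l2 : ContinuousAt (fun q : ℝ × ℝ => Real.log ((nuD1 γ 1 + q.2 ^ 2) ^ 2 - nuD1 γ q.1 ^ 2)) (r, 0) :=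
      ContinuousAt.log (by fun_prop) (by simp; linarith)
    have l3 : ContinuousAt (fun q : ℝ × ℝ => Real.log (nuD1 γ 1 + q.2 ^ 2)) (r, 0) :=
      ContinuousAt.log (by fun_prop) (by simp; linarith)
    unfold Ff FF VV
    fun_prop
  have hev : ∀ᶠ q in 𝓝 (r, (0:ℝ)), Ff γ q.2 (E0 γ) (x0 γ) (Q1 γ y m) q.1 a b c < ε :=
    hcont.eventually_lt continuousAt_const (lt_of_le_of_lt hle hε)
  refine PC_of_ev (fun _ => max |a| (max |b| |c|)) ?_
  have hev2 : ∀ᶠ q in 𝓝[Ioo (-1) 1] r ×ˢ 𝓝[>] (0:ℝ), Ff γ q.2 (E0 γ) (x0 γ) (Q1 γ y m) q.1 a b c < ε := by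
    rw [nhds_prod_eq] at hev
    exact hev.filter_mono (prod_mono nhdsWithin_le_nhds nhdsWithin_le_nhds)
  filter_upwards [hev2] with q hq
  exact ⟨a, b, c, le_max_left _ _, (le_max_left _ _).trans (le_max_right _ _), (le_max_right _ _).trans (le_max_right _ _), hq.le⟩

open Topology in
lemma loc_one (hγ : GammaDecay γ) (hn : nuF γ 1 = 1) {y m : ℝ} (hp : Pars γ y m)
    {ε : ℝ} (hε : 0 < ε) :
    ∃ t ∈ 𝓝 (1:ℝ), PC (fun δ r a b c => Ff γ δ (E0 γ) (x0 γ) (Q1 γ y m) r a b c) ε t := by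
  have hn1 : 0 < nuD1 γ 1 := by linarith [hp.n1_ge]
  have hn2 : 0 < nuD2 γ 1 := by linarith [hp.n12]
  have one_mem : (1:ℝ) ∈ Icc (-1:ℝ) 1 := by simp
  have c0 := (contF hγ).continuousWithinAt one_mem
  have c1 := (contD1 hγ).continuousWithinAt one_mem
  have c2 := (contD2 hγ).continuousWithinAt one_mem
  let Er : ℝ × ℝ → ℝ := fun q => m * (1 - q.1) * x0 γ / 2 + y * x0 γ * (1 - q.1) / 4 + m * x0 γ * (nuD2 γ 1 - nuD2 γ q.1) / (4 * nuD2 γ 1) + q.2 ^ 2 * (y ^ 2 + m ^ 2) / 4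
       + 1 / 2 * Real.log (2 * (nuD1 γ 1 + q.2 ^ 2) ^ 2 / (nuD1 γ 1 * (nuD1 γ 1 + q.2 ^ 2 + nuD1 γ q.1))) + 1 / 2 * Real.log (nuD2 γ 1 / nuD2 γ q.1)
  let l : Filter (ℝ × ℝ) := 𝓝[Ioo (-1) 1] 1 ×ˢ 𝓝[>] (0:ℝ)
  have t1 : Tendsto (fun q : ℝ × ℝ => q.1) l (𝓝 1) := (tendsto_fst).mono_right nhdsWithin_le_nhds
  have t2 : Tendsto (fun q : ℝ × ℝ => q.2) l (𝓝 0) := (tendsto_snd).mono_right nhdsWithin_le_nhds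
  have t1' : Tendsto (fun q : ℝ × ℝ => q.1) l (𝓝[Icc (-1) 1] 1) := (tendsto_fst).mono_right (nhdsWithin_mono _ Ioo_subset_Icc_self)
  have T1 : Tendsto (fun q : ℝ × ℝ => nuD1 γ q.1) l (𝓝 (nuD1 γ 1)) := c1.tendsto.comp t1'
  have T2 : Tendsto (fun q : ℝ × ℝ => nuD2 γ q.1) l (𝓝 (nuD2 γ 1)) := c2.tendsto.comp t1'
  have hEr : Tendsto Er l (𝓝 0) := by
    have L1 : Tendsto (fun q : ℝ × ℝ => Real.log (2 * (nuD1 γ 1 + q.2 ^ 2) ^ 2 / (nuD1 γ 1 * (nuD1 γ 1 + q.2 ^ 2 + nuD1 γ q.1)))) l (𝓝 0) := by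
      have e : (0:ℝ) = Real.log (2 * (nuD1 γ 1 + 0 ^ 2) ^ 2 / (nuD1 γ 1 * (nuD1 γ 1 + 0 ^ 2 + nuD1 γ 1))) := by
        rw [show 2 * (nuD1 γ 1 + 0 ^ 2) ^ 2 / (nuD1 γ 1 * (nuD1 γ 1 + 0 ^ 2 + nuD1 γ 1)) = 1 by field_simp; ring, Real.log_one]
      refine (congrArg (fun z => Tendsto _ l (𝓝 z)) e).mpr ?_
      refine Tendsto.log ?_ (by positivity)
      refine Tendsto.div ?_ ?_ (by positivity)
      · exact ((((t2.pow 2).const_add _).pow 2).const_mul _)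
      · exact (((t2.pow 2).const_add _).add T1).const_mul _
    have L2 : Tendsto (fun q : ℝ × ℝ => Real.log (nuD2 γ 1 / nuD2 γ q.1)) l (𝓝 0) := by
      have e : (0:ℝ) = Real.log (nuD2 γ 1 / nuD2 γ 1) := by rw [div_self hn2.ne', Real.log_one]
      refine (congrArg (fun z => Tendsto _ l (𝓝 z)) e).mpr ?_
      exact Tendsto.log (tendsto_const_nhds.div T2 hn2.ne') (by positivity)
    have a1 := ((t1.const_sub 1).const_mul m).mul_const (x0 γ) |>.div_const 2
    have a2 := ((t1.const_sub 1).const_mul (y * x0 γ)).div_const 4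
    have a3 := ((T2.const_sub (nuD2 γ 1)).const_mul (m * x0 γ)).div_const (4 * nuD2 γ 1)
    have a4 := ((t2.pow 2).mul_const (y ^ 2 + m ^ 2)).div_const 4
    have := ((((a1.add a2).add a3).add a4).add (L1.const_mul (1/2))).add (L2.const_mul (1/2))
    simpa [Er] using this
  refine PC_of_ev (fun δ => |y / 2| + |m / 4| + |x0 γ| / (2 * δ ^ 2)) ?_
  have e1 : ∀ᶠ q in l, Er q < ε := hEr.eventually (gt_mem_nhds hε)
  have e2 : ∀ᶠ q in l, 0 < nuD2 γ q.1 := T2.eventually (lt_mem_nhds hn2)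
  have e3 : ∀ᶠ q in l, 0 < nuD1 γ q.1 := T1.eventually (lt_mem_nhds hn1)
  have e4 : ∀ᶠ q in l, 0 < q.1 := t1.eventually (lt_mem_nhds one_pos)
  have e5 : ∀ᶠ q in l, q.1 ∈ Ioo (-1:ℝ) 1 := tendsto_fst.eventually (eventually_mem_nhdsWithin)
  have e6 : ∀ᶠ q in l, 0 < q.2 := tendsto_snd.eventually (eventually_mem_nhdsWithin)
  filter_upwards [e1, e2, e3, e4, e5, e6] with ⟨r, δ⟩ h1 h2 h3 h4 h5 h6
  simp only at h1 h2 h3 h4 h5 h6 ⊢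
  have hr : |r| ≤ 1 := abs_le.2 ⟨h5.1.le, h5.2.le⟩
  have hd := nu_diff hγ h4.le h5.2.le
  have hb := near1_bound (n1 := nuD1 γ 1) (n2 := nuD2 γ 1) (A := nuF γ r) (B := nuD1 γ r) (C := nuD2 γ r) (u := E0 γ) (x := x0 γ) (Q := Q1 γ y m) (y := y) (m := m)
    (t := 1 - r) (δ := δ) hn1 hn2 hp.y_pos hp.m_pos hp.hs hp.e hp.x hp.rel hp.ye (Q1_eq hn hp).1 (by linarith [h5.2]) (by linarith) h6
    (hn ▸ (abs_le.1 (nuF_abs_le hγ hr)).2) h2 (abs_le.1 (nuD2_abs_le hγ hr)).2 h3.le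
    ((abs_le.1 (nuD1_abs_le hγ hr)).2.trans (by nlinarith)) hd.1 hd.2
  rw [show 1 - (1 - r) = r by ring] at hb
  refine ⟨y / 2, m / 4, x0 γ / (4 * (1 - r) * nuD2 γ 1 + 2 * δ ^ 2), ?_, ?_, ?_, ?_⟩
  · have : 0 ≤ |x0 γ| / (2 * δ ^ 2) := by positivity
    linarith [abs_nonneg (m/4)]
  · have : 0 ≤ |x0 γ| / (2 * δ ^ 2) := by positivity
    linarith [abs_nonneg (y/2)]
  · have hnn : 0 ≤ 4 * (1 - r) * nuD2 γ 1 := by have := h5.2; have : 0 ≤ 1 - r := by linarith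
                                                positivity
    have : |x0 γ / (4 * (1 - r) * nuD2 γ 1 + 2 * δ ^ 2)| ≤ |x0 γ| / (2 * δ ^ 2) := by
      rw [abs_div, abs_of_pos (show 0 < 4 * (1 - r) * nuD2 γ 1 + 2 * δ ^ 2 by positivity)]
      gcongr; linarith
    linarith [abs_nonneg (y/2), abs_nonneg (m/4)]
  · unfold Ff
    rw [hn]
    refine hb.trans ?_
    exact h1.le

open Topology in
lemma loc_neg (hγ : GammaDecay γ) (hn : nuF γ 1 = 1) {y m : ℝ} (hp : Pars γ y m)
    {ε : ℝ} (hε : 0 < ε) :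
    ∃ t ∈ 𝓝 (-1:ℝ), PC (fun δ r a b c => Ff γ δ (E0 γ) (x0 γ) (Q1 γ y m) r a b c) ε t := by
  have hn1 : 0 < nuD1 γ 1 := by linarith [hp.n1_ge]
  have hn2 : 0 < nuD2 γ 1 := by linarith [hp.n12]
  have mone_mem : (-1:ℝ) ∈ Icc (-1:ℝ) 1 := by simp
  have c0 := (contF hγ).continuousWithinAt mone_mem
  have c1 := (contD1 hγ).continuousWithinAt mone_mem
  let l : Filter (ℝ × ℝ) := 𝓝[Ioo (-1) 1] (-1) ×ˢ 𝓝[>] (0:ℝ)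
  have t1 : Tendsto (fun q : ℝ × ℝ => q.1) l (𝓝 (-1)) := (tendsto_fst).mono_right nhdsWithin_le_nhds
  have t2 : Tendsto (fun q : ℝ × ℝ => q.2) l (𝓝 0) := (tendsto_snd).mono_right nhdsWithin_le_nhds
  have t1' : Tendsto (fun q : ℝ × ℝ => q.1) l (𝓝[Icc (-1) 1] (-1)) := (tendsto_fst).mono_right (nhdsWithin_mono _ Ioo_subset_Icc_self)
  have T0 : Tendsto (fun q : ℝ × ℝ => nuF γ q.1) l (𝓝 (nuF γ (-1))) := c0.tendsto.comp t1'
  have T1 : Tendsto (fun q : ℝ × ℝ => nuD1 γ q.1) l (𝓝 (nuD1 γ (-1))) := c1.tendsto.comp t1'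
  have e5 : ∀ᶠ q in l, q.1 ∈ Ioo (-1:ℝ) 1 := tendsto_fst.eventually (eventually_mem_nhdsWithin)
  have e6 : ∀ᶠ q in l, 0 < q.2 := tendsto_snd.eventually (eventually_mem_nhdsWithin)
  have e7 : ∀ᶠ q in l, q.2 < 1 := t2.eventually (gt_mem_nhds one_pos)
  by_cases hodd : ∀ p, 2 ≤ p → Odd p → γ p = 0
  · obtain ⟨t, ht, d0, hd0, H⟩ := loc_one hγ hn hp hε
    refine ⟨Neg.neg ⁻¹' t, ?_, d0, hd0, fun δ h1 h2 => ?_⟩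
    · exact (continuous_neg.tendsto (-1:ℝ)) (by simpa using ht)
    · obtain ⟨B, hB⟩ := H δ h1 h2
      refine ⟨B, fun r hr hr1 => ?_⟩
      obtain ⟨a, b, c, ha, hb, hc, hF⟩ := hB (-r) hr ⟨by linarith [hr1.2], by linarith [hr1.1]⟩
      refine ⟨a, c, b, ha, hc, hb, ?_⟩
      obtain ⟨p0, p1, p2⟩ := nu_even hodd r
      refine le_trans (le_of_eq ?_) hF
      simp only [Ff, FF, VV, p0, p1, p2]
      ring_nf
  push Not at hodd
  obtain ⟨p, hp2, hpo, hpne⟩ := hodd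
  by_cases hev : ∀ p, 2 ≤ p → Even p → γ p = 0
  · have hm1 : nuF γ (-1) = -1 := by rw [nu_odd hev, hn]
    rw [hm1] at T0
    have hE : 0 < E0 γ := by rw [hp.e]; have := hp.y_pos; have := hp.m_pos; positivity
    set Cc := Real.log (nuD1 γ 1 + 1) - Real.log (nuD1 γ 1) + 2 * Q1 γ y m with hCc
    set A := (|Cc| + 1) / (2 * E0 γ) with hA
    have hAE : 2 * A * E0 γ = |Cc| + 1 := by rw [hA]; field_simp
    refine PC_of_ev (fun _ => |A|) ?_
    have tt : Tendsto (fun q : ℝ × ℝ => A ^ 2 * (1 + nuF γ q.1 + q.2 ^ 2)) l (𝓝 0) := by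
      have := (((T0.const_add 1).add (t2.pow 2)).const_mul (A ^ 2))
      simpa using this
    filter_upwards [e5, e6, e7, tt.eventually (gt_mem_nhds one_pos)] with ⟨r, δ⟩ h5 h6 h7 h8
    simp only at h5 h6 h7 h8 ⊢
    refine ⟨A, 0, 0, le_rfl, by simp, by simp, ?_⟩
    have hr1 : |r| < 1 := abs_lt.2 h5
    have hr2 : 0 < 1 - r ^ 2 := by have := (sq_lt_one_iff_abs_lt_one r).2 hr1; linarith
    have hB : nuD1 γ 1 ^ 2 * (1 - r ^ 2) ≤ (nuD1 γ 1 + δ ^ 2) ^ 2 - nuD1 γ r ^ 2 := by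
      have h1 : nuD1 γ r ^ 2 ≤ r ^ 2 * nuD1 γ 1 ^ 2 := by
        rw [← mul_pow]; apply sq_le_sq.2; rw [abs_mul, abs_of_pos hn1]; exact nuD1_abs_le hγ hr1.le
      have : 0 ≤ δ ^ 2 := sq_nonneg δ
      nlinarith [mul_nonneg this hn1.le]
    have hl := Real.log_le_log (by positivity) hB
    rw [Real.log_mul (by positivity) hr2.ne', Real.log_pow] at hl
    have hl2 : Real.log (nuD1 γ 1 + δ ^ 2) ≤ Real.log (nuD1 γ 1 + 1) := by
      apply Real.log_le_log (by positivity); nlinarith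
    unfold Ff FF VV
    rw [hn]
    have := le_abs_self Cc
    push_cast at hl
    nlinarith
  · push Not at hev
    obtain ⟨q, hq2, hqe, hqne⟩ := hev
    have hlt := nu_both hγ hp2 hpo hpne hq2 hqe hqne
    set ρ := (nuD1 γ 1 ^ 2 - nuD1 γ (-1) ^ 2) / 2 with hρ
    have hρ0 : 0 < ρ := by
      have : nuD1 γ (-1) ^ 2 < nuD1 γ 1 ^ 2 := by rw [sq_lt_sq, abs_of_pos hn1]; exact hlt
      rw [hρ]; linarith
    set Cc := Real.log (nuD1 γ 1 + 1) - 1 / 2 * Real.log ρ + 2 * Q1 γ y m with hCc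
    refine PC_of_ev (fun _ => 0) ?_
    have tt : Tendsto (fun q : ℝ × ℝ => nuD1 γ 1 ^ 2 - nuD1 γ q.1 ^ 2) l (𝓝 (nuD1 γ 1 ^ 2 - nuD1 γ (-1) ^ 2)) := (T1.pow 2).const_sub _
    have t3 : Tendsto (fun q : ℝ × ℝ => 1 - q.1 ^ 2) l (𝓝 0) := by
      have := (t1.pow 2).const_sub 1; simpa using this
    filter_upwards [e5, e6, e7, tt.eventually (lt_mem_nhds (show ρ < _ by linarith)), t3.eventually (gt_mem_nhds (Real.exp_pos (-2 * Cc)))] with ⟨r, δ⟩ h5 h6 h7 h8 h9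
    simp only at h5 h6 h7 h8 h9 ⊢
    refine ⟨0, 0, 0, by simp, by simp, by simp, ?_⟩
    have hr1 : |r| < 1 := abs_lt.2 h5
    have hr2 : 0 < 1 - r ^ 2 := by have := (sq_lt_one_iff_abs_lt_one r).2 hr1; linarith
    have hl0 : Real.log (1 - r ^ 2) ≤ -2 * Cc := (Real.log_le_iff_le_exp hr2).2 h9.le
    have hl1 : Real.log ρ ≤ Real.log ((nuD1 γ 1 + δ ^ 2) ^ 2 - nuD1 γ r ^ 2) := by
      apply Real.log_le_log hρ0
      nlinarith [mul_nonneg (sq_nonneg δ) hn1.le]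
    have hl2 : Real.log (nuD1 γ 1 + δ ^ 2) ≤ Real.log (nuD1 γ 1 + 1) := by
      apply Real.log_le_log (by positivity); nlinarith
    unfold Ff FF VV
    simp only [mul_zero, zero_mul, ne_eq, OfNat.ofNat_ne_zero, not_false_eq_true, zero_pow, add_zero, sub_zero]
    linarith

lemma claimC (hγ : GammaDecay γ) (hn : nuF γ 1 = 1) {y m : ℝ} (hp : Pars γ y m)
    (hPsi : ∀ r ∈ Ioo (-1:ℝ) 1, Psi0 γ r ≤ 0) {ε : ℝ} (hε : 0 < ε) :
    PC (fun δ r a b c => Ff γ δ (E0 γ) (x0 γ) (Q1 γ y m) r a b c) ε (Icc (-1) 1) := by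
  refine PC_compact fun r hr => ?_
  rcases hr.1.eq_or_lt with h | h
  · rw [← h]; exact loc_neg hγ hn hp hε
  rcases hr.2.eq_or_lt with h' | h'
  · rw [h']; exact loc_one hγ hn hp hε
  · exact loc_int hγ hn hp hPsi hε ⟨h, h'⟩

end

/-- truncation of the coefficients -/
def tr (γ : ℕ → ℝ) (K : ℕ) (p : ℕ) : ℝ := if p ≤ K then γ p else 0

lemma tr_decay {γ : ℕ → ℝ} (hγ : GammaDecay γ) (K : ℕ) : GammaDecay (tr γ K) := by
  obtain ⟨h0, ρ, h1, h2, h3⟩ := hγ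
  refine ⟨fun p => ?_, ρ, h1, h2, ?_⟩
  · unfold tr; split_ifs; exacts [h0 p, le_rfl]
  · filter_upwards [h3] with p hp
    unfold tr; split_ifs
    exacts [hp, by positivity]

/-- tail of the second moment -/
def tailT (γ : ℕ → ℝ) (K : ℕ) (p : ℕ) : ℝ := if p ≤ K then 0 else γ p ^ 2 * (p:ℝ) ^ 2

open Topology in
lemma tail_tendsto {γ : ℕ → ℝ} (hγ : GammaDecay γ) :
    Tendsto (fun K => ∑' p, tailT γ K p) atTop (𝓝 0) := by
  have := tendsto_tsum_of_dominated_convergence (𝓕 := atTop) (f := fun K p => tailT γ K p) (g := fun _ => (0:ℝ))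
    (bound := fun p => γ p ^ 2 * (p:ℝ) ^ 2) (summ2 hγ 2) ?_ ?_
  · simpa using this
  · intro p
    refine tendsto_const_nhds.congr' ?_
    filter_upwards [eventually_ge_atTop p] with K hK
    simp [tailT, hK]
  · filter_upwards with K p
    unfold tailT; split_ifs
    · simp; positivity
    · rw [Real.norm_of_nonneg (by positivity)]

lemma tail_summ {γ : ℕ → ℝ} (hγ : GammaDecay γ) (K : ℕ) : Summable (tailT γ K) := by
  refine Summable.of_nonneg_of_le (fun p => ?_) (fun p => ?_) (summ2 hγ 2)
  · unfold tailT; split_ifs <;> positivity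
  · unfold tailT; split_ifs
    · positivity
    · exact le_rfl

lemma diff_bd {γ : ℕ → ℝ} (hγ : GammaDecay γ) (K : ℕ) {f g : ℕ → ℝ} {a b : ℝ} (hf : HasSum f a) (hg : HasSum g b)
    (h1 : ∀ p ≤ K, f p = g p) (h2 : ∀ p, ¬ p ≤ K → g p = 0) {k : ℕ} (hk : k ≤ 2)
    (h3 : ∀ p, ‖f p‖ ≤ γ p ^ 2 * (p:ℝ) ^ k) :
    |b - a| ≤ ∑' p, tailT γ K p := by
  rw [abs_sub_comm]
  have h := hf.sub hg
  rw [← h.tsum_eq, ← Real.norm_eq_abs]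
  refine tsum_of_norm_bounded (tail_summ hγ K).hasSum fun p => ?_
  unfold tailT
  split_ifs with hp
  · rw [h1 p hp]; simp
  · rw [h2 p hp, sub_zero]
    refine (h3 p).trans ?_
    have : (1:ℝ) ≤ p := by exact_mod_cast (by omega : 1 ≤ p)
    gcongr

lemma tr_close {γ : ℕ → ℝ} (hγ : GammaDecay γ) (K : ℕ) {r : ℝ} (hr : |r| ≤ 1) :
    |nuF (tr γ K) r - nuF γ r| ≤ ∑' p, tailT γ K p ∧
    |nuD1 (tr γ K) r - nuD1 γ r| ≤ ∑' p, tailT γ K p ∧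
    |nuD2 (tr γ K) r - nuD2 γ r| ≤ ∑' p, tailT γ K p := by
  have hK := tr_decay hγ K
  refine ⟨diff_bd hγ K (hsF hγ hr) (hsF hK hr) ?_ ?_ (by norm_num) (tF_bd γ hr),
    diff_bd hγ K (hsD1 hγ hr) (hsD1 hK hr) ?_ ?_ (by norm_num) (tD1_bd γ hr),
    diff_bd hγ K (hsD2 hγ hr) (hsD2 hK hr) ?_ ?_ (by norm_num) (tD2_bd γ hr)⟩
  all_goals intro p hp; simp [tF, tD1, tD2, tr, hp]

lemma prod_bd {p P d η : ℝ} (hp : |p| ≤ P) (hd : |d| ≤ η) : p * d ≤ P * η := by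
  refine (le_abs_self _).trans ?_
  rw [abs_mul]
  have := abs_nonneg p
  exact mul_le_mul hp hd (abs_nonneg _) (this.trans hp)

lemma VV_bd {n0 n1 n2 A B C r a b c M η : ℝ} (hr : |r| ≤ 1) (h0 : |n0| ≤ η) (h1 : |n1| ≤ η) (h2 : |n2| ≤ η)
    (hA : |A| ≤ η) (hB : |B| ≤ η) (hC : |C| ≤ η) (ha : |a| ≤ M) (hb : |b| ≤ M) (hc : |c| ≤ M) :
    VV n0 n1 n2 A B C r a b c ≤ 108 * M ^ 2 * η := by
  have hM : 0 ≤ M := (abs_nonneg a).trans ha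
  have r1 : |1 + r| ≤ 2 := (abs_add_le _ _).trans (by rw [abs_one]; linarith)
  have r2 : |1 - r| ≤ 2 := (abs_sub _ _).trans (by rw [abs_one]; linarith)
  have r3 : |1 - r ^ 2| ≤ 1 := by
    have : r ^ 2 ≤ 1 := (sq_le_one_iff_abs_le_one r).2 hr
    rw [abs_of_nonneg] <;> nlinarith [sq_nonneg r]
  have q : ∀ {s t S T : ℝ}, |s| ≤ S → |t| ≤ T → |s * t| ≤ S * T := by
    intro s t S T hs ht
    rw [abs_mul]; exact mul_le_mul hs ht (abs_nonneg _) ((abs_nonneg s).trans hs)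
  have ad : ∀ {s t S T : ℝ}, |s| ≤ S → |t| ≤ T → |s + t| ≤ S + T := fun hs ht => (abs_add_le _ _).trans (add_le_add hs ht)
  have sb : ∀ {s t S T : ℝ}, |s| ≤ S → |t| ≤ T → |s - t| ≤ S + T := fun hs ht => (abs_sub _ _).trans (add_le_add hs ht)
  have t1 := prod_bd (q ha ha) (ad h0 hA)
  have s1 : |(1 + r) / 2| ≤ 1 := by rw [abs_div, abs_two]; linarith
  have s2 : |(1 - r) / 2| ≤ 1 := by rw [abs_div, abs_two]; linarith
  have t2 := prod_bd (q (q hb hb) r1) (ad (ad h1 hB) (q s1 (ad h2 hC)))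
  have t3 := prod_bd (q (q hc hc) r2) (ad (sb h1 hB) (q s2 (ad h2 hC)))
  have t4 := prod_bd (q (q ha hb) r1) (ad h1 hB)
  have t5 := prod_bd (q (q ha hc) r2) (sb h1 hB)
  have t6 := prod_bd (q (q hb hc) r3) (sb h2 hC)
  unfold VV
  linarith

set_option maxHeartbeats 1000000 in
lemma FF_pert {δ n0 n1 n2 A B C u x Q n0' n1' n2' A' B' C' y m r a b c M η : ℝ} (hδ : 0 < δ) (hy : 0 < y) (hm : 0 < m) (hr : |r| ≤ 1)
    (h0 : |n0' - n0| ≤ η) (h1 : |n1' - n1| ≤ η) (h2 : |n2' - n2| ≤ η)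
    (hA : |A' - A| ≤ η) (hB : |B' - B| ≤ η) (hC : |C' - C| ≤ η) (ha : |a| ≤ M) (hb : |b| ≤ M) (hc : |c| ≤ M)
    (hn : |B| ≤ n1) (hn' : |B'| ≤ n1') :
    FF δ n0' n1' n2' A' B' C' (n0' * y + n1' * m) (n1' * y + (n1' + n2') * m)
      ((n0' * y ^ 2 + 2 * n1' * y * m + (n1' + n2') * m ^ 2) / 2) r a b c ≤
    FF δ n0 n1 n2 A B C (n0 * y + n1 * m) (n1 * y + (n1 + n2) * m)
      ((n0 * y ^ 2 + 2 * n1 * y * m + (n1 + n2) * m ^ 2) / 2) r a b c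
      + η * ((4 * n1 + 2 * η + 2 * δ ^ 2) / δ ^ 4 + 1 / δ ^ 2 + 10 * M * (y + 2 * m) + 54 * M ^ 2 + 4 * (y + m) ^ 2) := by
  have hn1 := (abs_nonneg _).trans hn
  have hn1' := (abs_nonneg _).trans hn'
  have hη := (abs_nonneg _).trans h0
  have hM : 0 ≤ M := (abs_nonneg a).trans ha
  have hδ2 : 0 < δ ^ 2 := by positivity
  have hP' : δ ^ 4 ≤ (n1' + δ ^ 2) ^ 2 - B' ^ 2 := by
    have := sq_le_sq' (by linarith [neg_abs_le B', abs_nonneg B']) ((le_abs_self _).trans hn')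
    nlinarith
  have hP : δ ^ 4 ≤ (n1 + δ ^ 2) ^ 2 - B ^ 2 := by
    have := sq_le_sq' (by linarith [neg_abs_le B, abs_nonneg B]) ((le_abs_self _).trans hn)
    nlinarith
  have hδ4 : 0 < δ ^ 4 := by positivity
  have L1 : Real.log ((n1 + δ ^ 2) ^ 2 - B ^ 2) - Real.log ((n1' + δ ^ 2) ^ 2 - B' ^ 2) ≤ η * ((4 * n1 + 2 * η + 2 * δ ^ 2) / δ ^ 4) := by
    rw [← Real.log_div (by linarith) (by linarith)]
    refine (Real.log_le_sub_one_of_pos (div_pos (by linarith) (by linarith))).trans ?_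
    rw [div_sub_one (by linarith)]
    have e : (n1 + δ ^ 2) ^ 2 - B ^ 2 - ((n1' + δ ^ 2) ^ 2 - B' ^ 2) ≤ η * (4 * n1 + 2 * η + 2 * δ ^ 2) := by
      have i1 := prod_bd (p := n1 + n1' + 2 * δ ^ 2) (P := 2 * n1 + η + 2 * δ ^ 2) (d := n1 - n1') (η := η)
        (by rw [abs_of_nonneg (by positivity)]; linarith [(abs_le.1 h1).2]) (by rwa [abs_sub_comm])
      have i2 := prod_bd (p := B + B') (P := 2 * n1 + η) (d := B' - B) (η := η)
        ((abs_add_le _ _).trans (by linarith [(abs_le.1 h1).2])) hB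
      linarith
    rw [← mul_div_assoc]
    refine (div_le_div_of_nonneg_right e (by linarith)).trans ?_
    exact div_le_div_of_nonneg_left (by positivity) hδ4 hP'
  have L2 : Real.log (n1' + δ ^ 2) - Real.log (n1 + δ ^ 2) ≤ η * (1 / δ ^ 2) := by
    rw [← Real.log_div (by positivity) (by positivity)]
    refine (Real.log_le_sub_one_of_pos (by positivity)).trans ?_
    rw [div_sub_one (by positivity), mul_one_div]
    refine (div_le_div_of_nonneg_right (c := n1 + δ ^ 2) (b := η) (by linarith [(abs_le.1 h1).2]) (by positivity)).trans ?_
    exact div_le_div_of_nonneg_left hη hδ2 (by linarith)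
  have V := VV_bd (r := r) hr h0 h1 h2 hA hB hC ha hb hc
  have r1 : |1 + r| ≤ 2 := (abs_add_le _ _).trans (by rw [abs_one]; linarith)
  have r2 : |1 - r| ≤ 2 := (abs_sub _ _).trans (by rw [abs_one]; linarith)
  have q : ∀ {s t S T : ℝ}, |s| ≤ S → |t| ≤ T → |s * t| ≤ S * T := by
    intro s t S T hs ht
    rw [abs_mul]; exact mul_le_mul hs ht (abs_nonneg _) ((abs_nonneg s).trans hs)
  have k1 := prod_bd (p := a) (P := M) (d := (n0 * y + n1 * m) - (n0' * y + n1' * m)) (η := η * (y + m)) ha (by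
    rw [show (n0 * y + n1 * m) - (n0' * y + n1' * m) = -((n0' - n0) * y + (n1' - n1) * m) by ring, abs_neg, abs_le]
    obtain ⟨a1, a2⟩ := abs_le.1 h0
    obtain ⟨a3, a4⟩ := abs_le.1 h1
    have b1 := mul_le_mul_of_nonneg_right a1 hy.le
    have b2 := mul_le_mul_of_nonneg_right a2 hy.le
    have b3 := mul_le_mul_of_nonneg_right a3 hm.le
    have b4 := mul_le_mul_of_nonneg_right a4 hm.le
    constructor <;> linarith)
  have hx : |(n1 * y + (n1 + n2) * m) - (n1' * y + (n1' + n2') * m)| ≤ η * (y + 2 * m) := by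
    rw [show (n1 * y + (n1 + n2) * m) - (n1' * y + (n1' + n2') * m) = -((n1' - n1) * (y + m) + (n2' - n2) * m) by ring, abs_neg, abs_le]
    obtain ⟨a1, a2⟩ := abs_le.1 h2
    obtain ⟨a3, a4⟩ := abs_le.1 h1
    have b1 := mul_le_mul_of_nonneg_right a1 hm.le
    have b2 := mul_le_mul_of_nonneg_right a2 hm.le
    have b3 := mul_le_mul_of_nonneg_right a3 (add_pos hy hm).le
    have b4 := mul_le_mul_of_nonneg_right a4 (add_pos hy hm).le
    constructor <;> linarith
  have k2 := prod_bd (q hb r1) hx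
  have k3 := prod_bd (q hc r2) hx
  have k4 : (n0' * y ^ 2 + 2 * n1' * y * m + (n1' + n2') * m ^ 2) - (n0 * y ^ 2 + 2 * n1 * y * m + (n1 + n2) * m ^ 2) ≤ η * (4 * (y + m) ^ 2) := by
    have b0 := mul_le_mul_of_nonneg_right (abs_le.1 h0).2 (by positivity : 0 ≤ y ^ 2)
    have b1 := mul_le_mul_of_nonneg_right (abs_le.1 h1).2 (by positivity : 0 ≤ 2 * y * m + m ^ 2)
    have b2 := mul_le_mul_of_nonneg_right (abs_le.1 h2).2 (by positivity : 0 ≤ m ^ 2)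
    have b3 : 0 ≤ η * (3 * y ^ 2 + 6 * y * m + 2 * m ^ 2) := by positivity
    linarith
  have L1' : 0 ≤ η * ((4 * n1 + 2 * η + 2 * δ ^ 2) / δ ^ 4) := by positivity
  have hMm : 0 ≤ M * η * y := by positivity
  have hMm2 : 0 ≤ M * η * m := by positivity
  unfold VV at V
  unfold FF VV
  linarith

open Topology in
lemma claimT {γ : ℕ → ℝ} (hγ : GammaDecay γ) (hn : nuF γ 1 = 1) {y m : ℝ} (hp : Pars γ y m)
    (hPsi : ∀ r ∈ Ioo (-1:ℝ) 1, Psi0 γ r ≤ 0) {ε : ℝ} (hε : 0 < ε) :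
    ∃ δ0 > 0, ∀ δ, 0 < δ → δ < δ0 → ∃ B, ∀ᶠ K in atTop, ∀ r ∈ Ioo (-1 : ℝ) 1,
    ∃ a b c : ℝ, |a| ≤ B ∧ |b| ≤ B ∧ |c| ≤ B ∧
      Ff (tr γ K) δ (nuF (tr γ K) 1 * y + nuD1 (tr γ K) 1 * m) (nuD1 (tr γ K) 1 * y + (nuD1 (tr γ K) 1 + nuD2 (tr γ K) 1) * m)
       (Q1 (tr γ K) y m) r a b c ≤ ε := by
  obtain ⟨δ0, h0, h⟩ := claimC hγ hn hp hPsi (half_pos hε)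
  refine ⟨δ0, h0, fun δ h1 h2 => ?_⟩
  obtain ⟨B, hB⟩ := h δ h1 h2
  refine ⟨B, ?_⟩
  let η : ℕ → ℝ := fun K => ∑' p, tailT γ K p
  have ht : Tendsto (fun K => η K * ((4 * nuD1 γ 1 + 2 * η K + 2 * δ ^ 2) / δ ^ 4 + 1 / δ ^ 2 + 10 * B * (y + 2 * m) + 54 * B ^ 2 + 4 * (y + m) ^ 2)) atTop (𝓝 0) := by
    have t := tail_tendsto hγ
    have := t.mul ((((((t.const_mul 2).const_add (4 * nuD1 γ 1)).add_const (2 * δ ^ 2)).div_const (δ ^ 4)).add_const (1 / δ ^ 2 + 10 * B * (y + 2 * m) + 54 * B ^ 2 + 4 * (y + m) ^ 2)))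
    rw [zero_mul] at this
    refine this.congr fun K => ?_
    simp only [η]; ring
  filter_upwards [ht.eventually (gt_mem_nhds (half_pos hε))] with K hK r hr
  obtain ⟨a, b, c, ha, hb, hc, hF⟩ := hB r (Ioo_subset_Icc_self hr) hr
  refine ⟨a, b, c, ha, hb, hc, ?_⟩
  have hr1 : |r| ≤ 1 := (abs_lt.2 hr).le
  obtain ⟨c0, c1, c2⟩ := tr_close hγ K abs1
  obtain ⟨d0, d1, d2⟩ := tr_close hγ K hr1
  have nb : ∀ {γ : ℕ → ℝ}, GammaDecay γ → |nuD1 γ r| ≤ nuD1 γ 1 := by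
    intro γ hγ
    have i := nuD1_abs_le hγ hr1
    have j := nuD1_abs_le hγ abs1
    rw [abs_one, one_mul] at j
    nlinarith [abs_nonneg (nuD1 γ 1)]
  have := FF_pert (δ := δ) (y := y) (m := m) (r := r) (u := 0) (x := 0) (Q := 0) h1 hp.y_pos hp.m_pos hr1 c0 c1 c2 d0 d1 d2 ha hb hc (nb hγ) (nb (tr_decay hγ K))
  have e : Ff γ δ (E0 γ) (x0 γ) (Q1 γ y m) r a b c = FF δ (nuF γ 1) (nuD1 γ 1) (nuD2 γ 1) (nuF γ r) (nuD1 γ r) (nuD2 γ r) (nuF γ 1 * y + nuD1 γ 1 * m) (nuD1 γ 1 * y + (nuD1 γ 1 + nuD2 γ 1) * m)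
      ((nuF γ 1 * y ^ 2 + 2 * nuD1 γ 1 * y * m + (nuD1 γ 1 + nuD2 γ 1) * m ^ 2) / 2) r a b c := by
    unfold Ff Q1; rw [hp.e, hp.x, hn]; simp only [one_mul]
  rw [← e] at this
  unfold Ff Q1
  refine this.trans ?_
  simp only [η] at hK
  linarith

lemma u_tendsto {γ : ℕ → ℝ} (hγ : GammaDecay γ) {r : ℝ} (hr : |r| ≤ 1) :
    Tendsto (fun K => nuF (tr γ K) r) atTop (nhds (nuF γ r)) ∧
    Tendsto (fun K => nuD1 (tr γ K) r) atTop (nhds (nuD1 γ r)) ∧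
    Tendsto (fun K => nuD2 (tr γ K) r) atTop (nhds (nuD2 γ r)) := by
  refine ⟨?_, ?_, ?_⟩ <;> rw [tendsto_iff_dist_tendsto_zero] <;>
    refine squeeze_zero (fun _ => dist_nonneg) (fun K => ?_) (tail_tendsto hγ) <;> rw [Real.dist_eq]
  exacts [(tr_close hγ K hr).1, (tr_close hγ K hr).2.1, (tr_close hγ K hr).2.2]

section gauss
set_option linter.unusedSectionVars false
variable {E : Type*} [NormedAddCommGroup E] [InnerProductSpace ℝ E] [FiniteDimensional ℝ E]
  [MeasurableSpace E] [BorelSpace E]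

lemma expn_int (μ : Measure E) [IsGaussian μ] (C : ℝ) : Integrable (fun g : E => Real.exp (C * ‖g‖)) μ := by
  obtain ⟨c, hc, hi⟩ := IsGaussian.exists_integrable_exp_sq μ
  refine Integrable.mono' (hi.const_mul (Real.exp (C ^ 2 / (4 * c)))) (by fun_prop) (ae_of_all _ fun g => ?_)
  rw [Real.norm_of_nonneg (Real.exp_pos _).le, ← Real.exp_add, Real.exp_le_exp]
  have : C ^ 2 / (4 * c) + c * ‖g‖ ^ 2 - C * ‖g‖ = (C - 2 * c * ‖g‖) ^ 2 / (4 * c) := by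
    field_simp; ring
  have h2 : 0 ≤ (C - 2 * c * ‖g‖) ^ 2 / (4 * c) := by positivity
  linarith

/-- at most exponential growth -/
def EG (F : E → ℝ) : Prop := ∃ C, 0 ≤ C ∧ ∀ g, |F g| ≤ C * Real.exp (C * ‖g‖)

lemma EG.integrable {F : E → ℝ} (h : EG F) (hm : Measurable F) (μ : Measure E) [IsGaussian μ] : Integrable F μ := by
  obtain ⟨C, hC, h⟩ := h
  exact Integrable.mono' ((expn_int μ C).const_mul C) hm.aestronglyMeasurable (ae_of_all _ h)

lemma EG.of_le {F : E → ℝ} (A B : ℝ) (h : ∀ g, |F g| ≤ A * Real.exp (B * ‖g‖)) : EG F := by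
  refine ⟨max (max A B) 0, le_max_right _ _, fun g => (h g).trans ?_⟩
  have h1 : A ≤ max (max A B) 0 := (le_max_left _ _).trans (le_max_left _ _)
  have h2 : B ≤ max (max A B) 0 := (le_max_right _ _).trans (le_max_left _ _)
  have : (0:ℝ) ≤ max (max A B) 0 := le_max_right _ _
  gcongr

lemma EG.mul {F G : E → ℝ} (hF : EG F) (hG : EG G) : EG (fun g => F g * G g) := by
  obtain ⟨C, hC, h⟩ := hF
  obtain ⟨D, hD, h'⟩ := hG
  refine EG.of_le (C * D) (C + D) fun g => ?_
  rw [abs_mul, add_mul, Real.exp_add, mul_mul_mul_comm]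
  exact mul_le_mul (h g) (h' g) (abs_nonneg _) (by positivity)

lemma EG.mono {F G : E → ℝ} (hF : EG F) (h : ∀ g, |G g| ≤ |F g|) : EG G := by
  obtain ⟨C, hC, h'⟩ := hF
  exact ⟨C, hC, fun g => (h g).trans (h' g)⟩

lemma EG.inner (v : E) : EG (fun g : E => inner ℝ g v) := by
  refine EG.of_le ‖v‖ 1 fun g => (abs_real_inner_le_norm _ _).trans ?_
  rw [mul_comm, one_mul]
  have := Real.add_one_le_exp ‖g‖
  gcongr; linarith

lemma EG.const (c : ℝ) : EG (fun _ : E => c) :=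
  EG.of_le |c| 0 fun g => by simp

lemma EG.finsum {ι : Type*} (s : Finset ι) {F : ι → E → ℝ} (h : ∀ i ∈ s, EG (F i)) : EG (fun g => ∑ i ∈ s, F i g) := by
  classical
  induction s using Finset.induction_on with
  | empty => simpa using EG.const 0
  | insert a s ha ih =>
    obtain ⟨C, hC, h1⟩ := h a (Finset.mem_insert_self _ _)
    obtain ⟨D, hD, h2⟩ := ih fun i hi => h i (Finset.mem_insert_of_mem hi)
    refine EG.of_le (C + D) (C + D) fun g => ?_
    rw [Finset.sum_insert ha]
    refine (abs_add_le _ _).trans ((add_le_add (h1 g) (h2 g)).trans ?_)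
    rw [add_mul C D (Real.exp _)]
    have := norm_nonneg g
    gcongr <;> linarith

lemma stein1 {F F' : ℝ → ℝ} (hF : ∀ x, HasDerivAt F (F' x) x) (hm : Measurable F') (h1 : EG F) (h2 : EG F') :
    ∫ x, x * F x ∂(gaussianReal 0 1) = ∫ x, F' x ∂(gaussianReal 0 1) := by
  have hFm : Measurable F := (continuous_iff_continuousAt.2 fun x => (hF x).continuousAt).measurable
  have cv : ∀ {G : ℝ → ℝ}, EG G → Measurable G → Integrable (fun x => gaussianPDFReal 0 1 x * G x) := by
    intro G hG hGm
    have i := hG.integrable hGm (gaussianReal 0 1)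
    rw [gaussianReal_of_var_ne_zero _ one_ne_zero, integrable_withDensity_iff_integrable_smul' (measurable_gaussianPDF 0 1)
      (ae_of_all _ fun _ => gaussianPDF_lt_top)] at i
    simpa [gaussianPDF, ENNReal.toReal_ofReal (gaussianPDFReal_nonneg _ _ _)] using i
  have hx : EG (fun x : ℝ => x) := EG.of_le 1 1 fun g => by
    rw [one_mul, one_mul, Real.norm_eq_abs]; linarith [Real.add_one_le_exp |g|]
  have hd : ∀ x, HasDerivAt (gaussianPDFReal 0 1) (-(x * gaussianPDFReal 0 1 x)) x := by
    intro x
    have : HasDerivAt (fun x : ℝ => (√(2 * π * (1:NNReal)))⁻¹ * Real.exp (-(x - 0) ^ 2 / (2 * (1:NNReal)))) 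
      ((√(2 * π * (1:NNReal)))⁻¹ * (Real.exp (-(x - 0) ^ 2 / (2 * (1:NNReal))) * (-(2 * (x - 0) ^ (2-1) * 1) / (2 * (1:NNReal))))) x := by
      exact ((((((hasDerivAt_id x).sub_const 0).pow 2).neg).div_const _).exp).const_mul _
    rw [show gaussianPDFReal 0 1 = fun x : ℝ => (√(2 * π * (1:NNReal)))⁻¹ * Real.exp (-(x - 0) ^ 2 / (2 * (1:NNReal))) from rfl]
    convert this using 1
    simp; ring
  have := integral_mul_deriv_eq_deriv_mul_of_integrable (u := F) (u' := F') (v := gaussianPDFReal 0 1)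
    (v' := fun x => -(x * gaussianPDFReal 0 1 x)) (fun x _ => hF x) (fun x _ => hd x) ?_ ?_ ?_
  · rw [integral_gaussianReal_eq_integral_smul one_ne_zero, integral_gaussianReal_eq_integral_smul one_ne_zero]
    simp only [smul_eq_mul]
    have e : ∫ x, gaussianPDFReal 0 1 x * (x * F x) = - ∫ x, F x * -(x * gaussianPDFReal 0 1 x) := by
      rw [← integral_neg]; congr 1; ext x; ring
    rw [e, this, neg_neg]; congr 1; ext x; ring
  · refine (cv (hx.mul h1) (measurable_id.mul hFm)).neg.congr (ae_of_all _ fun x => ?_)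
    simp; ring
  · refine (cv h2 hm).congr (ae_of_all _ fun x => ?_)
    simp; ring
  · refine (cv h1 hFm).congr (ae_of_all _ fun x => ?_)
    simp; ring

lemma split_law {v : E} (hv : ‖v‖ = 1) :
    Measure.map (fun q : ℝ × E => q.1 • v + (q.2 - inner ℝ v q.2 • v)) ((gaussianReal 0 1).prod (stdGaussian E)) = stdGaussian E := by
  refine Measure.ext_of_charFun (funext fun t => ?_)
  rw [charFun_apply, integral_map (by fun_prop) (by fun_prop)]
  have e : ∀ q : ℝ × E, Complex.exp (((inner ℝ (q.1 • v + (q.2 - inner ℝ v q.2 • v)) t : ℝ) : ℂ) * Complex.I)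
      = Complex.exp (((inner ℝ q.1 (inner ℝ v t : ℝ) : ℝ) : ℂ) * Complex.I) * Complex.exp (((inner ℝ q.2 (t - (inner ℝ v t : ℝ) • v) : ℝ) : ℂ) * Complex.I) := by
    intro q
    rw [← Complex.exp_add, ← add_mul, ← Complex.ofReal_add]
    congr 3
    simp only [inner_add_left, inner_sub_left, inner_smul_left, inner_sub_right, inner_smul_right]
    simp [real_inner_comm q.2 v]; ring
  simp_rw [e]
  rw [integral_prod_mul (fun x : ℝ => Complex.exp (((inner ℝ x (inner ℝ v t : ℝ) : ℝ) : ℂ) * Complex.I))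
    (fun h : E => Complex.exp (((inner ℝ h (t - (inner ℝ v t : ℝ) • v) : ℝ) : ℂ) * Complex.I)), ← charFun_apply, ← charFun_apply,
    charFun_stdGaussian, charFun_stdGaussian, charFun_gaussianReal, ← Complex.exp_add]
  congr 1
  have : ‖t - (inner ℝ v t : ℝ) • v‖ ^ 2 = ‖t‖ ^ 2 - (inner ℝ v t : ℝ) ^ 2 := by
    rw [norm_sub_sq_real, norm_smul, hv, inner_smul_right, real_inner_comm v t]; simp; ring
  have h2 : ((‖t - (inner ℝ v t : ℝ) • v‖ : ℂ)) ^ 2 = (‖t‖ : ℂ) ^ 2 - ((inner ℝ v t : ℝ) : ℂ) ^ 2 := by exact_mod_cast this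
  rw [h2]; simp; ring

lemma stein_unit {v : E} (hv : ‖v‖ = 1) {F F' : E → ℝ} (hF : ∀ g, HasDerivAt (fun t : ℝ => F (g + t • v)) (F' g) 0)
    (hm : Measurable F) (hm' : Measurable F') (h1 : EG F) (h2 : EG F') :
    ∫ g, inner ℝ g v * F g ∂(stdGaussian E) = ∫ g, F' g ∂(stdGaussian E) := by
  have hvv : inner ℝ v v = (1:ℝ) := by rw [real_inner_self_eq_norm_sq, hv]; norm_num
  have I1 : Integrable (fun g : E => inner ℝ g v * F g) (stdGaussian E) :=
    ((EG.inner v).mul h1).integrable (by fun_prop) _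
  have I2 : Integrable F' (stdGaussian E) := h2.integrable hm' _
  rw [← split_law hv] at I1 I2
  rw [← split_law hv, integral_map (by fun_prop) (by fun_prop), integral_map (by fun_prop) (by fun_prop)]
  rw [integrable_map_measure (by fun_prop) (by fun_prop)] at I1 I2
  simp only [Function.comp_def] at I1 I2
  rw [integral_prod_symm _ I1, integral_prod_symm _ I2]
  congr 1; ext h
  simp only
  set k := h - inner ℝ v h • v with hk
  have hk0 : inner ℝ k v = (0:ℝ) := by
    rw [hk, inner_sub_left, inner_smul_left, hvv, real_inner_comm v h]; simp
  have : ∀ x : ℝ, inner ℝ (x • v + k) v = x := by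
    intro x; rw [inner_add_left, inner_smul_left, hvv, hk0]; simp
  simp only [this]
  have gr : ∀ {G : E → ℝ}, EG G → EG (fun x : ℝ => G (x • v + k)) := by
    rintro G ⟨C, hC, hG⟩
    refine EG.of_le (C * Real.exp (C * ‖k‖)) C fun x => (hG _).trans ?_
    rw [mul_assoc, ← Real.exp_add]
    have : ‖x • v + k‖ ≤ ‖x‖ + ‖k‖ := (norm_add_le _ _).trans (by rw [norm_smul, hv, mul_one])
    gcongr
    nlinarith
  refine stein1 (F := fun x => F (x • v + k)) (F' := fun x => F' (x • v + k)) (fun x => ?_) (by fun_prop) (gr h1) (gr h2)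
  have := hF (x • v + k)
  have h3 : HasDerivAt (fun t : ℝ => F (x • v + k + (t - x) • v)) (F' (x • v + k)) x := by
    have h4 : HasDerivAt (fun t : ℝ => F (x • v + k + t • v)) (F' (x • v + k)) (x - x) := by rwa [sub_self]
    exact h4.comp_sub_const x x
  refine h3.congr_of_eventuallyEq (Eventually.of_forall fun t => ?_)
  simp only [sub_smul]; congr 1; abel

lemma stein {v : E} {F F' : E → ℝ} (hF : ∀ g, HasDerivAt (fun t : ℝ => F (g + t • v)) (F' g) 0)
    (hm : Measurable F) (hm' : Measurable F') (h1 : EG F) (h2 : EG F') :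
    ∫ g, inner ℝ g v * F g ∂(stdGaussian E) = ∫ g, F' g ∂(stdGaussian E) := by
  rcases eq_or_ne v 0 with rfl | hv
  · have : ∀ g, F' g = 0 := fun g => (hF g).unique (by simpa using hasDerivAt_const (0:ℝ) (F g))
    simp [this]
  · have hn : ‖v‖ ≠ 0 := norm_ne_zero_iff.2 hv
    have hu : ‖(‖v‖⁻¹ • v)‖ = 1 := by rw [norm_smul, norm_inv, norm_norm, inv_mul_cancel₀ hn]
    have := stein_unit hu (F := F) (F' := fun g => F' g * ‖v‖⁻¹) (fun g => ?_) hm (by fun_prop) h1 (h2.mul (EG.const _))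
    · simp only [inner_smul_right] at this
      rw [integral_mul_const] at this
      have e : ∫ g, ‖v‖⁻¹ * inner ℝ g v * F g ∂(stdGaussian E) = ‖v‖⁻¹ * ∫ g, inner ℝ g v * F g ∂(stdGaussian E) := by
        rw [← integral_const_mul]; congr 1; ext g; ring
      rw [e, mul_comm] at this
      exact mul_right_cancel₀ (inv_ne_zero hn) this
    · have h3 : HasDerivAt (fun t : ℝ => t * ‖v‖⁻¹) ‖v‖⁻¹ 0 := by
        simpa using (hasDerivAt_id (0:ℝ)).mul_const ‖v‖⁻¹
      have h4 : HasDerivAt (fun t : ℝ => F (g + t • v)) (F' g) (0 * ‖v‖⁻¹) := by rw [zero_mul]; exact hF g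
      have := HasDerivAt.comp (0:ℝ) h4 h3
      refine this.congr_of_eventuallyEq (Eventually.of_forall fun t => ?_)
      simp [mul_smul]

end gauss

section interp
set_option linter.unusedSectionVars false
variable {E : Type*} [NormedAddCommGroup E] [InnerProductSpace ℝ E] [FiniteDimensional ℝ E]
  [MeasurableSpace E] [BorelSpace E]
variable {T : Type*} [Fintype T] [Nonempty T]

def ZZ (β : ℝ) (x : Bool × T → ℝ) (l : Bool) : ℝ := ∑ i, Real.exp (β * x (l, i))
def fI (β : ℝ) (p : Bool → ℝ) (x : Bool × T → ℝ) : ℝ := Real.exp (∑ l, p l * Real.log (ZZ β x l))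
def wt (β : ℝ) (x : Bool × T → ℝ) (k : Bool × T) : ℝ := Real.exp (β * x k) / ZZ β x k.1

lemma ZZ_pos (β : ℝ) (x : Bool × T → ℝ) (l : Bool) : 0 < ZZ β x l :=
  Finset.sum_pos (fun _ _ => Real.exp_pos _) Finset.univ_nonempty
lemma fI_pos (β : ℝ) (p : Bool → ℝ) (x : Bool × T → ℝ) : 0 < fI β p x := Real.exp_pos _
lemma wt_nonneg (β : ℝ) (x : Bool × T → ℝ) (k : Bool × T) : 0 ≤ wt β x k :=
  div_nonneg (Real.exp_pos _).le (ZZ_pos _ _ _).le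
lemma wt_sum (β : ℝ) (x : Bool × T → ℝ) (l : Bool) : ∑ i, wt β x (l, i) = 1 := by
  unfold wt
  simp only
  rw [← Finset.sum_div]
  exact div_self (ZZ_pos _ _ _).ne'
lemma wt_le_one (β : ℝ) (x : Bool × T → ℝ) (k : Bool × T) : wt β x k ≤ 1 := by
  rw [← wt_sum β x k.1]
  exact Finset.single_le_sum (f := fun i => wt β x (k.1, i)) (fun i _ => wt_nonneg β x (k.1, i)) (Finset.mem_univ k.2)

lemma ZZ_deriv (β : ℝ) {x : ℝ → Bool × T → ℝ} {x' : Bool × T → ℝ} {t : ℝ} (hx : ∀ k, HasDerivAt (fun s => x s k) (x' k) t) (l : Bool) :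
    HasDerivAt (fun s => ZZ β (x s) l) (∑ i, Real.exp (β * x t (l, i)) * (β * x' (l, i))) t := by
  unfold ZZ
  exact HasDerivAt.fun_sum fun i _ => ((hx (l, i)).const_mul β).exp

lemma ZZ_deriv' (β : ℝ) {x : ℝ → Bool × T → ℝ} {x' : Bool × T → ℝ} {t : ℝ} (hx : ∀ k, HasDerivAt (fun s => x s k) (x' k) t) (l : Bool) :
    HasDerivAt (fun s => ZZ β (x s) l) (ZZ β (x t) l * (β * ∑ i, wt β (x t) (l, i) * x' (l, i))) t := by
  convert ZZ_deriv β hx l using 1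
  unfold wt
  rw [Finset.mul_sum, Finset.mul_sum]
  refine Finset.sum_congr rfl fun i _ => ?_
  have := (ZZ_pos β (x t) l).ne'
  simp only; field_simp

lemma fI_deriv (β : ℝ) (p : Bool → ℝ) {x : ℝ → Bool × T → ℝ} {x' : Bool × T → ℝ} {t : ℝ} (hx : ∀ k, HasDerivAt (fun s => x s k) (x' k) t) :
    HasDerivAt (fun s => fI β p (x s)) (fI β p (x t) * (β * ∑ k, p k.1 * wt β (x t) k * x' k)) t := by
  unfold fI
  have : HasDerivAt (fun s => ∑ l, p l * Real.log (ZZ β (x s) l)) (∑ l, p l * (ZZ β (x t) l * (β * ∑ i, wt β (x t) (l, i) * x' (l, i)) / ZZ β (x t) l)) t :=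
    HasDerivAt.fun_sum fun l _ => ((ZZ_deriv' β hx l).log (ZZ_pos β (x t) l).ne').const_mul (p l)
  convert this.exp using 2
  rw [Fintype.sum_prod_type, Finset.mul_sum]
  refine Finset.sum_congr rfl fun l _ => ?_
  have := (ZZ_pos β (x t) l).ne'
  rw [mul_div_cancel_left₀ _ this, mul_left_comm, Finset.mul_sum (a := p l)]
  simp only [mul_assoc]

lemma wt_deriv (β : ℝ) {x : ℝ → Bool × T → ℝ} {x' : Bool × T → ℝ} {t : ℝ} (hx : ∀ k, HasDerivAt (fun s => x s k) (x' k) t) (k : Bool × T) :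
    HasDerivAt (fun s => wt β (x s) k) (β * (wt β (x t) k * (x' k - ∑ i, wt β (x t) (k.1, i) * x' (k.1, i)))) t := by
  have hz := (ZZ_pos β (x t) k.1).ne'
  refine ((((hx k).const_mul β).exp).div (ZZ_deriv' β hx k.1) hz).congr_deriv ?_
  set S := ∑ i, wt β (x t) (k.1, i) * x' (k.1, i)
  unfold wt
  field_simp

lemma fk_deriv (β : ℝ) (p : Bool → ℝ) {x : ℝ → Bool × T → ℝ} {x' : Bool × T → ℝ} {t : ℝ} (hx : ∀ k, HasDerivAt (fun s => x s k) (x' k) t) (k : Bool × T) :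
    HasDerivAt (fun s => p k.1 * wt β (x s) k * fI β p (x s))
      (β * fI β p (x t) * (p k.1 * wt β (x t) k * (∑ j, p j.1 * wt β (x t) j * x' j + x' k - ∑ i, wt β (x t) (k.1, i) * x' (k.1, i)))) t := by
  refine (((wt_deriv β hx k).const_mul (p k.1)).mul (fI_deriv β p hx)).congr_deriv ?_
  ring

lemma fI_bd (β : ℝ) (p : Bool → ℝ) {x : Bool × T → ℝ} {B : ℝ} (hx : ∀ k, |x k| ≤ B) :
    fI β p x ≤ Real.exp ((∑ l, |p l|) * (Real.log (Fintype.card T) + |β| * B)) := by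
  unfold fI
  rw [Real.exp_le_exp, Finset.sum_mul]
  refine Finset.sum_le_sum fun l _ => (le_abs_self _).trans ?_
  rw [abs_mul]
  refine mul_le_mul_of_nonneg_left ?_ (abs_nonneg _)
  have hc : (1:ℝ) ≤ Fintype.card T := by exact_mod_cast Fintype.card_pos
  have hb : ∀ k, |β * x k| ≤ |β| * B := fun k => by
    rw [abs_mul]; exact mul_le_mul_of_nonneg_left (hx k) (abs_nonneg _)
  have up : ZZ β x l ≤ Fintype.card T * Real.exp (|β| * B) := by
    unfold ZZ
    refine (Finset.sum_le_card_nsmul Finset.univ _ (Real.exp (|β| * B)) fun i _ => Real.exp_le_exp.2 ((le_abs_self _).trans (hb _))).trans ?_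
    simp
  have lo : Real.exp (-(|β| * B)) ≤ ZZ β x l := by
    obtain ⟨i⟩ := ‹Nonempty T›
    refine le_trans (Real.exp_le_exp.2 ?_) (Finset.single_le_sum (f := fun i => Real.exp (β * x (l, i))) (fun i _ => (Real.exp_pos _).le) (Finset.mem_univ i))
    exact (abs_le.1 (hb (l, i))).1
  rw [abs_le]
  constructor
  · have := Real.log_le_log (Real.exp_pos _) lo
    rw [Real.log_exp] at this
    linarith [Real.log_nonneg hc]
  · have := Real.log_le_log (ZZ_pos β x l) up
    rwa [Real.log_mul (by positivity) (Real.exp_pos _).ne', Real.log_exp] at this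

lemma fI_meas (β : ℝ) (p : Bool → ℝ) : Continuous (fun x : Bool × T → ℝ => fI β p x) := by
  unfold fI
  refine Real.continuous_exp.comp (continuous_finsetSum _ fun l _ => continuous_const.mul (Continuous.log ?_ fun x => (ZZ_pos β x l).ne'))
  unfold ZZ; fun_prop

lemma wt_meas (β : ℝ) (k : Bool × T) : Continuous (fun x : Bool × T → ℝ => wt β x k) := by
  unfold wt
  refine Continuous.div (by fun_prop) ?_ fun x => (ZZ_pos β x _).ne'
  unfold ZZ; fun_prop

/-- Gaussian interpolation inequality. -/
lemma interp (β : ℝ) (p : Bool → ℝ) (a b : Bool × T → E) (hab : ∀ k j, inner ℝ (a k) (b j) = (0:ℝ)) (c : ℝ)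
    (hD : ∀ w : Bool × T → ℝ, (∀ k, 0 ≤ w k) → (∀ l, ∑ i, w (l, i) = 1) →
      β ^ 2 * ∑ k, p k.1 * w k * (∑ j, p j.1 * w j * (inner ℝ (b k) (b j) - inner ℝ (a k) (a j)) + (inner ℝ (b k) (b k) - inner ℝ (a k) (a k))
        - ∑ i, w (k.1, i) * (inner ℝ (b k) (b (k.1, i)) - inner ℝ (a k) (a (k.1, i)))) ≤ 2 * c) :
    ∫ g, fI β p (fun k => inner ℝ g (b k)) ∂(stdGaussian E) ≤ Real.exp c * ∫ g, fI β p (fun k => inner ℝ g (a k)) ∂(stdGaussian E) := by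
  let v : ℝ → Bool × T → E := fun θ k => Real.cos θ • a k + Real.sin θ • b k
  let v' : ℝ → Bool × T → E := fun θ k => (-Real.sin θ) • a k + Real.cos θ • b k
  let X : ℝ → E → Bool × T → ℝ := fun θ g k => inner ℝ g (v θ k)
  let M : ℝ := ∑ k, (‖a k‖ + ‖b k‖)
  have hM : ∀ k, ‖a k‖ + ‖b k‖ ≤ M := fun k =>
    Finset.single_le_sum (f := fun k => ‖a k‖ + ‖b k‖) (fun _ _ => by positivity) (Finset.mem_univ k)
  have hvn : ∀ θ k, ‖v θ k‖ ≤ M := fun θ k => by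
    refine le_trans ((norm_add_le _ _).trans ?_) (hM k)
    rw [norm_smul, norm_smul]
    have h1 := Real.abs_cos_le_one θ
    have h2 := Real.abs_sin_le_one θ
    simp only [Real.norm_eq_abs]
    nlinarith [norm_nonneg (a k), norm_nonneg (b k)]
  have hvn' : ∀ θ k, ‖v' θ k‖ ≤ M := fun θ k => by
    refine le_trans ((norm_add_le _ _).trans ?_) (hM k)
    rw [norm_smul, norm_smul]
    have h1 := Real.abs_cos_le_one θ
    have h2 := Real.abs_sin_le_one θ
    simp only [Real.norm_eq_abs, abs_neg]
    nlinarith [norm_nonneg (a k), norm_nonneg (b k)]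
  have hM0 : 0 ≤ M := Finset.sum_nonneg fun k _ => by positivity
  have hXb : ∀ θ g k, |X θ g k| ≤ M * ‖g‖ := fun θ g k => (abs_real_inner_le_norm _ _).trans (by
    rw [mul_comm]; exact mul_le_mul_of_nonneg_right (hvn θ k) (norm_nonneg _))
  let A1 := Real.exp ((∑ l, |p l|) * (Real.log (Fintype.card T)))
  let A2 := (∑ l, |p l|) * (|β| * M)
  have hfb : ∀ θ g, fI β p (X θ g) ≤ A1 * Real.exp (A2 * ‖g‖) := fun θ g => by
    refine (fI_bd β p (hXb θ g)).trans (le_of_eq ?_)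
    rw [← Real.exp_add]; congr 1; ring
  have hXm : ∀ θ, Measurable (X θ) := fun θ => measurable_pi_lambda _ fun k => by fun_prop
  have hfm : ∀ θ, Measurable (fun g => fI β p (X θ g)) := fun θ => (fI_meas β p).measurable.comp (hXm θ)
  have hwm : ∀ θ k, Measurable (fun g => wt β (X θ g) k) := fun θ k => (wt_meas β k).measurable.comp (hXm θ)
  have hfE : ∀ θ, EG (fun g => fI β p (X θ g)) := fun θ => EG.of_le A1 A2 fun g => by
    rw [abs_of_pos (fI_pos _ _ _)]; exact hfb θ g
  have hwE : ∀ θ k, EG (fun g => wt β (X θ g) k) := fun θ k => EG.of_le 1 0 fun g => by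
    rw [abs_of_nonneg (wt_nonneg _ _ _)]; simpa using wt_le_one β (X θ g) k
  -- derivative in θ
  let F' : ℝ → E → ℝ := fun θ g => fI β p (X θ g) * (β * ∑ k, p k.1 * wt β (X θ g) k * inner ℝ g (v' θ k))
  have hdθ : ∀ g θ, HasDerivAt (fun θ => fI β p (X θ g)) (F' θ g) θ := fun g θ => by
    refine fI_deriv β p fun k => ?_
    have h1 : ∀ s, X s g k = Real.cos s * inner ℝ g (a k) + Real.sin s * inner ℝ g (b k) := fun s => by
      simp [X, v, inner_add_right, inner_smul_right]
    have h2 : inner ℝ g (v' θ k) = -Real.sin θ * inner ℝ g (a k) + Real.cos θ * inner ℝ g (b k) := by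
      simp [v', inner_add_right, inner_smul_right]
    simp only [h1, h2]
    exact ((Real.hasDerivAt_cos θ).mul_const _).add ((Real.hasDerivAt_sin θ).mul_const _)
  let P : ℝ := ∑ k : Bool × T, |p k.1|
  have hF'b : ∀ θ g, |F' θ g| ≤ A1 * Real.exp (A2 * ‖g‖) * (|β| * (P * (M * Real.exp (1 * ‖g‖)))) := fun θ g => by
    rw [abs_mul, abs_mul, abs_of_pos (fI_pos _ _ _)]
    have : |∑ k, p k.1 * wt β (X θ g) k * inner ℝ g (v' θ k)| ≤ P * (M * Real.exp (1 * ‖g‖)) := by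
      refine (Finset.abs_sum_le_sum_abs _ _).trans ?_
      rw [Finset.sum_mul]
      refine Finset.sum_le_sum fun k _ => ?_
      rw [abs_mul, abs_mul, mul_assoc]
      refine mul_le_mul_of_nonneg_left ?_ (abs_nonneg _)
      have h1 : |inner ℝ g (v' θ k)| ≤ M * Real.exp (1 * ‖g‖) := (abs_real_inner_le_norm _ _).trans (by
        rw [mul_comm, one_mul]
        have := Real.add_one_le_exp ‖g‖
        exact mul_le_mul (hvn' θ k) (by linarith) (norm_nonneg _) hM0)
      rw [abs_of_nonneg (wt_nonneg _ _ _)]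
      nlinarith [wt_le_one β (X θ g) k, wt_nonneg β (X θ g) k, abs_nonneg (inner ℝ g (v' θ k))]
    exact mul_le_mul (hfb θ g) (mul_le_mul_of_nonneg_left this (abs_nonneg _)) (by positivity) (by positivity)
  have hbi : Integrable (fun g : E => A1 * Real.exp (A2 * ‖g‖) * (|β| * (P * (M * Real.exp (1 * ‖g‖))))) (stdGaussian E) := by
    have := (expn_int (stdGaussian E) (A2 + 1)).const_mul (A1 * (|β| * (P * M)))
    refine this.congr (ae_of_all _ fun g => ?_)
    simp only [add_mul, Real.exp_add]; ring
  have hmF' : ∀ θ, Measurable (F' θ) := fun θ => by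
    refine (hfm θ).mul (measurable_const.mul (Finset.measurable_sum _ fun k _ => ?_))
    exact (measurable_const.mul (hwm θ k)).mul (by fun_prop)
  let φ : ℝ → ℝ := fun θ => ∫ g, fI β p (X θ g) ∂(stdGaussian E)
  have hφ : ∀ θ, HasDerivAt φ (∫ g, F' θ g ∂(stdGaussian E)) θ := fun θ =>
    (hasDerivAt_integral_of_dominated_loc_of_deriv_le (s := univ) univ_mem
      (Eventually.of_forall fun s => (hfm s).aestronglyMeasurable) ((hfE θ).integrable (hfm θ) _)
      (hmF' θ).aestronglyMeasurable (ae_of_all _ fun g s _ => hF'b s g) hbi (ae_of_all _ fun g s _ => hdθ g s)).2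
  -- Stein
  have hle : ∀ θ, 0 ≤ Real.sin θ * Real.cos θ → ∫ g, F' θ g ∂(stdGaussian E) ≤ 2 * c * (Real.sin θ * Real.cos θ) * φ θ := fun θ hθ => by
    let Dv : Bool × T → E → ℝ := fun k g => β * fI β p (X θ g) * (p k.1 * wt β (X θ g) k * (∑ j, p j.1 * wt β (X θ g) j * inner ℝ (v' θ k) (v θ j) + inner ℝ (v' θ k) (v θ k) - ∑ i, wt β (X θ g) (k.1, i) * inner ℝ (v' θ k) (v θ (k.1, i))))
    have hDm : ∀ k, Measurable (Dv k) := fun k => by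
      refine (measurable_const.mul (hfm θ)).mul ((measurable_const.mul (hwm θ k)).mul (((Finset.measurable_sum _ fun j _ => ?_).add measurable_const).sub (Finset.measurable_sum _ fun i _ => ?_)))
      · exact (measurable_const.mul (hwm θ j)).mul measurable_const
      · exact (hwm θ _).mul measurable_const
    have hDE : ∀ k, EG (Dv k) := fun k => by
      have e : Dv k = fun g => β * fI β p (X θ g) * (p k.1 * wt β (X θ g) k * (∑ j, p j.1 * wt β (X θ g) j * inner ℝ (v' θ k) (v θ j) + ∑ i ∈ ({0} : Finset ℕ), inner ℝ (v' θ k) (v θ k) + ∑ i, (-1) * (wt β (X θ g) (k.1, i) * inner ℝ (v' θ k) (v θ (k.1, i))))) := by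
        ext g; simp only [Dv, Finset.sum_singleton, neg_mul, one_mul, Finset.sum_neg_distrib]; ring
      have ad : ∀ {F G : E → ℝ}, EG F → EG G → EG (fun g => F g + G g) := fun {F G} hF hG => by
        have := EG.finsum (Finset.univ : Finset Bool) (F := fun b => if b then F else G) (fun b _ => by cases b <;> simpa)
        simpa using this
      rw [e]
      refine ((EG.const β).mul (hfE θ)).mul (((EG.const _).mul (hwE θ k)).mul (ad (ad (EG.finsum _ fun j _ => ?_) (EG.finsum _ fun j _ => EG.const _)) (EG.finsum _ fun i _ => ?_)))
      · exact ((EG.const _).mul (hwE θ j)).mul (EG.const _)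
      · exact (EG.const _).mul ((hwE θ _).mul (EG.const _))
    have hGE : ∀ k, EG (fun g => p k.1 * wt β (X θ g) k * fI β p (X θ g)) := fun k => ((EG.const _).mul (hwE θ k)).mul (hfE θ)
    have hGm : ∀ k, Measurable (fun g => p k.1 * wt β (X θ g) k * fI β p (X θ g)) := fun k => (measurable_const.mul (hwm θ k)).mul (hfm θ)
    have hst : ∀ k, ∫ g, inner ℝ g (v' θ k) * (p k.1 * wt β (X θ g) k * fI β p (X θ g)) ∂(stdGaussian E) = ∫ g, Dv k g ∂(stdGaussian E) := fun k => by
      refine stein (fun g => ?_) (hGm k) (hDm k) (hGE k) (hDE k)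
      have := fk_deriv β p (x := fun t => X θ (g + t • v' θ k)) (x' := fun j => inner ℝ (v' θ k) (v θ j)) (t := 0) (fun j => ?_) k
      · simpa only [zero_smul, add_zero] using this
      · have h1 : ∀ s : ℝ, X θ (g + s • v' θ k) j = X θ g j + s * inner ℝ (v' θ k) (v θ j) := fun s => by
          simp [X, inner_add_left, inner_smul_left]
        simp only [h1]
        simpa using ((hasDerivAt_id (0:ℝ)).mul_const (inner ℝ (v' θ k) (v θ j))).const_add (X θ g j)
    have e1 : ∫ g, F' θ g ∂(stdGaussian E) = ∫ g, β * ∑ k, Dv k g ∂(stdGaussian E) := by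
      have : ∀ g, F' θ g = β * ∑ k, inner ℝ g (v' θ k) * (p k.1 * wt β (X θ g) k * fI β p (X θ g)) := fun g => by
        simp only [F']; rw [mul_left_comm, Finset.mul_sum]; congr 1
        exact Finset.sum_congr rfl fun k _ => by ring
      simp_rw [this]
      rw [integral_const_mul, integral_const_mul, integral_finsetSum, integral_finsetSum]
      · simp_rw [hst]
      · exact fun k _ => (hDE k).integrable (hDm k) _
      · exact fun k _ => ((EG.inner _).mul (hGE k)).integrable ((by fun_prop : Measurable fun g : E => inner ℝ g (v' θ k)).mul (hGm k)) _
    rw [e1, ← integral_const_mul]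
    have hDs : EG (fun g => β * ∑ k, Dv k g) := (EG.const _).mul (EG.finsum _ fun k _ => hDE k)
    refine integral_mono (hDs.integrable (measurable_const.mul (Finset.measurable_sum _ fun k _ => hDm k)) _) (((hfE θ).integrable (hfm θ) _).const_mul _) fun g => ?_
    have hin : ∀ k j, inner ℝ (v' θ k) (v θ j) = Real.sin θ * Real.cos θ * (inner ℝ (b k) (b j) - inner ℝ (a k) (a j)) := fun k j => by
      simp only [v, v', inner_add_left, inner_add_right, inner_smul_left, inner_smul_right, hab, real_inner_comm (a j) (b k)]
      simp; ring
    have h := hD (wt β (X θ g)) (wt_nonneg _ _) (wt_sum _ _)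
    have hpos : 0 ≤ Real.sin θ * Real.cos θ * fI β p (X θ g) := mul_nonneg hθ (fI_pos _ _ _).le
    have h2 := mul_le_mul_of_nonneg_left h hpos
    have e2 : β * ∑ k, Dv k g = Real.sin θ * Real.cos θ * fI β p (X θ g) * (β ^ 2 * ∑ k, p k.1 * wt β (X θ g) k * (∑ j, p j.1 * wt β (X θ g) j * (inner ℝ (b k) (b j) - inner ℝ (a k) (a j)) + (inner ℝ (b k) (b k) - inner ℝ (a k) (a k))
        - ∑ i, wt β (X θ g) (k.1, i) * (inner ℝ (b k) (b (k.1, i)) - inner ℝ (a k) (a (k.1, i))))) := by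
      simp only [Dv, hin]
      rw [Finset.mul_sum, Finset.mul_sum, Finset.mul_sum]
      refine Finset.sum_congr rfl fun k _ => ?_
      have s1 : ∑ j, p j.1 * wt β (X θ g) j * (Real.sin θ * Real.cos θ * (inner ℝ (b k) (b j) - inner ℝ (a k) (a j))) = Real.sin θ * Real.cos θ * ∑ j, p j.1 * wt β (X θ g) j * (inner ℝ (b k) (b j) - inner ℝ (a k) (a j)) := by
        rw [Finset.mul_sum]; exact Finset.sum_congr rfl fun j _ => by ring
      have s2 : ∑ i, wt β (X θ g) (k.1, i) * (Real.sin θ * Real.cos θ * (inner ℝ (b k) (b (k.1, i)) - inner ℝ (a k) (a (k.1, i)))) = Real.sin θ * Real.cos θ * ∑ i, wt β (X θ g) (k.1, i) * (inner ℝ (b k) (b (k.1, i)) - inner ℝ (a k) (a (k.1, i))) := by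
        rw [Finset.mul_sum]; exact Finset.sum_congr rfl fun j _ => by ring
      rw [s1, s2]; ring
    simp only [] at *
    rw [e2]
    linarith
  -- monotonicity
  let ψ : ℝ → ℝ := fun θ => φ θ * Real.exp (-(c * Real.sin θ ^ 2))
  have hψ : ∀ θ, HasDerivAt ψ ((∫ g, F' θ g ∂(stdGaussian E)) * Real.exp (-(c * Real.sin θ ^ 2)) + φ θ * (Real.exp (-(c * Real.sin θ ^ 2)) * (-(c * (2 * Real.sin θ ^ (2 - 1) * Real.cos θ))))) θ := fun θ =>
    (hφ θ).mul ((((Real.hasDerivAt_sin θ).pow 2).const_mul c).neg.exp)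
  have hanti : AntitoneOn ψ (Icc 0 (π / 2)) := by
    refine antitoneOn_of_deriv_nonpos (convex_Icc _ _) (fun θ _ => (hψ θ).continuousAt.continuousWithinAt) (fun θ _ => (hψ θ).differentiableAt.differentiableWithinAt) fun θ hθ => ?_
    rw [interior_Icc] at hθ
    rw [(hψ θ).deriv]
    have h1 := hle θ (mul_nonneg (Real.sin_nonneg_of_nonneg_of_le_pi hθ.1.le (by linarith [hθ.2, Real.pi_pos])) (Real.cos_nonneg_of_mem_Icc ⟨by linarith [hθ.1, Real.pi_pos], hθ.2.le⟩))
    have h2 := mul_le_mul_of_nonneg_right h1 (Real.exp_pos (-(c * Real.sin θ ^ 2))).le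
    norm_num
    linarith
  have h := hanti (left_mem_Icc.2 (by positivity)) (right_mem_Icc.2 (by positivity)) (by positivity)
  simp only [ψ, φ, X, v, Real.cos_pi_div_two, Real.sin_pi_div_two, Real.cos_zero, Real.sin_zero, zero_smul, one_smul, zero_add, add_zero] at h
  rw [Real.exp_neg] at h
  norm_num at h
  have hc := Real.exp_pos c
  rw [← div_eq_mul_inv, div_le_iff₀ hc] at h
  linarith

end interp

section g3
set_option linter.unusedSectionVars false
variable {E1 E2 : Type*} [NormedAddCommGroup E1] [InnerProductSpace ℝ E1] [FiniteDimensional ℝ E1]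
  [MeasurableSpace E1] [BorelSpace E1] [NormedAddCommGroup E2] [InnerProductSpace ℝ E2] [FiniteDimensional ℝ E2]
  [MeasurableSpace E2] [BorelSpace E2]
variable {T : Type*} [Fintype T] [Nonempty T]

lemma std_prod : ((stdGaussian E1).prod (stdGaussian E2)).map (WithLp.toLp 2) = stdGaussian (WithLp 2 (E1 × E2)) := by
  have : IsProbabilityMeasure (((stdGaussian E1).prod (stdGaussian E2)).map (WithLp.toLp 2)) :=
    Measure.isProbabilityMeasure_map (by fun_prop)
  apply Measure.ext_of_charFun
  ext t
  rw [charFun_prod, charFun_stdGaussian, charFun_stdGaussian, charFun_stdGaussian, ← Complex.exp_add]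
  have := WithLp.prod_norm_sq_eq_of_L2 t
  have h2 : ((‖t‖ ^ 2 : ℝ) : ℂ) = ((‖t.fst‖ ^ 2 + ‖t.snd‖ ^ 2 : ℝ) : ℂ) := by rw [this]
  push_cast at h2
  rw [h2]
  congr 1
  change -(‖t.fst‖:ℂ) ^ 2 / 2 + -(‖t.snd‖:ℂ) ^ 2 / 2 = _
  ring

lemma int_prod (F : E1 × E2 → ℝ) (hF : Measurable F) :
    ∫ g, F (WithLp.ofLp g) ∂(stdGaussian (WithLp 2 (E1 × E2))) = ∫ g, F g ∂((stdGaussian E1).prod (stdGaussian E2)) := by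
  rw [← std_prod, integral_map (by fun_prop)]
  exact (hF.comp (by fun_prop)).aestronglyMeasurable

lemma int_fst (F : E1 → ℝ) (hF : Measurable F) :
    ∫ g, F (WithLp.ofLp g).1 ∂(stdGaussian (WithLp 2 (E1 × E2))) = ∫ g, F g ∂(stdGaussian E1) := by
  rw [int_prod (fun p => F p.1) (hF.comp measurable_fst), integral_fun_fst]; simp

lemma int_snd (F : E2 → ℝ) (hF : Measurable F) :
    ∫ g, F (WithLp.ofLp g).2 ∂(stdGaussian (WithLp 2 (E1 × E2))) = ∫ g, F g ∂(stdGaussian E2) := by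
  rw [int_prod (fun p => F p.2) (hF.comp measurable_snd), integral_fun_snd]; simp

lemma interp2 (β : ℝ) (p : Bool → ℝ) (a : Bool × T → E1) (b : Bool × T → E2) (c : ℝ)
    (hD : ∀ w : Bool × T → ℝ, (∀ k, 0 ≤ w k) → (∀ l, ∑ i, w (l, i) = 1) →
      β ^ 2 * ∑ k, p k.1 * w k * (∑ j, p j.1 * w j * (inner ℝ (b k) (b j) - inner ℝ (a k) (a j)) + (inner ℝ (b k) (b k) - inner ℝ (a k) (a k))
        - ∑ i, w (k.1, i) * (inner ℝ (b k) (b (k.1, i)) - inner ℝ (a k) (a (k.1, i)))) ≤ 2 * c) :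
    ∫ g, fI β p (fun k => inner ℝ g (b k)) ∂(stdGaussian E2) ≤ Real.exp c * ∫ g, fI β p (fun k => inner ℝ g (a k)) ∂(stdGaussian E1) := by
  have h := interp (E := WithLp 2 (E1 × E2)) β p (fun k => WithLp.toLp 2 (a k, 0)) (fun k => WithLp.toLp 2 (0, b k))
    (fun k j => by simp [WithLp.prod_inner_apply]) c (by
      intro w hw hw1
      simpa [WithLp.prod_inner_apply] using hD w hw hw1)
  simp only [WithLp.prod_inner_apply, inner_zero_right, add_zero, zero_add] at h
  rwa [int_fst (fun g => fI β p (fun k => inner ℝ g (a k))) (by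
      refine (fI_meas β p).measurable.comp (by fun_prop)),
    int_snd (fun g => fI β p (fun k => inner ℝ g (b k))) (by
      refine (fI_meas β p).measurable.comp (by fun_prop))] at h

lemma ZZ_lo {β : ℝ} (hβ : 0 < β) (x : Bool × T → ℝ) (l : Bool) : β * (⨆ i, x (l, i)) ≤ Real.log (ZZ β x l) := by
  obtain ⟨i, hi⟩ := exists_eq_ciSup_of_finite (f := fun i => x (l, i))
  rw [← hi, Real.le_log_iff_exp_le (ZZ_pos _ _ _)]
  exact Finset.single_le_sum (f := fun i => Real.exp (β * x (l, i))) (fun i _ => (Real.exp_pos _).le) (Finset.mem_univ i)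

lemma ZZ_up {β : ℝ} (hβ : 0 < β) (x : Bool × T → ℝ) (l : Bool) : Real.log (ZZ β x l) ≤ Real.log (Fintype.card T) + β * (⨆ i, x (l, i)) := by
  have hc : (0:ℝ) < Fintype.card T := by exact_mod_cast Fintype.card_pos
  rw [Real.log_le_iff_le_exp (ZZ_pos _ _ _), Real.exp_add, Real.exp_log hc]
  unfold ZZ
  refine (Finset.sum_le_card_nsmul Finset.univ _ (Real.exp (β * ⨆ i, x (l, i))) fun i _ => Real.exp_le_exp.2 ?_).trans (by simp)
  exact mul_le_mul_of_nonneg_left (le_ciSup (f := fun i => x (l, i)) (Finite.bddAbove_range _) i) hβ.le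

lemma sup_EG (b : T → E1) (s : ℝ) : EG (fun g : E1 => Real.exp (s * ⨆ i, inner ℝ g (b i))) := by
  refine EG.of_le 1 (|s| * ∑ i, ‖b i‖) fun g => ?_
  rw [abs_of_pos (Real.exp_pos _), one_mul, Real.exp_le_exp]
  obtain ⟨i, hi⟩ := exists_eq_ciSup_of_finite (f := fun i => (inner ℝ g (b i) : ℝ))
  rw [← hi]
  refine (le_abs_self _).trans ?_
  rw [abs_mul, mul_assoc]
  refine mul_le_mul_of_nonneg_left ((abs_real_inner_le_norm _ _).trans ?_) (abs_nonneg _)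
  rw [mul_comm]
  exact mul_le_mul_of_nonneg_right (Finset.single_le_sum (f := fun i => ‖b i‖) (fun i _ => norm_nonneg _) (Finset.mem_univ i)) (norm_nonneg _)

lemma sup_meas (b : T → E1) : Measurable (fun g : E1 => ⨆ i, (inner ℝ g (b i) : ℝ)) :=
  Measurable.iSup fun i => by fun_prop

lemma fI_int (β : ℝ) (p : Bool → ℝ) (b : Bool × T → E1) : Integrable (fun g : E1 => fI β p (fun k => inner ℝ g (b k))) (stdGaussian E1) := by
  refine EG.integrable ?_ ((fI_meas β p).measurable.comp (by fun_prop)) _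
  refine EG.of_le (Real.exp ((∑ l, |p l|) * (Real.log (Fintype.card T)))) ((∑ l, |p l|) * (|β| * ∑ i, ‖b i‖)) fun g => ?_
  change |fI β p (fun k => inner ℝ g (b k))| ≤ _
  rw [abs_of_pos (fI_pos _ _ _), ← Real.exp_add]
  refine (fI_bd β p (B := ‖g‖ * ∑ i, ‖b i‖) fun k => (abs_real_inner_le_norm _ _).trans ?_).trans (Real.exp_le_exp.2 (le_of_eq (by ring)))
  exact mul_le_mul_of_nonneg_left (Finset.single_le_sum (f := fun i => ‖b i‖) (fun i _ => norm_nonneg _) (Finset.mem_univ k)) (norm_nonneg _)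

lemma slepian_fin (a : T → E1) (b : T → E2) {y : ℝ} (hy : 0 < y) (Θ : ℝ)
    (h1 : ∀ i, (inner ℝ (b i) (b i) : ℝ) - inner ℝ (a i) (a i) = -Θ)
    (h2 : ∀ i j, -Θ ≤ (inner ℝ (b i) (b j) : ℝ) - inner ℝ (a i) (a j)) :
    ∫ g, Real.exp (y * ⨆ i, inner ℝ g (b i)) ∂(stdGaussian E2) ≤
      Real.exp (-(y ^ 2 * Θ / 2)) * ∫ g, Real.exp (y * ⨆ i, inner ℝ g (a i)) ∂(stdGaussian E1) := by
  have key : ∀ β : ℝ, y < β → ∫ g, Real.exp (y * ⨆ i, inner ℝ g (b i)) ∂(stdGaussian E2) ≤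
      Real.exp (-(y ^ 2 * Θ / 2)) * (Real.exp (y / β * Real.log (Fintype.card T)) * ∫ g, Real.exp (y * ⨆ i, inner ℝ g (a i)) ∂(stdGaussian E1)) := by
    intro β hβ
    have hβ0 : 0 < β := hy.trans hβ
    have hp1 : y / β ≤ 1 := (div_le_one hβ0).2 hβ.le
    have hp0 : 0 < y / β := by positivity
    let p : Bool → ℝ := fun l => if l then y / β else 0
    have hfI : ∀ x : Bool × T → ℝ, fI β p x = Real.exp (y / β * Real.log (ZZ β x true)) := fun x => by
      unfold fI; congr 1; simp [p]
    have hyb : ∀ t, y / β * (β * t) = y * t := fun t => by field_simp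
    have h := interp2 β p (fun k : Bool × T => a k.2) (fun k => b k.2) (-(y ^ 2 * Θ / 2)) (by
      intro w hw hw1
      rw [Fintype.sum_prod_type]
      simp only [Fintype.sum_bool, p, Fintype.sum_prod_type, if_true, Bool.false_eq_true, if_false, zero_mul, Finset.sum_const_zero, add_zero]
      have hs := hw1 true
      have hw := fun i => hw (true, i)
      generalize hv : (fun i => w (true, i)) = v at *
      have hv' : ∀ i, w (true, i) = v i := fun i => congrFun hv i
      simp only [hv'] at *
      have e1 : ∀ k, y / β * v k * (∑ j, y / β * v j * ((inner ℝ (b k) (b j) : ℝ) - inner ℝ (a k) (a j)) + ((inner ℝ (b k) (b k) : ℝ) - inner ℝ (a k) (a k))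
          - ∑ i, v i * ((inner ℝ (b k) (b i) : ℝ) - inner ℝ (a k) (a i))) ≤ y / β * v k * (-(y / β) * Θ) := fun k => by
        refine mul_le_mul_of_nonneg_left ?_ (mul_nonneg hp0.le (hw k))
        rw [h1 k]
        have : ∑ j, y / β * v j * ((inner ℝ (b k) (b j) : ℝ) - inner ℝ (a k) (a j)) = y / β * ∑ j, v j * ((inner ℝ (b k) (b j) : ℝ) - inner ℝ (a k) (a j)) := by
          rw [Finset.mul_sum]; exact Finset.sum_congr rfl fun _ _ => by ring
        rw [this]
        have h3 : -Θ ≤ ∑ j, v j * ((inner ℝ (b k) (b j) : ℝ) - inner ℝ (a k) (a j)) := by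
          calc -Θ = ∑ j, v j * (-Θ) := by rw [← Finset.sum_mul, hs, one_mul]
            _ ≤ _ := Finset.sum_le_sum fun j _ => mul_le_mul_of_nonneg_left (h2 k j) (hw j)
        nlinarith
      calc _ ≤ β ^ 2 * ∑ k, y / β * v k * (-(y / β) * Θ) := mul_le_mul_of_nonneg_left (Finset.sum_le_sum fun k _ => e1 k) (sq_nonneg _)
        _ = _ := by
          rw [← Finset.sum_mul, ← Finset.mul_sum, hs]; field_simp)
    calc _ ≤ ∫ g, fI β p (fun k => inner ℝ g (b k.2)) ∂(stdGaussian E2) := by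
          refine integral_mono ((sup_EG b y).integrable (Real.measurable_exp.comp ((sup_meas b).const_mul y)) _) (fI_int β p (fun k => b k.2)) fun g => ?_
          simp only [hfI]
          rw [Real.exp_le_exp, ← hyb]
          exact mul_le_mul_of_nonneg_left (ZZ_lo hβ0 (fun k : Bool × T => (inner ℝ g (b k.2) : ℝ)) true) hp0.le
      _ ≤ _ := h
      _ ≤ _ := by
          refine mul_le_mul_of_nonneg_left ?_ (Real.exp_pos _).le
          rw [← integral_const_mul]
          refine integral_mono (fI_int β p (fun k => a k.2)) (((sup_EG a y).integrable (Real.measurable_exp.comp ((sup_meas a).const_mul y)) _).const_mul _) fun g => ?_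
          simp only [hfI]
          rw [← Real.exp_add, Real.exp_le_exp, ← hyb, ← mul_add]
          exact mul_le_mul_of_nonneg_left (ZZ_up hβ0 (fun k : Bool × T => (inner ℝ g (a k.2) : ℝ)) true) hp0.le
  refine ge_of_tendsto (f := fun β : ℝ => Real.exp (-(y ^ 2 * Θ / 2)) * (Real.exp (y / β * Real.log (Fintype.card T)) * ∫ g, Real.exp (y * ⨆ i, inner ℝ g (a i)) ∂(stdGaussian E1))) (x := atTop) ?_ ((eventually_gt_atTop y).mono key)
  have h0 : Tendsto (fun β : ℝ => y / β * Real.log (Fintype.card T)) atTop (nhds 0) := by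
    have h00 : Tendsto (fun β : ℝ => y / β) atTop (nhds 0) := tendsto_const_nhds.div_atTop tendsto_id
    simpa using h00.mul_const (Real.log (Fintype.card T))
  have h3 := ((Real.continuous_exp.tendsto 0).comp h0)
  rw [Real.exp_zero] at h3
  simpa using (h3.mul_const _).const_mul (Real.exp (-(y ^ 2 * Θ / 2)))

lemma conc_int (b : T → E1) {s V : ℝ} (hs : 0 < s) (hV : ∀ i, (inner ℝ (b i) (b i) : ℝ) ≤ V) :
    ∫ g, Real.exp (s * ((⨆ i, inner ℝ g.1 (b i)) - ⨆ i, inner ℝ g.2 (b i))) ∂((stdGaussian E1).prod (stdGaussian E1)) ≤ Real.exp (s ^ 2 * V) := by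
  have hm : Measurable (fun g : E1 × E1 => Real.exp (s * ((⨆ i, inner ℝ g.1 (b i)) - ⨆ i, inner ℝ g.2 (b i)))) :=
    Real.measurable_exp.comp ((((sup_meas b).comp measurable_fst).sub ((sup_meas b).comp measurable_snd)).const_mul s)
  rw [← int_prod _ hm]
  have hC : ∀ i j, (inner ℝ (b i) (b j) : ℝ) ≤ V := fun i j => by
    have h1 := hV i; have h2 := hV j
    have h3 := real_inner_self_nonneg (x := b i - b j)
    rw [inner_sub_left, inner_sub_right, inner_sub_right, real_inner_comm (b i) (b j)] at h3
    linarith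
  have key : ∀ β : ℝ, 0 < β → ∫ g, Real.exp (s * ((⨆ i, inner ℝ (WithLp.ofLp g).1 (b i)) - ⨆ i, inner ℝ (WithLp.ofLp g).2 (b i))) ∂(stdGaussian (WithLp 2 (E1 × E1))) ≤
      Real.exp (s / β * Real.log (Fintype.card T)) * Real.exp (s ^ 2 * V) := by
    intro β hβ0
    have hp0 : 0 < s / β := by positivity
    let p : Bool → ℝ := fun l => if l then s / β else -(s / β)
    let B : Bool × T → WithLp 2 (E1 × E1) := fun k => if k.1 then WithLp.toLp 2 (b k.2, 0) else WithLp.toLp 2 (0, b k.2)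
    have hfI : ∀ x : Bool × T → ℝ, fI β p x = Real.exp (s / β * (Real.log (ZZ β x true) - Real.log (ZZ β x false))) := fun x => by
      unfold fI; congr 1; simp [p]; ring
    have hyb : ∀ t, s / β * (β * t) = s * t := fun t => by field_simp
    have h := interp2 β p (fun k : Bool × T => b k.2) B (s ^ 2 * V) (by
      intro w hw hw1
      have hB : ∀ k j : Bool × T, (inner ℝ (B k) (B j) : ℝ) - inner ℝ (b k.2) (b j.2) = if k.1 = j.1 then 0 else -inner ℝ (b k.2) (b j.2) := by
        rintro ⟨k1, k2⟩ ⟨j1, j2⟩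
        cases k1 <;> cases j1 <;> simp [B, WithLp.prod_inner_apply]
      simp only [hB]
      rw [Fintype.sum_prod_type]
      simp only [Fintype.sum_bool, p, Fintype.sum_prod_type, if_true, Bool.false_eq_true, if_false, mul_zero, Finset.sum_const_zero, add_zero, zero_add, sub_zero, reduceCtorEq]
      have e1 : ∀ k, s / β * w (true, k) * ∑ j, -(s / β) * w (false, j) * -inner ℝ (b k) (b j) ≤ s / β * w (true, k) * (s / β * V) := fun k => by
        refine mul_le_mul_of_nonneg_left ?_ (mul_nonneg hp0.le (hw _))
        calc _ ≤ ∑ j, s / β * w (false, j) * V := Finset.sum_le_sum fun j _ => by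
                have := mul_le_mul_of_nonneg_left (hC k j) (mul_nonneg hp0.le (hw (false, j)))
                linarith
          _ = _ := by rw [← Finset.sum_mul, ← Finset.mul_sum, hw1 false]; ring
      have e2 : ∀ k, -(s / β) * w (false, k) * ∑ j, s / β * w (true, j) * -inner ℝ (b k) (b j) ≤ s / β * w (false, k) * (s / β * V) := fun k => by
        have : -(s / β) * w (false, k) * ∑ j, s / β * w (true, j) * -inner ℝ (b k) (b j) = s / β * w (false, k) * ∑ j, s / β * w (true, j) * inner ℝ (b k) (b j) := by
          rw [Finset.mul_sum, Finset.mul_sum]; exact Finset.sum_congr rfl fun _ _ => by ring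
        rw [this]
        refine mul_le_mul_of_nonneg_left ?_ (mul_nonneg hp0.le (hw _))
        calc _ ≤ ∑ j, s / β * w (true, j) * V := Finset.sum_le_sum fun j _ => 
                mul_le_mul_of_nonneg_left (hC k j) (mul_nonneg hp0.le (hw (true, j)))
          _ = _ := by rw [← Finset.sum_mul, ← Finset.mul_sum, hw1 true]; ring
      calc _ ≤ β ^ 2 * (∑ k, s / β * w (true, k) * (s / β * V) + ∑ k, s / β * w (false, k) * (s / β * V)) :=
            mul_le_mul_of_nonneg_left (add_le_add (Finset.sum_le_sum fun k _ => e1 k) (Finset.sum_le_sum fun k _ => e2 k)) (sq_nonneg _)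
        _ ≤ _ := by
          rw [← Finset.sum_mul, ← Finset.mul_sum, ← Finset.sum_mul, ← Finset.mul_sum, hw1, hw1]; apply le_of_eq; field_simp; ring)
    have hone : ∫ g, fI β p (fun k : Bool × T => inner ℝ g (b k.2)) ∂(stdGaussian E1) = 1 := by
      simp only [hfI]
      have : ∀ g : E1, ZZ β (fun k : Bool × T => (inner ℝ g (b k.2) : ℝ)) true = ZZ β (fun k : Bool × T => (inner ℝ g (b k.2) : ℝ)) false := fun g => by simp [ZZ]
      simp [this]
    rw [hone, mul_one] at h
    refine le_trans ?_ (mul_le_mul_of_nonneg_left h (Real.exp_pos _).le)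
    rw [← integral_const_mul]
    refine integral_mono_of_nonneg (ae_of_all _ fun g => (Real.exp_pos _).le) ((fI_int β p B).const_mul _) (ae_of_all _ fun g => ?_)
    simp only [hfI]
    rw [← Real.exp_add, Real.exp_le_exp, ← hyb, ← mul_add]
    refine mul_le_mul_of_nonneg_left ?_ hp0.le
    have q1 := ZZ_lo hβ0 (fun k : Bool × T => (inner ℝ g (B k) : ℝ)) true
    have q2 := ZZ_up hβ0 (fun k : Bool × T => (inner ℝ g (B k) : ℝ)) false
    have q3 : ∀ i, (inner ℝ g (B (true, i)) : ℝ) = inner ℝ (WithLp.ofLp g).1 (b i) := fun i => by simp [B, WithLp.prod_inner_apply]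
    have q4 : ∀ i, (inner ℝ g (B (false, i)) : ℝ) = inner ℝ (WithLp.ofLp g).2 (b i) := fun i => by simp [B, WithLp.prod_inner_apply]
    simp only [q3] at q1
    simp only [q4] at q2
    rw [mul_sub]
    linarith
  refine ge_of_tendsto (f := fun β : ℝ => Real.exp (s / β * Real.log (Fintype.card T)) * Real.exp (s ^ 2 * V)) (x := atTop) ?_ ((eventually_gt_atTop 0).mono key)
  have h0 : Tendsto (fun β : ℝ => s / β * Real.log (Fintype.card T)) atTop (nhds 0) := by
    have h00 : Tendsto (fun β : ℝ => s / β) atTop (nhds 0) := tendsto_const_nhds.div_atTop tendsto_id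
    simpa using h00.mul_const (Real.log (Fintype.card T))
  have h3 := ((Real.continuous_exp.tendsto 0).comp h0)
  rw [Real.exp_zero] at h3
  simpa using (h3.mul_const (Real.exp (s ^ 2 * V)))

/-- two-sided tail inequality -/
lemma conc_prob (b : T → E1) {s V A B : ℝ} (hs : 0 < s) (hV : ∀ i, (inner ℝ (b i) (b i) : ℝ) ≤ V) :
    (stdGaussian E1).real {g | A ≤ ⨆ i, inner ℝ g (b i)} * (stdGaussian E1).real {g | (⨆ i, inner ℝ g (b i)) ≤ B} ≤
      Real.exp (s ^ 2 * V - s * (A - B)) := by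
  have hA : MeasurableSet {g : E1 | A ≤ ⨆ i, inner ℝ g (b i)} := measurableSet_le measurable_const (sup_meas b)
  have hB : MeasurableSet {g : E1 | (⨆ i, inner ℝ g (b i)) ≤ B} := measurableSet_le (sup_meas b) measurable_const
  have h := conc_int b hs hV
  rw [Real.exp_sub, le_div_iff₀ (Real.exp_pos _)]
  refine le_trans ?_ h
  rw [← measureReal_prod_prod, mul_comm]
  have hint : Integrable (fun g : E1 × E1 => Real.exp (s * ((⨆ i, inner ℝ g.1 (b i)) - ⨆ i, inner ℝ g.2 (b i)))) ((stdGaussian E1).prod (stdGaussian E1)) := by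
    have := ((sup_EG b s).integrable (Real.measurable_exp.comp ((sup_meas b).const_mul s)) (stdGaussian E1)).mul_prod
      ((sup_EG b (-s)).integrable (Real.measurable_exp.comp ((sup_meas b).const_mul (-s))) (stdGaussian E1))
    refine this.congr (ae_of_all _ fun g => ?_)
    simp only [← Real.exp_add]
    congr 1; ring
  rw [← smul_eq_mul, mul_comm, ← mul_comm, smul_eq_mul, mul_comm, ← smul_eq_mul, ← integral_indicator_const _ (hA.prod hB)]
  refine integral_mono_of_nonneg (ae_of_all _ fun g => indicator_nonneg (fun _ _ => (Real.exp_pos _).le) _) hint (ae_of_all _ fun g => ?_)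
  by_cases hg : g ∈ {g : E1 | A ≤ ⨆ i, inner ℝ g (b i)} ×ˢ {g : E1 | (⨆ i, inner ℝ g (b i)) ≤ B}
  · simp only [indicator_of_mem hg]
    rw [Real.exp_le_exp]
    refine mul_le_mul_of_nonneg_left ?_ hs.le
    have h1 : A ≤ ⨆ i, inner ℝ g.1 (b i) := hg.1
    have h2 : (⨆ i, inner ℝ g.2 (b i)) ≤ B := hg.2
    linarith
  · simp only [indicator_of_notMem hg]
    exact (Real.exp_pos _).le
end g3

section g4
set_option linter.unusedSectionVars false
variable {E : Type*} [NormedAddCommGroup E] [InnerProductSpace ℝ E] [FiniteDimensional ℝ E]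
  [MeasurableSpace E] [BorelSpace E]
variable {κ : Type*} [Fintype κ]

lemma orth_law (w : κ → E) (hw : ∀ i j, i ≠ j → (inner ℝ (w i) (w j) : ℝ) = 0) :
    (stdGaussian E).map (fun g => WithLp.toLp 2 (fun k => (inner ℝ g (w k) : ℝ))) =
      (Measure.pi fun k => gaussianReal 0 (‖w k‖₊ ^ 2)).map (WithLp.toLp 2) := by
  classical
  have hmeas : Measurable (fun g : E => (WithLp.toLp 2 (fun k => (inner ℝ g (w k) : ℝ)) : EuclideanSpace ℝ κ)) := by fun_prop
  have : IsProbabilityMeasure ((stdGaussian E).map (fun g => (WithLp.toLp 2 (fun k => (inner ℝ g (w k) : ℝ)) : EuclideanSpace ℝ κ))) :=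
    Measure.isProbabilityMeasure_map hmeas.aemeasurable
  have : IsProbabilityMeasure ((Measure.pi fun k => gaussianReal 0 (‖w k‖₊ ^ 2)).map (WithLp.toLp 2)) :=
    Measure.isProbabilityMeasure_map (by fun_prop)
  apply Measure.ext_of_charFun
  ext t
  rw [charFun_pi, charFun_apply, integral_map hmeas.aemeasurable (by fun_prop)]
  have e : ∀ g : E, (inner ℝ (WithLp.toLp 2 (fun k => (inner ℝ g (w k) : ℝ)) : EuclideanSpace ℝ κ) t : ℝ) = inner ℝ g (∑ k, t k • w k) := fun g => by
    rw [inner_sum]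
    simp [PiLp.inner_apply, inner_smul_right]
  simp_rw [e, ← charFun_apply, charFun_stdGaussian, charFun_gaussianReal, ← Complex.exp_sum]
  congr 1
  have h2 : ‖∑ k, t k • w k‖ ^ 2 = ∑ k, t k ^ 2 * ‖w k‖ ^ 2 := by
    rw [← real_inner_self_eq_norm_sq, sum_inner]
    refine Finset.sum_congr rfl fun k _ => ?_
    rw [inner_sum, Finset.sum_eq_single k]
    · rw [inner_smul_left, inner_smul_right, real_inner_self_eq_norm_sq]; simp; ring
    · intro j _ hj
      rw [inner_smul_left, inner_smul_right, hw k j hj.symm]; simp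
    · simp
  have h3 : ((‖∑ k, t k • w k‖ : ℂ)) ^ 2 = ∑ k, (t k : ℂ) ^ 2 * (‖w k‖ : ℂ) ^ 2 := by exact_mod_cast congrArg (fun x : ℝ => (x : ℂ)) h2
  rw [h3, ← Finset.sum_neg_distrib, Finset.sum_div]
  refine Finset.sum_congr rfl fun k _ => ?_
  simp; ring

lemma orth_int (w : κ → E) (hw : ∀ i j, i ≠ j → (inner ℝ (w i) (w j) : ℝ) = 0) (F : κ → ℝ → ℝ) (hF : ∀ k, Measurable (F k)) :
    ∫ g, ∏ k, F k (inner ℝ g (w k)) ∂(stdGaussian E) = ∏ k, ∫ x, F k x ∂(gaussianReal 0 (‖w k‖₊ ^ 2)) := by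
  have hmeas : Measurable (fun g : E => (WithLp.toLp 2 (fun k => (inner ℝ g (w k) : ℝ)) : EuclideanSpace ℝ κ)) := by fun_prop
  have hG : Measurable (fun z : EuclideanSpace ℝ κ => ∏ k, F k (z k)) := Finset.measurable_prod _ fun k _ => (hF k).comp (by fun_prop)
  have h1 := integral_map (μ := stdGaussian E) hmeas.aemeasurable (f := fun z : EuclideanSpace ℝ κ => ∏ k, F k (z k)) hG.aestronglyMeasurable
  rw [orth_law w hw, integral_map (by fun_prop) hG.aestronglyMeasurable] at h1
  simp only at h1
  rw [← h1, integral_fintype_prod_eq_prod]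

/-- one-dimensional Gaussian integral -/
lemma gauss1 (v : NNReal) (s t : ℝ) (h : 0 < 1 + s * v) :
    ∫ x, Real.exp (-(s * x ^ 2 / 2) + t * x) ∂(gaussianReal 0 v) = (Real.sqrt (1 + s * v))⁻¹ * Real.exp (t ^ 2 * v / (2 * (1 + s * v))) := by
  by_cases hv : v = 0
  · subst hv; simp
  have hv0 : (0:ℝ) < v := by positivity
  rw [integral_gaussianReal_eq_integral_smul hv]
  let v' : NNReal := ⟨v / (1 + s * v), by positivity⟩
  have hv' : v' ≠ 0 := by
    intro h0
    have : (v / (1 + s * v) : ℝ) = 0 := congrArg NNReal.toReal h0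
    have h3 : (0:ℝ) < v / (1 + s * v) := by positivity
    linarith
  have e : ∀ x, gaussianPDFReal 0 v x • Real.exp (-(s * x ^ 2 / 2) + t * x) =
      ((Real.sqrt (1 + s * v))⁻¹ * Real.exp (t ^ 2 * v / (2 * (1 + s * v)))) * gaussianPDFReal (t * (v / (1 + s * v))) v' x := fun x => by
    unfold gaussianPDFReal
    have hvv : ((v' : NNReal) : ℝ) = v / (1 + s * v) := rfl
    rw [hvv, smul_eq_mul, mul_assoc, ← Real.exp_add]
    have h1 : Real.sqrt (2 * π * (v / (1 + s * v))) = Real.sqrt (2 * π * v) / Real.sqrt (1 + s * v) := by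
      rw [← Real.sqrt_div (by positivity)]; congr 1; ring
    rw [h1]
    have h2 : Real.exp (-(x - 0) ^ 2 / (2 * v) + (-(s * x ^ 2 / 2) + t * x)) = Real.exp (t ^ 2 * v / (2 * (1 + s * v))) * Real.exp (-(x - t * (v / (1 + s * v))) ^ 2 / (2 * (v / (1 + s * v)))) := by
      rw [← Real.exp_add]; congr 1
      obtain ⟨d, hd⟩ : ∃ d, d = 1 + s * v := ⟨_, rfl⟩
      rw [← hd] at h ⊢
      have hs : s = (d - 1) / v := by rw [hd]; field_simp; ring
      have := h.ne'
      rw [hs]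
      field_simp
      ring
    rw [h2]
    have h4 : 0 < Real.sqrt (1 + s * v) := Real.sqrt_pos.2 h
    have h5 : 0 < Real.sqrt (2 * π * v) := Real.sqrt_pos.2 (by positivity)
    generalize Real.sqrt (1 + s * v) = q4 at h4 ⊢
    field_simp
  simp_rw [e]
  rw [integral_const_mul, integral_gaussianPDFReal_eq_one _ hv', mul_one]
end g4

section g5
set_option linter.unusedSectionVars false
variable {E : Type*} [NormedAddCommGroup E] [InnerProductSpace ℝ E] [FiniteDimensional ℝ E]
  [MeasurableSpace E] [BorelSpace E]

/-- abstract feature map with covariance `N f(⟨σ,τ⟩/N)` -/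
structure Feat (N : ℕ) (φ : EuclideanSpace ℝ (Fin N) → E) (f f1 f2 : ℝ → ℝ) : Prop where
  smooth : ContDiff ℝ 1 φ
  cov : ∀ σ τ, (inner ℝ (φ σ) (φ τ) : ℝ) = N * f ((inner ℝ σ τ : ℝ) / N)
  d1 : ∀ x, HasDerivAt f (f1 x) x
  d2 : ∀ x, HasDerivAt f1 (f2 x) x
  npos : 0 < N

variable {N : ℕ} {φ : EuclideanSpace ℝ (Fin N) → E} {f f1 f2 : ℝ → ℝ}

lemma Feat.line (h : Feat N φ f f1 f2) (τ v : EuclideanSpace ℝ (Fin N)) :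
    HasDerivAt (fun t : ℝ => φ (τ + t • v)) (fderiv ℝ φ τ v) 0 := by
  have h1 : HasFDerivAt φ (fderiv ℝ φ τ) (τ + (0:ℝ) • v) := by
    simpa using ((h.smooth.differentiable one_ne_zero) τ).hasFDerivAt
  have h2 : HasDerivAt (fun t : ℝ => τ + t • v) v 0 := by
    simpa using ((hasDerivAt_id (0:ℝ)).smul_const v).const_add τ
  exact h1.comp_hasDerivAt 0 h2

lemma Feat.cov1 (h : Feat N φ f f1 f2) (σ τ v : EuclideanSpace ℝ (Fin N)) :
    (inner ℝ (φ σ) (fderiv ℝ φ τ v) : ℝ) = f1 ((inner ℝ σ τ : ℝ) / N) * inner ℝ σ v := by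
  have hN : (N:ℝ) ≠ 0 := by exact_mod_cast h.npos.ne'
  have h1 : HasDerivAt (fun t : ℝ => (inner ℝ (φ σ) (φ (τ + t • v)) : ℝ)) (inner ℝ (φ σ) (fderiv ℝ φ τ v)) 0 := by
    simpa using (hasDerivAt_const (0:ℝ) (φ σ)).inner ℝ (h.line τ v)
  have h2 : HasDerivAt (fun t : ℝ => (N * f (((inner ℝ σ τ : ℝ) + t * inner ℝ σ v) / N) : ℝ)) (N * (f1 ((inner ℝ σ τ : ℝ) / N) * ((inner ℝ σ v : ℝ) / N))) 0 := by
    have h3 : HasDerivAt (fun t : ℝ => ((inner ℝ σ τ : ℝ) + t * inner ℝ σ v) / N) ((inner ℝ σ v : ℝ) / N) 0 := by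
      simpa using (((hasDerivAt_id (0:ℝ)).mul_const (inner ℝ σ v : ℝ)).const_add (inner ℝ σ τ : ℝ)).div_const (N:ℝ)
    have h4 : HasDerivAt f (f1 ((inner ℝ σ τ : ℝ) / N)) (((inner ℝ σ τ : ℝ) + 0 * inner ℝ σ v) / N) := by simpa using h.d1 _
    exact (h4.comp 0 h3).const_mul _
  have h5 : (fun t : ℝ => (inner ℝ (φ σ) (φ (τ + t • v)) : ℝ)) = fun t : ℝ => (N * f (((inner ℝ σ τ : ℝ) + t * inner ℝ σ v) / N) : ℝ) := by
    funext t; rw [h.cov, inner_add_right, inner_smul_right]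
  rw [h5] at h1
  rw [h1.unique h2]; field_simp

lemma Feat.cov2 (h : Feat N φ f f1 f2) (σ τ v w : EuclideanSpace ℝ (Fin N)) :
    (inner ℝ (fderiv ℝ φ σ v) (fderiv ℝ φ τ w) : ℝ) = f1 ((inner ℝ σ τ : ℝ) / N) * inner ℝ v w + f2 ((inner ℝ σ τ : ℝ) / N) * inner ℝ v τ * inner ℝ σ w / N := by
  have hN : (N:ℝ) ≠ 0 := by exact_mod_cast h.npos.ne'
  have h1 : HasDerivAt (fun t : ℝ => (inner ℝ (φ (σ + t • v)) (fderiv ℝ φ τ w) : ℝ)) (inner ℝ (fderiv ℝ φ σ v) (fderiv ℝ φ τ w)) 0 := by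
    simpa using (h.line σ v).inner ℝ (hasDerivAt_const (0:ℝ) (fderiv ℝ φ τ w))
  have h2 : HasDerivAt (fun t : ℝ => (f1 (((inner ℝ σ τ : ℝ) + t * inner ℝ v τ) / N) * (inner ℝ σ w + t * inner ℝ v w) : ℝ))
      (f2 ((inner ℝ σ τ : ℝ) / N) * ((inner ℝ v τ : ℝ) / N) * (inner ℝ σ w) + f1 ((inner ℝ σ τ : ℝ) / N) * inner ℝ v w) 0 := by
    have h3 : HasDerivAt (fun t : ℝ => ((inner ℝ σ τ : ℝ) + t * inner ℝ v τ) / N) ((inner ℝ v τ : ℝ) / N) 0 := by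
      simpa using (((hasDerivAt_id (0:ℝ)).mul_const (inner ℝ v τ : ℝ)).const_add (inner ℝ σ τ : ℝ)).div_const (N:ℝ)
    have h4 : HasDerivAt f1 (f2 ((inner ℝ σ τ : ℝ) / N)) (((inner ℝ σ τ : ℝ) + 0 * inner ℝ v τ) / N) := by simpa using h.d2 _
    have h6 : HasDerivAt (fun t : ℝ => (inner ℝ σ w : ℝ) + t * inner ℝ v w) (inner ℝ v w) 0 := by
      simpa using ((hasDerivAt_id (0:ℝ)).mul_const (inner ℝ v w : ℝ)).const_add (inner ℝ σ w : ℝ)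
    refine ((h4.comp 0 h3).mul h6).congr_deriv ?_
    simp
  have h5 : (fun t : ℝ => (inner ℝ (φ (σ + t • v)) (fderiv ℝ φ τ w) : ℝ)) = fun t : ℝ => (f1 (((inner ℝ σ τ : ℝ) + t * inner ℝ v τ) / N) * (inner ℝ σ w + t * inner ℝ v w) : ℝ) := by
    funext t; rw [h.cov1, inner_add_left, inner_smul_left, inner_add_left, inner_smul_left]; simp
  rw [h5] at h1
  rw [h1.unique h2]; field_simp; ring

/-- the adjoint gradient -/
def grd (φ : EuclideanSpace ℝ (Fin N) → E) (σ : EuclideanSpace ℝ (Fin N)) (g : E) : EuclideanSpace ℝ (Fin N) :=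
  ContinuousLinearMap.adjoint (fderiv ℝ φ σ) g

lemma grd_inner (σ v : EuclideanSpace ℝ (Fin N)) (g : E) : (inner ℝ (grd φ σ g) v : ℝ) = inner ℝ g (fderiv ℝ φ σ v) :=
  ContinuousLinearMap.adjoint_inner_left _ _ _

/-- the weight -/
def wgt (φ : EuclideanSpace ℝ (Fin N) → E) (δ u x : ℝ) (σ : EuclideanSpace ℝ (Fin N)) (g : E) : ℝ :=
  Real.exp (-((‖grd φ σ g - x • σ‖ ^ 2 + ((inner ℝ g (φ σ) : ℝ) - u * N) ^ 2 / N) / (2 * δ ^ 2)))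

lemma wgt_half {δ : ℝ} (hδ : 0 < δ) {n : ℕ} (e : Fin n → EuclideanSpace ℝ (Fin N)) (he : Orthonormal ℝ e) (hN : 0 < N) (u x a : ℝ)
    (σ l : EuclideanSpace ℝ (Fin N)) (g : E) (h1 : ∀ j, (inner ℝ σ (e j) : ℝ) = 0) (h2 : ∀ j, (inner ℝ l (e j) : ℝ) = 0) :
    wgt φ δ u x σ g ≤ Real.exp ((inner ℝ g (a • φ σ + fderiv ℝ φ σ l) : ℝ) - (∑ j, (inner ℝ g (fderiv ℝ φ σ (e j)) : ℝ) ^ 2) / (2 * δ ^ 2)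
      + (-(x * inner ℝ σ l) - a * u * N + δ ^ 2 / 2 * (inner ℝ l l + N * a ^ 2))) := by
  unfold wgt
  rw [Real.exp_le_exp]
  have hNr : (0:ℝ) < N := by exact_mod_cast hN
  set z := grd φ σ g - x • σ with hz
  have b1 := he.sum_inner_products_le (x := z + δ ^ 2 • l) (s := Finset.univ)
  have b2 : ∀ j, ‖(inner ℝ (e j) (z + δ ^ 2 • l) : ℝ)‖ ^ 2 = (inner ℝ g (fderiv ℝ φ σ (e j)) : ℝ) ^ 2 := fun j => by
    rw [Real.norm_eq_abs, sq_abs, real_inner_comm, inner_add_left, hz, inner_sub_left, grd_inner, inner_smul_left, inner_smul_left, h1, h2]; simp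
  simp only [b2] at b1
  have b3 : ‖z + δ ^ 2 • l‖ ^ 2 = ‖z‖ ^ 2 + 2 * δ ^ 2 * ((inner ℝ g (fderiv ℝ φ σ l) : ℝ) - x * inner ℝ σ l) + δ ^ 4 * inner ℝ l l := by
    rw [norm_add_sq_real, norm_smul, inner_smul_right, mul_pow, ← real_inner_self_eq_norm_sq l]
    have : (inner ℝ z l : ℝ) = (inner ℝ g (fderiv ℝ φ σ l) : ℝ) - x * inner ℝ σ l := by
      rw [hz, inner_sub_left, grd_inner, inner_smul_left]; simp
    rw [this, Real.norm_eq_abs, sq_abs]; ring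
  rw [b3] at b1
  rw [inner_add_right, inner_smul_right]
  set S := ∑ j, (inner ℝ g (fderiv ℝ φ σ (e j)) : ℝ) ^ 2
  set L := (inner ℝ g (fderiv ℝ φ σ l) : ℝ)
  set H := (inner ℝ g (φ σ) : ℝ)
  set ll := (inner ℝ l l : ℝ)
  set sl := (inner ℝ σ l : ℝ)
  have b4 : 0 ≤ ((H - u * N) + δ ^ 2 * N * a) ^ 2 / N := by positivity
  have b5 : ((H - u * N) + δ ^ 2 * N * a) ^ 2 / N = (H - u * N) ^ 2 / N + 2 * δ ^ 2 * (a * H - a * u * N) + δ ^ 4 * N * a ^ 2 := by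
    field_simp; ring
  rw [b5] at b4
  have hd : 0 < 2 * δ ^ 2 := by positivity
  rw [neg_le_iff_add_nonneg]
  have b6 : 0 ≤ (‖z‖ ^ 2 + (H - u * N) ^ 2 / N + 2 * δ ^ 2 * (L - x * sl) + δ ^ 4 * ll + 2 * δ ^ 2 * (a * H - a * u * N) + δ ^ 4 * N * a ^ 2 - S) / (2 * δ ^ 2) :=
    div_nonneg (by linarith) hd.le
  refine b6.trans (le_of_eq ?_)
  field_simp
  ring

lemma exists_perp (σ τ : EuclideanSpace ℝ (Fin N)) : ∃ e : Fin (N - 2) → EuclideanSpace ℝ (Fin N), Orthonormal ℝ e ∧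
    (∀ j, (inner ℝ σ (e j) : ℝ) = 0) ∧ (∀ j, (inner ℝ τ (e j) : ℝ) = 0) := by
  classical
  let U := Submodule.span ℝ ((({σ, τ} : Finset (EuclideanSpace ℝ (Fin N)))) : Set (EuclideanSpace ℝ (Fin N)))
  have h1 : Module.finrank ℝ U ≤ 2 := (finrank_span_finset_le_card _).trans Finset.card_le_two
  have h2 : Module.finrank ℝ U + Module.finrank ℝ Uᗮ = N := by
    rw [Submodule.finrank_add_finrank_orthogonal]; simp
  have h3 : N - 2 ≤ Module.finrank ℝ Uᗮ := by omega
  refine ⟨fun j => ((stdOrthonormalBasis ℝ Uᗮ (Fin.castLE h3 j) : Uᗮ) : EuclideanSpace ℝ (Fin N)), ?_, ?_, ?_⟩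
  · have := ((stdOrthonormalBasis ℝ Uᗮ).orthonormal.comp_linearIsometry Uᗮ.subtypeₗᵢ).comp _ (Fin.castLE_injective h3)
    exact this
  · intro j
    exact Submodule.inner_right_of_mem_orthogonal (Submodule.subset_span (by simp)) (Subtype.mem _)
  · intro j
    exact Submodule.inner_right_of_mem_orthogonal (Submodule.subset_span (by simp)) (Subtype.mem _)
end g5

section g6
set_option linter.unusedSectionVars false
variable {E : Type*} [NormedAddCommGroup E] [InnerProductSpace ℝ E] [FiniteDimensional ℝ E]
  [MeasurableSpace E] [BorelSpace E]
variable {N : ℕ} {φ : EuclideanSpace ℝ (Fin N) → E} {f f1 f2 : ℝ → ℝ}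

lemma wgt_pos (δ u x : ℝ) (σ : EuclideanSpace ℝ (Fin N)) (g : E) : 0 < wgt φ δ u x σ g := Real.exp_pos _
lemma wgt_le_one (δ u x : ℝ) (σ : EuclideanSpace ℝ (Fin N)) (g : E) : wgt φ δ u x σ g ≤ 1 := by
  unfold wgt
  rw [Real.exp_le_one_iff]
  have : 0 ≤ (‖grd φ σ g - x • σ‖ ^ 2 + ((inner ℝ g (φ σ) : ℝ) - u * N) ^ 2 / N) / (2 * δ ^ 2) := by positivity
  linarith

lemma Feat.h_norm (h : Feat N φ f f1 f2) {σ τ : EuclideanSpace ℝ (Fin N)} {r : ℝ} (hσ : (inner ℝ σ σ : ℝ) = N) (hτ : (inner ℝ τ τ : ℝ) = N)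
    (hr : (inner ℝ σ τ : ℝ) = N * r) (a b c : ℝ) :
    (inner ℝ ((a • φ σ + fderiv ℝ φ σ (b • (σ + τ) + c • (σ - τ))) + (a • φ τ + fderiv ℝ φ τ (b • (σ + τ) - c • (σ - τ))))
      ((a • φ σ + fderiv ℝ φ σ (b • (σ + τ) + c • (σ - τ))) + (a • φ τ + fderiv ℝ φ τ (b • (σ + τ) - c • (σ - τ)))) : ℝ)
      = N * VV (f 1) (f1 1) (f2 1) (f r) (f1 r) (f2 r) r a b c := by
  have hN : (N:ℝ) ≠ 0 := by exact_mod_cast h.npos.ne'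
  set l1 := b • (σ + τ) + c • (σ - τ) with hl1
  set l2 := b • (σ + τ) - c • (σ - τ) with hl2
  have hr' : (inner ℝ τ σ : ℝ) = N * r := by rw [real_inner_comm]; exact hr
  have e1 : (inner ℝ σ l1 : ℝ) = N * (b * (1 + r) + c * (1 - r)) := by
    simp only [hl1, inner_add_right, inner_sub_right, inner_smul_right, hσ, hr]; ring
  have e2 : (inner ℝ τ l1 : ℝ) = N * (b * (1 + r) - c * (1 - r)) := by
    simp only [hl1, inner_add_right, inner_sub_right, inner_smul_right, hτ, hr']; ring
  have e3 : (inner ℝ σ l2 : ℝ) = N * (b * (1 + r) - c * (1 - r)) := by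
    simp only [hl2, inner_add_right, inner_sub_right, inner_smul_right, hσ, hr]; ring
  have e4 : (inner ℝ τ l2 : ℝ) = N * (b * (1 + r) + c * (1 - r)) := by
    simp only [hl2, inner_add_right, inner_sub_right, inner_smul_right, hτ, hr']; ring
  have e5 : (inner ℝ l1 l1 : ℝ) = N * (2 * b ^ 2 * (1 + r) + 2 * c ^ 2 * (1 - r)) := by
    simp only [hl1, inner_add_right, inner_sub_right, inner_add_left, inner_sub_left, inner_smul_right, inner_smul_left, hσ, hτ, hr, hr']; simp; ring
  have e6 : (inner ℝ l2 l2 : ℝ) = N * (2 * b ^ 2 * (1 + r) + 2 * c ^ 2 * (1 - r)) := by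
    simp only [hl2, inner_add_right, inner_sub_right, inner_add_left, inner_sub_left, inner_smul_right, inner_smul_left, hσ, hτ, hr, hr']; simp; ring
  have e7 : (inner ℝ l1 l2 : ℝ) = N * (2 * b ^ 2 * (1 + r) - 2 * c ^ 2 * (1 - r)) := by
    simp only [hl1, hl2, inner_add_right, inner_sub_right, inner_add_left, inner_sub_left, inner_smul_right, inner_smul_left, hσ, hτ, hr, hr']; simp; ring
  have e7' : (inner ℝ l2 l1 : ℝ) = N * (2 * b ^ 2 * (1 + r) - 2 * c ^ 2 * (1 - r)) := by rw [real_inner_comm]; exact e7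
  have c1 : ∀ ρ l, (inner ℝ (fderiv ℝ φ ρ l) (φ σ) : ℝ) = f1 ((inner ℝ σ ρ : ℝ) / N) * inner ℝ σ l := fun ρ l => by rw [real_inner_comm, h.cov1]
  have c2 : ∀ ρ l, (inner ℝ (fderiv ℝ φ ρ l) (φ τ) : ℝ) = f1 ((inner ℝ τ ρ : ℝ) / N) * inner ℝ τ l := fun ρ l => by rw [real_inner_comm, h.cov1]
  simp only [inner_add_left, inner_add_right, inner_smul_left, inner_smul_right, h.cov, h.cov1, h.cov2, c1, c2]
  have d1 : (N * r / N : ℝ) = r := by field_simp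
  have d2 : (N / N : ℝ) = 1 := by field_simp
  simp only [real_inner_comm σ l1, real_inner_comm τ l1, real_inner_comm σ l2, real_inner_comm τ l2]
  simp only [e1, e2, e3, e4, e5, e6, e7, e7', hσ, hτ, hr, hr', d1, d2]
  unfold VV
  simp only [conj_trivial]
  field_simp
  ring

lemma Feat.pair (h : Feat N φ f f1 f2) {σ τ : EuclideanSpace ℝ (Fin N)} {r δ : ℝ} (hδ : 0 < δ) (hσ : (inner ℝ σ σ : ℝ) = N) (hτ : (inner ℝ τ τ : ℝ) = N)
    (hr : (inner ℝ σ τ : ℝ) = N * r) (hN : 3 ≤ N) (u x a b c : ℝ) :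
    ∫ g, wgt φ δ u x σ g * wgt φ δ u x τ g ∂(stdGaussian E) ≤
      ((Real.sqrt (1 + (f1 1 + f1 r) / δ ^ 2))⁻¹ * (Real.sqrt (1 + (f1 1 - f1 r) / δ ^ 2))⁻¹) ^ (N - 2) *
       Real.exp (N * (-(2 * a * u + 2 * b * (1 + r) * x + 2 * c * (1 - r) * x) + 1 / 2 * VV (f 1) (f1 1) (f2 1) (f r) (f1 r) (f2 r) r a b c
        + δ ^ 2 * (a ^ 2 + 2 * b ^ 2 * (1 + r) + 2 * c ^ 2 * (1 - r)))) := by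
  have hN0 : (N:ℝ) ≠ 0 := by exact_mod_cast h.npos.ne'
  obtain ⟨e, he, heσ, heτ⟩ := exists_perp σ τ
  set l1 := b • (σ + τ) + c • (σ - τ) with hl1
  set l2 := b • (σ + τ) - c • (σ - τ) with hl2
  have hr' : (inner ℝ τ σ : ℝ) = N * r := by rw [real_inner_comm]; exact hr
  have o1 : ∀ j, (inner ℝ l1 (e j) : ℝ) = 0 := fun j => by
    simp only [hl1, inner_add_left, inner_sub_left, inner_smul_left, heσ, heτ]; simp
  have o2 : ∀ j, (inner ℝ l2 (e j) : ℝ) = 0 := fun j => by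
    simp only [hl2, inner_add_left, inner_sub_left, inner_smul_left, heσ, heτ]; simp
  have e1 : (inner ℝ σ l1 : ℝ) = N * (b * (1 + r) + c * (1 - r)) := by
    simp only [hl1, inner_add_right, inner_sub_right, inner_smul_right, hσ, hr]; ring
  have e4 : (inner ℝ τ l2 : ℝ) = N * (b * (1 + r) + c * (1 - r)) := by
    simp only [hl2, inner_add_right, inner_sub_right, inner_smul_right, hτ, hr']; ring
  have e5 : (inner ℝ l1 l1 : ℝ) = N * (2 * b ^ 2 * (1 + r) + 2 * c ^ 2 * (1 - r)) := by
    simp only [hl1, inner_add_right, inner_sub_right, inner_add_left, inner_sub_left, inner_smul_right, inner_smul_left, hσ, hτ, hr, hr']; simp; ring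
  have e6 : (inner ℝ l2 l2 : ℝ) = N * (2 * b ^ 2 * (1 + r) + 2 * c ^ 2 * (1 - r)) := by
    simp only [hl2, inner_add_right, inner_sub_right, inner_add_left, inner_sub_left, inner_smul_right, inner_smul_left, hσ, hτ, hr, hr']; simp; ring
  let H : E := (a • φ σ + fderiv ℝ φ σ l1) + (a • φ τ + fderiv ℝ φ τ l2)
  let p : Fin (N - 2) → E := fun j => fderiv ℝ φ σ (e j)
  let q : Fin (N - 2) → E := fun j => fderiv ℝ φ τ (e j)
  let w : Option (Fin (N - 2) × Bool) → E := fun k => match k with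
    | none => H
    | some (j, l) => if l then p j + q j else p j - q j
  have d1 : (N * r / N : ℝ) = r := by field_simp
  have d2 : (N / N : ℝ) = 1 := by field_simp
  have hee : ∀ i j, (inner ℝ (e i) (e j) : ℝ) = if i = j then 1 else 0 := fun i j => orthonormal_iff_ite.1 he i j
  have pp : ∀ i j, (inner ℝ (p i) (p j) : ℝ) = f1 1 * if i = j then 1 else 0 := fun i j => by
    simp only [p, h.cov2, hσ, d2, heσ, hee]; simp
  have qq : ∀ i j, (inner ℝ (q i) (q j) : ℝ) = f1 1 * if i = j then 1 else 0 := fun i j => by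
    simp only [q, h.cov2, hτ, d2, heτ, hee]; simp
  have pq : ∀ i j, (inner ℝ (p i) (q j) : ℝ) = f1 r * if i = j then 1 else 0 := fun i j => by
    simp only [p, q, h.cov2, hr, d1, heσ, hee]; simp
  have qp : ∀ i j, (inner ℝ (q i) (p j) : ℝ) = f1 r * if i = j then 1 else 0 := fun i j => by
    simp only [p, q, h.cov2, hr', d1, heτ, hee]; simp
  have Hp : ∀ j, (inner ℝ H (p j) : ℝ) = 0 := fun j => by
    simp only [H, p, inner_add_left, inner_smul_left, h.cov1, h.cov2, heσ, heτ, o1, o2]; simp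
  have Hq : ∀ j, (inner ℝ H (q j) : ℝ) = 0 := fun j => by
    simp only [H, q, inner_add_left, inner_smul_left, h.cov1, h.cov2, heσ, heτ, o1, o2]; simp
  have pH : ∀ j, (inner ℝ (p j) H : ℝ) = 0 := fun j => by rw [real_inner_comm]; exact Hp j
  have qH : ∀ j, (inner ℝ (q j) H : ℝ) = 0 := fun j => by rw [real_inner_comm]; exact Hq j
  have hw : ∀ i j, i ≠ j → (inner ℝ (w i) (w j) : ℝ) = 0 := by
    rintro (_ | ⟨i, l⟩) (_ | ⟨j, l'⟩) hij
    · exact absurd rfl hij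
    · cases l' <;> simp [w, inner_add_right, inner_sub_right, Hp, Hq]
    · cases l <;> simp [w, inner_add_left, inner_sub_left, pH, qH]
    · by_cases hij2 : i = j
      · subst hij2
        cases l <;> cases l'
        · exact absurd rfl hij
        · simp only [w, Bool.false_eq_true, if_true, if_false, inner_add_left, inner_sub_left, inner_add_right, inner_sub_right, pp, pq, qp, qq]; ring
        · simp only [w, Bool.false_eq_true, if_true, if_false, inner_add_left, inner_sub_left, inner_add_right, inner_sub_right, pp, pq, qp, qq]; ring
        · exact absurd rfl hij
      · cases l <;> cases l' <;> simp [w, inner_add_left, inner_sub_left, inner_add_right, inner_sub_right, pp, pq, qp, qq, hij2]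
  let s : ℝ := 1 / (2 * δ ^ 2)
  have hs : 0 < s := by positivity
  let F : Option (Fin (N - 2) × Bool) → ℝ → ℝ := fun k => match k with
    | none => fun t => Real.exp (-(0 * t ^ 2 / 2) + 1 * t)
    | some _ => fun t => Real.exp (-(s * t ^ 2 / 2) + 0 * t)
  have hF : ∀ k, Measurable (F k) := by
    rintro (_ | _) <;> simp only [F] <;> fun_prop
  let K0 : ℝ := N * (-(2 * a * u + 2 * b * (1 + r) * x + 2 * c * (1 - r) * x)
        + δ ^ 2 * (a ^ 2 + 2 * b ^ 2 * (1 + r) + 2 * c ^ 2 * (1 - r)))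
  have key : ∀ g : E, wgt φ δ u x σ g * wgt φ δ u x τ g ≤ Real.exp K0 * ∏ k, F k (inner ℝ g (w k)) := fun g => by
    refine (mul_le_mul (wgt_half hδ e he h.npos u x a σ l1 g heσ o1) (wgt_half hδ e he h.npos u x a τ l2 g heτ o2) (wgt_pos _ _ _ _ _).le (Real.exp_pos _).le).trans ?_
    rw [Fintype.prod_option]
    simp only [F, ← Real.exp_sum, ← Real.exp_add]
    rw [Real.exp_le_exp]
    apply le_of_eq
    have t1 : ∀ j, ∑ l : Bool, (-(s * (inner ℝ g (w (some (j, l))) : ℝ) ^ 2 / 2) + 0 * inner ℝ g (w (some (j, l)))) = -(1 / (2 * δ ^ 2)) * ((inner ℝ g (p j) : ℝ) ^ 2 + (inner ℝ g (q j) : ℝ) ^ 2) := fun j => by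
      simp only [Fintype.sum_bool, w, if_true, Bool.false_eq_true, if_false, inner_add_right, inner_sub_right, s]; ring
    rw [Fintype.sum_prod_type]
    simp only [t1]
    rw [← Finset.mul_sum, Finset.sum_add_distrib]
    rw [e1, e4, e5, e6]
    simp only [w, H, inner_add_right, p, q, K0]
    ring
  have hFp : ∀ k t, 0 < F k t := by rintro (_ | _) t <;> exact Real.exp_pos _
  have hEG : EG (fun g : E => ∏ k, F k (inner ℝ g (w k))) := by
    refine EG.of_le 1 ‖H‖ fun g => ?_
    rw [abs_of_pos (Finset.prod_pos fun k _ => hFp _ _), Fintype.prod_option, one_mul]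
    refine (mul_le_of_le_one_right (hFp none (inner ℝ g (w none))).le ?_).trans ?_
    · refine Finset.prod_le_one (fun k _ => (hFp (some k) (inner ℝ g (w (some k)))).le) fun k _ => ?_
      simp only [F]
      rw [Real.exp_le_one_iff]
      have : 0 ≤ s * (inner ℝ g (w (some k)) : ℝ) ^ 2 := by positivity
      linarith
    · simp only [F, w]
      rw [Real.exp_le_exp]
      have := real_inner_le_norm g H
      linarith
  have hint : Integrable (fun g : E => Real.exp K0 * ∏ k, F k (inner ℝ g (w k))) (stdGaussian E) := 
    (hEG.integrable (Finset.measurable_fun_prod _ fun k _ => (hF k).comp (by fun_prop)) _).const_mul _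
  refine (integral_mono_of_nonneg (ae_of_all _ fun g => (mul_pos (wgt_pos _ _ _ _ _) (wgt_pos _ _ _ _ _)).le) hint (ae_of_all _ key)).trans ?_
  rw [integral_const_mul, orth_int w hw F hF, Fintype.prod_option]
  have g0 : ∫ t, F none t ∂(gaussianReal 0 (‖w none‖₊ ^ 2)) = Real.exp (N * (1 / 2 * VV (f 1) (f1 1) (f2 1) (f r) (f1 r) (f2 r) r a b c)) := by
    simp only [F]
    rw [gauss1 _ 0 1 (by simp)]
    have : ((‖w none‖₊ ^ 2 : NNReal) : ℝ) = N * VV (f 1) (f1 1) (f2 1) (f r) (f1 r) (f2 r) r a b c := by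
      rw [← h.h_norm hσ hτ hr a b c, real_inner_self_eq_norm_sq]; simp [w, H, hl1, hl2]
    rw [this]; simp; ring_nf
  have g1 : ∀ j l, ∫ t, F (some (j, l)) t ∂(gaussianReal 0 (‖w (some (j, l))‖₊ ^ 2)) = (Real.sqrt (1 + (f1 1 + (if l then f1 r else - f1 r)) / δ ^ 2))⁻¹ := fun j l => by
    simp only [F]
    rw [gauss1 _ s 0 (by positivity)]
    have : ((‖w (some (j, l))‖₊ ^ 2 : NNReal) : ℝ) = 2 * (f1 1 + if l then f1 r else - f1 r) := by
      have : ((‖w (some (j, l))‖₊ ^ 2 : NNReal) : ℝ) = inner ℝ (w (some (j, l))) (w (some (j, l))) := by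
        rw [real_inner_self_eq_norm_sq]; simp
      rw [this]
      cases l <;> simp only [w, Bool.false_eq_true, if_true, if_false, inner_add_left, inner_sub_left, inner_add_right, inner_sub_right, pp, pq, qp, qq] <;> ring
    rw [this]
    have h5 : s * (2 * (f1 1 + if l then f1 r else - f1 r)) = (f1 1 + if l then f1 r else - f1 r) / δ ^ 2 := by
      simp only [s]; field_simp
    rw [h5]; simp
  rw [g0, Fintype.prod_prod_type]
  simp only [g1, Fintype.prod_bool, if_true, Bool.false_eq_true, if_false, Finset.prod_const, Finset.card_univ, Fintype.card_fin, ← sub_eq_add_neg]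
  rw [← mul_assoc, ← Real.exp_add, mul_comm]
  refine le_of_eq ?_
  congr 2
  simp only [K0]; ring
end g6

section g7
set_option linter.unusedSectionVars false
variable {E : Type*} [NormedAddCommGroup E] [InnerProductSpace ℝ E] [FiniteDimensional ℝ E]
  [MeasurableSpace E] [BorelSpace E]

lemma gauss1_lb (v : NNReal) {s : ℝ} (hs : 0 < s) (c k : ℝ) (hc : c = v * k) :
    (Real.sqrt (1 + s * v))⁻¹ * Real.exp (-(v * k ^ 2 / 2)) ≤ ∫ x, Real.exp (-(s * (x - c) ^ 2 / 2)) ∂(gaussianReal 0 v) := by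
  have h1 : ∀ x : ℝ, Real.exp (-(s * (x - c) ^ 2 / 2)) = Real.exp (-(s * c ^ 2 / 2)) * Real.exp (-(s * x ^ 2 / 2) + s * c * x) := fun x => by
    rw [← Real.exp_add]; congr 1; ring
  have hv : 0 ≤ (v:ℝ) := v.2
  have h0 : 0 < 1 + s * v := by positivity
  simp only [h1]
  rw [integral_const_mul, gauss1 v s (s * c) h0, mul_left_comm, ← Real.exp_add]
  refine mul_le_mul_of_nonneg_left (Real.exp_le_exp.2 ?_) (by positivity)
  have : -(s * c ^ 2 / 2) + (s * c) ^ 2 * v / (2 * (1 + s * v)) = -(v * k ^ 2 / 2) * (s * v / (1 + s * v)) := by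
    rw [hc]; field_simp; ring
  rw [this]
  have h2 : s * v / (1 + s * v) ≤ 1 := by rw [div_le_one h0]; linarith
  have h3 : 0 ≤ v * k ^ 2 / 2 := by positivity
  nlinarith

variable {M : ℕ} {φ : EuclideanSpace ℝ (Fin (M+1)) → E} {f f1 f2 : ℝ → ℝ}

lemma exists_basis0 {V : Type*} [NormedAddCommGroup V] [InnerProductSpace ℝ V] [FiniteDimensional ℝ V] {n : ℕ} (hn : Module.finrank ℝ V = n + 1) (e : V) (he : ‖e‖ = 1) :
    ∃ b : OrthonormalBasis (Fin (n+1)) ℝ V, b 0 = e := by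
  have h1 : Orthonormal ℝ ((({0} : Set (Fin (n+1)))).domRestrict (fun _ => e)) := by
    constructor
    · intro i; exact he
    · intro i j hij
      exact absurd (Subsingleton.elim i j) hij
  obtain ⟨b, hb⟩ := Orthonormal.exists_orthonormalBasis_extension_of_card_eq (𝕜 := ℝ) (E := V) (ι := Fin (n+1)) (by simpa using hn) (v := fun _ => e) (s := {0}) h1
  exact ⟨b, hb 0 (by simp)⟩

lemma Feat.first (h : Feat (M+1) φ f f1 f2) {σ : EuclideanSpace ℝ (Fin (M+1))} {δ : ℝ} (hδ : 0 < δ) (hσ : (inner ℝ σ σ : ℝ) = (M+1 : ℕ))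
    (h1 : 0 < f1 1) (h2 : 0 ≤ f2 1) (y m : ℝ) :
    (Real.sqrt (1 + f1 1 / δ ^ 2))⁻¹ ^ M * ((Real.sqrt (1 + 3 * (f1 1 + f2 1) / δ ^ 2))⁻¹ * (Real.sqrt (1 + 2 * f 1 / δ ^ 2))⁻¹) *
      Real.exp (-((M+1 : ℕ) * ((f 1 * y ^ 2 + 2 * f1 1 * y * m + (f1 1 + f2 1) * m ^ 2) / 2))) ≤
    ∫ g, wgt φ δ (f 1 * y + f1 1 * m) (f1 1 * y + (f1 1 + f2 1) * m) σ g ∂(stdGaussian E) := by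
  set N : ℝ := ((M+1 : ℕ) : ℝ) with hNdef
  have hN : 0 < N := by simp only [hNdef]; positivity
  set q := Real.sqrt N with hq
  have hq0 : 0 < q := Real.sqrt_pos.2 hN
  have hqq : q * q = N := Real.mul_self_sqrt hN.le
  have hqN : N = q ^ 2 := by rw [sq]; exact hqq.symm
  have hnσ : ‖σ‖ = q := by
    rw [hq, ← hσ, real_inner_self_eq_norm_sq, Real.sqrt_sq (norm_nonneg _)]
  obtain ⟨b, hb⟩ := exists_basis0 (V := EuclideanSpace ℝ (Fin (M+1))) (n := M) (by simp) (q⁻¹ • σ) (by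
    rw [norm_smul, hnσ, norm_inv, Real.norm_of_nonneg hq0.le, inv_mul_cancel₀ hq0.ne'])
  have hσb : σ = q • b 0 := by rw [hb, smul_smul, mul_inv_cancel₀ hq0.ne', one_smul]
  have hbb : ∀ i j, (inner ℝ (b i) (b j) : ℝ) = if i = j then 1 else 0 := fun i j => orthonormal_iff_ite.1 b.orthonormal i j
  have hσj : ∀ j, (inner ℝ σ (b j) : ℝ) = q * if j = 0 then 1 else 0 := fun j => by
    conv_lhs => rw [hσb]
    rw [inner_smul_left, hbb]; simp [eq_comm]
  have hjσ : ∀ j, (inner ℝ (b j) σ : ℝ) = q * if j = 0 then 1 else 0 := fun j => by rw [real_inner_comm]; exact hσj j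
  set α := f1 1 / (f1 1 + f2 1) with hα
  have hs12 : 0 < f1 1 + f2 1 := by linarith
  have hα1 : α * (f1 1 + f2 1) = f1 1 := by rw [hα]; field_simp
  have hα0 : 0 ≤ α := by positivity
  have hαle : α ≤ 1 := by rw [hα, div_le_one hs12]; linarith
  set v3 := f 1 - α * f1 1 with hv3
  let p : Fin (M+1) → E := fun j => fderiv ℝ φ σ (b j)
  have d2 : (inner ℝ σ σ : ℝ) / ((M+1 : ℕ) : ℝ) = 1 := by rw [hσ]; exact div_self hN.ne'
  have pp : ∀ i j, (inner ℝ (p i) (p j) : ℝ) = f1 1 * (if i = j then 1 else 0) + f2 1 * ((if i = 0 then 1 else 0) * (if j = 0 then 1 else 0)) := fun i j => by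
    simp only [p, h.cov2, d2, hbb, hσj, hjσ]
    rw [← hNdef, hqN]; field_simp
  have fp : ∀ j, (inner ℝ (φ σ) (p j) : ℝ) = f1 1 * (q * if j = 0 then 1 else 0) := fun j => by
    simp only [p, h.cov1, d2, hσj]
  have pf : ∀ j, (inner ℝ (p j) (φ σ) : ℝ) = f1 1 * (q * if j = 0 then 1 else 0) := fun j => by rw [real_inner_comm]; exact fp j
  have ff : (inner ℝ (φ σ) (φ σ) : ℝ) = q ^ 2 * f 1 := by rw [h.cov, d2, ← hNdef, hqN]
  let w : Option (Fin (M+1)) → E := fun k => match k with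
    | none => q⁻¹ • φ σ - α • p 0
    | some j => p j
  have w0 : ∀ j, (inner ℝ (w none) (w (some j)) : ℝ) = 0 := fun j => by
    simp only [w, inner_sub_left, inner_smul_left, fp, pp, conj_trivial]
    by_cases hj : j = 0
    · subst hj; simp only [if_true]; field_simp; linarith
    · simp [hj, Ne.symm hj]
  have hw : ∀ i j, i ≠ j → (inner ℝ (w i) (w j) : ℝ) = 0 := by
    rintro (_ | i) (_ | j) hij
    · exact absurd rfl hij
    · exact w0 j
    · rw [real_inner_comm]; exact w0 i
    · have hij' : i ≠ j := fun hh => hij (by rw [hh])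
      simp only [w, pp, if_neg hij']
      by_cases hi : i = 0
      · have : j ≠ 0 := fun hh => hij' (hi.trans hh.symm)
        simp [this]
      · simp [hi]
  have nn : ∀ k, ((‖w k‖₊ ^ 2 : NNReal) : ℝ) = inner ℝ (w k) (w k) := fun k => by
    rw [real_inner_self_eq_norm_sq]; simp
  have nnone : ((‖w none‖₊ ^ 2 : NNReal) : ℝ) = v3 := by
    refine (nn none).trans ?_
    simp only [w, inner_sub_left, inner_sub_right, inner_smul_left, inner_smul_right, fp, pf, pp, ff, conj_trivial, if_true]
    field_simp
    rw [hv3]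
    linear_combination α * hα1
  have nsome : ∀ j, ((‖w (some j)‖₊ ^ 2 : NNReal) : ℝ) = f1 1 + if j = 0 then f2 1 else 0 := fun j => by
    refine (nn (some j)).trans ?_
    simp only [w, pp, if_true]; by_cases hj : j = 0 <;> simp [hj]
  have hv30 : 0 ≤ v3 := by rw [← nnone]; positivity
  let F : Option (Fin (M+1)) → ℝ → ℝ := fun k => match k with
    | none => fun t => Real.exp (-(2 / δ ^ 2 * (t - v3 * (q * y)) ^ 2 / 2))
    | some j => fun t => Real.exp (-((if j = 0 then 3 / δ ^ 2 else 1 / δ ^ 2) * (t - (if j = 0 then (f1 1 + f2 1) * (q * (α * y + m)) else 0)) ^ 2 / 2))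
  have hF : ∀ k, Measurable (F k) := by
    rintro (_ | _) <;> simp only [F] <;> fun_prop
  have key : ∀ g : E, ∏ k, F k (inner ℝ g (w k)) ≤ wgt φ δ (f 1 * y + f1 1 * m) (f1 1 * y + (f1 1 + f2 1) * m) σ g := fun g => by
    unfold wgt
    rw [Fintype.prod_option]
    simp only [F, ← Real.exp_sum, ← Real.exp_add]
    rw [Real.exp_le_exp]
    set x := f1 1 * y + (f1 1 + f2 1) * m with hx
    have b2 : ‖grd φ σ g - x • σ‖ ^ 2 = ∑ j, ((inner ℝ g (p j) : ℝ) - x * (q * if j = 0 then 1 else 0)) ^ 2 := by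
      rw [← b.sum_sq_norm_inner_right (grd φ σ g - x • σ)]
      refine Finset.sum_congr rfl fun j _ => ?_
      rw [Real.norm_eq_abs, sq_abs, real_inner_comm, inner_sub_left, grd_inner, inner_smul_left, hσj]; simp [p]
    rw [b2, Fin.sum_univ_succ, Fin.sum_univ_succ]
    simp only [w, if_true, Fin.succ_ne_zero, if_false, inner_sub_right, inner_smul_right]
    set X := (inner ℝ g (p 0) : ℝ)
    set Y := (inner ℝ g (φ σ) : ℝ)
    have e1 : ∑ i : Fin M, -(1 / δ ^ 2 * ((inner ℝ g (p i.succ) : ℝ) - 0) ^ 2 / 2) = - (∑ i : Fin M, ((inner ℝ g (p i.succ) : ℝ) - x * (q * 0)) ^ 2) / (2 * δ ^ 2) := by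
      rw [← Finset.sum_neg_distrib, Finset.sum_div]
      refine Finset.sum_congr rfl fun j _ => ?_
      field_simp; ring
    rw [e1]
    set S := ∑ i : Fin M, ((inner ℝ g (p i.succ) : ℝ) - x * (q * 0)) ^ 2
    set A := X - x * (q * 1) with hA
    set B := q⁻¹ * Y - α * X - v3 * (q * y) with hB
    have e2 : (Y - (f 1 * y + f1 1 * m) * ((M+1 : ℕ) : ℝ)) ^ 2 / ((M+1 : ℕ) : ℝ) = (B + α * A) ^ 2 := by
      rw [← hNdef, hqN, hA, hB, hx]
      have : (Y - (f 1 * y + f1 1 * m) * q ^ 2) = q * (q⁻¹ * Y - α * X - v3 * (q * y) + α * (X - (f1 1 * y + (f1 1 + f2 1) * m) * (q * 1))) := by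
        rw [hv3]; field_simp; linear_combination q ^ 2 * m * hα1
      rw [this]; field_simp
    rw [e2]
    have e3 : X - (f1 1 + f2 1) * (q * (α * y + m)) = A := by
      rw [hA, hx]; linear_combination (-q * y) * hα1
    rw [e3]
    have e4 : (B + α * A) ^ 2 ≤ 2 * B ^ 2 + 2 * A ^ 2 := by
      have : (α * A) ^ 2 ≤ A ^ 2 := by rw [mul_pow]; exact mul_le_of_le_one_left (sq_nonneg _) (pow_le_one₀ hα0 hαle)
      linarith [sq_nonneg (B - α * A)]
    have e5 : (A ^ 2 + S + (B + α * A) ^ 2) / (2 * δ ^ 2) ≤ (A ^ 2 + S + (2 * B ^ 2 + 2 * A ^ 2)) / (2 * δ ^ 2) := by gcongr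
    have e6 : (A ^ 2 + S + (2 * B ^ 2 + 2 * A ^ 2)) / (2 * δ ^ 2) = 2 / δ ^ 2 * B ^ 2 / 2 + 3 / δ ^ 2 * A ^ 2 / 2 + S / (2 * δ ^ 2) := by field_simp; ring
    rw [neg_div]
    linarith
  have hFp : ∀ k t, 0 < F k t := by rintro (_ | _) t <;> exact Real.exp_pos _
  have hwm : AEStronglyMeasurable (fun g => wgt φ δ (f 1 * y + f1 1 * m) (f1 1 * y + (f1 1 + f2 1) * m) σ g) (stdGaussian E) := by
    apply Continuous.aestronglyMeasurable
    unfold wgt grd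
    fun_prop
  have hwint : Integrable (fun g => wgt φ δ (f 1 * y + f1 1 * m) (f1 1 * y + (f1 1 + f2 1) * m) σ g) (stdGaussian E) :=
    Integrable.of_bound hwm 1 (ae_of_all _ fun g => by rw [Real.norm_of_nonneg (wgt_pos _ _ _ _ _).le]; exact wgt_le_one _ _ _ _ _)
  refine le_trans ?_ (integral_mono_of_nonneg (ae_of_all _ fun g => (Finset.prod_pos fun k _ => hFp k _).le) hwint (ae_of_all _ key))
  rw [orth_int w hw F hF, Fintype.prod_option, Fin.prod_univ_succ]
  have g0 := gauss1_lb (‖w none‖₊ ^ 2) (s := 2 / δ ^ 2) (by positivity) (v3 * (q * y)) (q * y) (by rw [nnone])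
  have g1 := gauss1_lb (‖w (some 0)‖₊ ^ 2) (s := 3 / δ ^ 2) (by positivity) ((f1 1 + f2 1) * (q * (α * y + m))) (q * (α * y + m)) (by rw [nsome]; simp)
  have g2 : ∀ j : Fin M, _ := fun j => gauss1_lb (‖w (some j.succ)‖₊ ^ 2) (s := 1 / δ ^ 2) (by positivity) 0 0 (by simp)
  rw [nnone] at g0
  rw [nsome] at g1
  simp only [nsome, if_true, Fin.succ_ne_zero, if_false] at g1 g2
  have g3 : (Real.sqrt (1 + f1 1 / δ ^ 2))⁻¹ ^ M ≤ ∏ i : Fin M, ∫ t, F (some i.succ) t ∂(gaussianReal 0 (‖w (some i.succ)‖₊ ^ 2)) := by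
    have : (Real.sqrt (1 + f1 1 / δ ^ 2))⁻¹ ^ M = ∏ i : Fin M, (Real.sqrt (1 + f1 1 / δ ^ 2))⁻¹ := by simp
    rw [this]
    refine Finset.prod_le_prod (fun _ _ => by positivity) fun j _ => ?_
    refine le_trans (le_of_eq ?_) ((g2 j).trans (le_of_eq ?_))
    · simp; ring_nf
    · simp only [F, Fin.succ_ne_zero, if_false]
  have hc3 : (Real.sqrt (1 + 2 * f 1 / δ ^ 2))⁻¹ ≤ (Real.sqrt (1 + 2 / δ ^ 2 * v3))⁻¹ := by
    apply inv_anti₀ (Real.sqrt_pos.2 (by positivity))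
    apply Real.sqrt_le_sqrt
    have : v3 ≤ f 1 := by rw [hv3]; linarith [mul_nonneg hα0 h1.le]
    have := mul_le_mul_of_nonneg_left this (show 0 ≤ 2 / δ ^ 2 by positivity)
    have e : 2 * f 1 / δ ^ 2 = 2 / δ ^ 2 * f 1 := by ring
    linarith
  have hexp : Real.exp (-(N * ((f 1 * y ^ 2 + 2 * f1 1 * y * m + (f1 1 + f2 1) * m ^ 2) / 2))) = Real.exp (-(v3 * (q * y) ^ 2 / 2)) * Real.exp (-((f1 1 + f2 1) * (q * (α * y + m)) ^ 2 / 2)) := by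
    rw [← Real.exp_add]; congr 1; rw [hqN, hv3]; linear_combination (q ^ 2 * y ^ 2 * α / 2 + q ^ 2 * y * m) * hα1
  rw [hexp]
  have hX : (Real.sqrt (1 + 2 * f 1 / δ ^ 2))⁻¹ * Real.exp (-(v3 * (q * y) ^ 2 / 2)) ≤ ∫ t, F none t ∂(gaussianReal 0 (‖w none‖₊ ^ 2)) :=
    (mul_le_mul_of_nonneg_right hc3 (Real.exp_pos _).le).trans g0
  have hY : (Real.sqrt (1 + 3 * (f1 1 + f2 1) / δ ^ 2))⁻¹ * Real.exp (-((f1 1 + f2 1) * (q * (α * y + m)) ^ 2 / 2)) ≤ ∫ t, F (some 0) t ∂(gaussianReal 0 (‖w (some 0)‖₊ ^ 2)) := by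
    refine le_trans (le_of_eq ?_) (g1.trans (le_of_eq ?_))
    · ring_nf
    · simp only [F, if_true]
  have hfin := mul_le_mul hX (mul_le_mul hY g3 (by positivity) (integral_nonneg fun t => (hFp (some 0) t).le)) (by positivity) (integral_nonneg fun t => (hFp none t).le)
  refine le_trans (le_of_eq ?_) hfin
  ring
end g7

section g8
set_option linter.unusedSectionVars false
variable {E : Type*} [NormedAddCommGroup E] [InnerProductSpace ℝ E] [FiniteDimensional ℝ E]
  [MeasurableSpace E] [BorelSpace E]

variable {M : ℕ} {φ : EuclideanSpace ℝ (Fin (M+1)) → E} {f f1 f2 : ℝ → ℝ}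

/-- first moment lower bound -/
def FM (M : ℕ) (δ n0 n1 n2 Q : ℝ) : ℝ :=
  (Real.sqrt (1 + n1 / δ ^ 2))⁻¹ ^ M * ((Real.sqrt (1 + 3 * (n1 + n2) / δ ^ 2))⁻¹ * (Real.sqrt (1 + 2 * n0 / δ ^ 2))⁻¹) * Real.exp (-((M+1 : ℕ) * Q))

/-- the constant in the second moment -/
def CM (δ n0 n1 n2 : ℝ) : ℝ :=
  (n1 + δ ^ 2) ^ 2 / δ ^ 4 * ((1 + 3 * (n1 + n2) / δ ^ 2) * (1 + 2 * n0 / δ ^ 2))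

lemma Feat.pairF (h : Feat (M+1) φ f f1 f2) {σ τ : EuclideanSpace ℝ (Fin (M+1))} {r δ : ℝ} (hδ : 0 < δ) (hσ : (inner ℝ σ σ : ℝ) = (M+1 : ℕ)) (hτ : (inner ℝ τ τ : ℝ) = (M+1 : ℕ))
    (hr : (inner ℝ σ τ : ℝ) = (M+1 : ℕ) * r) (hr1 : r ∈ Set.Ioo (-1 : ℝ) 1) (hM : 2 ≤ M) (h0 : 0 ≤ f 1) (h1 : 0 < f1 1) (h2 : 0 ≤ f2 1) (hB : |f1 r| ≤ f1 1) {u x Q ε a b c : ℝ}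
    (hF : FF δ (f 1) (f1 1) (f2 1) (f r) (f1 r) (f2 r) u x Q r a b c ≤ ε) :
    ∫ g, wgt φ δ u x σ g * wgt φ δ u x τ g ∂(stdGaussian E) ≤
      CM δ (f 1) (f1 1) (f2 1) * Real.exp ((M+1 : ℕ) * ε) * Real.exp (-((M+1 : ℕ) / 2 * Real.log (1 - r ^ 2))) * FM M δ (f 1) (f1 1) (f2 1) Q ^ 2 := by
  refine (h.pair hδ hσ hτ hr (by omega) u x a b c).trans ?_
  set N : ℝ := ((M+1 : ℕ) : ℝ) with hNdef
  have hN : 0 < N := by simp only [hNdef]; positivity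
  have hB1 := neg_le_of_abs_le hB
  have hB2 := le_of_abs_le hB
  have hd2 : 0 < δ ^ 2 := by positivity
  set D := (f1 1 + δ ^ 2) ^ 2 - f1 r ^ 2 with hD
  have hDe : D = (f1 1 + δ ^ 2 + f1 r) * (f1 1 + δ ^ 2 - f1 r) := by rw [hD]; ring
  have hD0 : 0 < D := by rw [hDe]; exact mul_pos (by linarith) (by linarith)
  have hDle : D ≤ (f1 1 + δ ^ 2) ^ 2 := by rw [hD]; linarith [sq_nonneg (f1 r)]
  set Y := (Real.sqrt (1 + (f1 1 + f1 r) / δ ^ 2))⁻¹ * (Real.sqrt (1 + (f1 1 - f1 r) / δ ^ 2))⁻¹ with hY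
  have hY1 : Y = Real.exp (Real.log (δ ^ 2) - 1 / 2 * Real.log D) := by
    have e1 : 0 < 1 + (f1 1 + f1 r) / δ ^ 2 := by have : 0 ≤ (f1 1 + f1 r) / δ ^ 2 := div_nonneg (by linarith) hd2.le; linarith
    have e2 : (1 + (f1 1 + f1 r) / δ ^ 2) * (1 + (f1 1 - f1 r) / δ ^ 2) = D / (δ ^ 2) ^ 2 := by rw [hDe]; field_simp; ring
    rw [hY, ← mul_inv, ← Real.sqrt_mul e1.le, e2, Real.sqrt_div hD0.le, Real.sqrt_sq hd2.le, Real.exp_sub, Real.exp_log hd2,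
      show 1 / 2 * Real.log D = Real.log (Real.sqrt D) by rw [Real.log_sqrt hD0.le]; ring, Real.exp_log (Real.sqrt_pos.2 hD0), inv_div]
  have hY0 : 0 < Y := by rw [hY1]; exact Real.exp_pos _
  have hYN : Y ^ (M + 1 - 2) = Real.exp (N * (Real.log (δ ^ 2) - 1 / 2 * Real.log D)) * (D / δ ^ 4) := by
    have : Y ^ (M + 1) = Y ^ (M + 1 - 2) * Y ^ 2 := by rw [← pow_add]; congr 1; omega
    have e3 : Y ^ (M+1) = Real.exp (N * (Real.log (δ ^ 2) - 1 / 2 * Real.log D)) := by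
      rw [hY1, ← Real.exp_nat_mul]
    have e4 : Y ^ 2 = δ ^ 4 / D := by
      rw [hY1, ← Real.exp_nat_mul, show ((2:ℕ):ℝ) * (Real.log (δ ^ 2) - 1 / 2 * Real.log D) = Real.log (δ ^ 2) + Real.log (δ ^ 2) - Real.log D by push_cast; ring,
        Real.exp_sub, Real.exp_add, Real.exp_log hd2, Real.exp_log hD0]; ring
    rw [← e3, this, e4]; field_simp
  rw [hYN]
  unfold FF at hF
  rw [← hD] at hF
  have hn1d : 0 < f1 1 + δ ^ 2 := by linarith
  set VVx := 1 / 2 * VV (f 1) (f1 1) (f2 1) (f r) (f1 r) (f2 r) r a b c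
  set Lr := Real.log (1 - r ^ 2)
  set LD := Real.log D
  set Ln := Real.log (f1 1 + δ ^ 2) with hLn
  set Ld := Real.log (δ ^ 2) with hLd
  set G2 := (Real.sqrt (1 + f1 1 / δ ^ 2))⁻¹ with hG2
  have hG2s : G2 ^ 2 = Real.exp (Ld - Ln) := by
    rw [hG2, inv_pow, Real.sq_sqrt (by positivity), Real.exp_sub, hLd, hLn, Real.exp_log hd2, Real.exp_log hn1d]; field_simp; ring
  have hG20 : 0 < G2 := by positivity
  have hG21 : G2 ≤ 1 := by
    rw [hG2]; apply inv_le_one_of_one_le₀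
    rw [Real.one_le_sqrt]
    have : 0 ≤ f1 1 / δ ^ 2 := by positivity
    linarith
  have hGM : Real.exp (N * (Ld - Ln)) ≤ (G2 ^ M) ^ 2 := by
    have : Real.exp (N * (Ld - Ln)) = (G2 ^ M) ^ 2 * G2 ^ 2 := by
      rw [hNdef, Real.exp_nat_mul, ← hG2s]; ring
    rw [this]; exact mul_le_of_le_one_right (by positivity) (pow_le_one₀ hG20.le hG21)
  have hs1 : Real.sqrt (1 + 3 * (f1 1 + f2 1) / δ ^ 2) ^ 2 = 1 + 3 * (f1 1 + f2 1) / δ ^ 2 := Real.sq_sqrt (by positivity)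
  have hs2 : Real.sqrt (1 + 2 * f 1 / δ ^ 2) ^ 2 = 1 + 2 * f 1 / δ ^ 2 := Real.sq_sqrt (by positivity)
  have hp1 : 0 < 1 + 3 * (f1 1 + f2 1) / δ ^ 2 := by positivity
  have hp2 : 0 < 1 + 2 * f 1 / δ ^ 2 := by positivity
  have hFM : FM M δ (f 1) (f1 1) (f2 1) Q ^ 2 * ((1 + 3 * (f1 1 + f2 1) / δ ^ 2) * (1 + 2 * f 1 / δ ^ 2)) = (G2 ^ M) ^ 2 * Real.exp (-(N * (2 * Q))) := by
    unfold FM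
    rw [← hG2, ← hNdef, show Real.exp (-(N * (2 * Q))) = Real.exp (-(N * Q)) ^ 2 by rw [← Real.exp_nat_mul]; congr 1; push_cast; ring]
    rw [mul_pow, mul_pow, mul_pow, inv_pow (Real.sqrt (1 + 3 * (f1 1 + f2 1) / δ ^ 2)), inv_pow (Real.sqrt (1 + 2 * f 1 / δ ^ 2)), hs1, hs2]
    field_simp
  have hrhs : CM δ (f 1) (f1 1) (f2 1) * Real.exp (N * ε) * Real.exp (-(N / 2 * Lr)) * FM M δ (f 1) (f1 1) (f2 1) Q ^ 2
      = (f1 1 + δ ^ 2) ^ 2 / δ ^ 4 * Real.exp (N * ε) * Real.exp (-(N / 2 * Lr)) * ((G2 ^ M) ^ 2 * Real.exp (-(N * (2 * Q)))) := by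
    rw [← hFM]; unfold CM; ring
  rw [hrhs]
  have hlhs : ∀ Z, Real.exp (N * (Ld - 1 / 2 * LD)) * (D / δ ^ 4) * Real.exp (N * Z) = (D / δ ^ 4) * Real.exp (N * (Z + 1 / 2 * Lr - 1 / 2 * LD + Ln + 2 * Q)) * Real.exp (-(N / 2 * Lr)) * (Real.exp (N * (Ld - Ln)) * Real.exp (-(N * (2 * Q)))) := fun Z => by
    rw [mul_comm (Real.exp _) (D / δ ^ 4)]
    simp only [mul_assoc, ← Real.exp_add]
    congr 2; ring
  rw [hlhs]
  gcongr
  linarith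

/-- projection to the sphere of radius `√N` -/
def Sp (M : ℕ) (h : EuclideanSpace ℝ (Fin (M+1))) : EuclideanSpace ℝ (Fin (M+1)) :=
  if h = 0 then Real.sqrt (M+1 : ℕ) • EuclideanSpace.single 0 1 else (Real.sqrt (M+1 : ℕ) / ‖h‖) • h

lemma Sp_inner (h : EuclideanSpace ℝ (Fin (M+1))) : (inner ℝ (Sp M h) (Sp M h) : ℝ) = (M+1 : ℕ) := by
  unfold Sp
  rw [real_inner_self_eq_norm_sq]
  split_ifs with h0
  · rw [norm_smul, mul_pow, EuclideanSpace.norm_single]; simp; rw [Real.sq_sqrt (by positivity)]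
  · have : ‖h‖ ≠ 0 := norm_ne_zero_iff.2 h0
    rw [norm_smul, Real.norm_of_nonneg (by positivity), div_mul_cancel₀ _ this, Real.sq_sqrt (by positivity)]

lemma Sp_meas : Measurable (Sp M) := by
  unfold Sp
  refine Measurable.ite (measurableSet_eq) (by fun_prop) ?_
  exact (measurable_const.div measurable_norm).smul measurable_id

lemma Sp_tail {τ : EuclideanSpace ℝ (Fin (M+1))} (hτ : (inner ℝ τ τ : ℝ) = (M+1 : ℕ)) (hM : 1 ≤ M) {t : ℝ} (ht : 0 < t) (ht1 : t ≤ 1) :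
    (stdGaussian (EuclideanSpace ℝ (Fin (M+1)))).real {h | 1 - ((inner ℝ (Sp M h) τ : ℝ) / (M+1 : ℕ)) ^ 2 ≤ t} ≤ 2 * Real.sqrt (M+1 : ℕ) * Real.sqrt t ^ M := by
  set N : ℝ := ((M+1 : ℕ) : ℝ) with hNdef
  have hN : 0 < N := by simp only [hNdef]; positivity
  have hMr : (1:ℝ) ≤ M := by exact_mod_cast hM
  have hNM : N = M + 1 := by simp [hNdef]
  set q := Real.sqrt N with hq
  have hq0 : 0 < q := Real.sqrt_pos.2 hN
  have hqq : q * q = N := Real.mul_self_sqrt hN.le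
  have hnτ : ‖τ‖ = q := by
    rw [hq, ← hτ, real_inner_self_eq_norm_sq, Real.sqrt_sq (norm_nonneg _)]
  obtain ⟨b, hb⟩ := exists_basis0 (V := EuclideanSpace ℝ (Fin (M+1))) (n := M) (by simp) (q⁻¹ • τ) (by
    rw [norm_smul, hnτ, norm_inv, Real.norm_of_nonneg hq0.le, inv_mul_cancel₀ hq0.ne'])
  have hτb : τ = q • b 0 := by rw [hb, smul_smul, mul_inv_cancel₀ hq0.ne', one_smul]
  have hw : ∀ i j, i ≠ j → (inner ℝ (b i) (b j) : ℝ) = 0 := fun i j hij => b.orthonormal.2 hij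
  set s := (1 - 1 / N) / t with hs
  have h1N : 1 / N < 1 := by rw [div_lt_one hN, hNM]; linarith
  have hs0 : 0 < s := div_pos (by linarith) ht
  have hst : s * t = 1 - 1 / N := by rw [hs]; field_simp
  let F : Fin (M+1) → ℝ → ℝ := fun k x => Real.exp (-((if k = 0 then -(s * t) else s * (1 - t)) * x ^ 2 / 2) + 0 * x)
  have hF : ∀ k, Measurable (F k) := fun k => by simp only [F]; fun_prop
  have nb : ∀ k, ((‖b k‖₊ ^ 2 : NNReal) : ℝ) = 1 := fun k => by simp [b.orthonormal.1 k]
  have key : ∀ h, Set.indicator {h | 1 - ((inner ℝ (Sp M h) τ : ℝ) / N) ^ 2 ≤ t} (fun _ => (1:ℝ)) h ≤ ∏ k, F k (inner ℝ h (b k)) := fun h => by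
    rw [Set.indicator_apply]
    have hp : 0 < ∏ k, F k (inner ℝ h (b k)) := Finset.prod_pos fun k _ => Real.exp_pos _
    split_ifs with hh
    swap
    · exact hp.le
    rw [mem_ofPred_eq] at hh
    have hexp : ∏ k, F k (inner ℝ h (b k)) = Real.exp (s / 2 * ((inner ℝ h (b 0) : ℝ) ^ 2 - (1 - t) * ‖h‖ ^ 2)) := by
      rw [← b.sum_sq_norm_inner_left h]
      simp only [F, ← Real.exp_sum, Real.norm_eq_abs, sq_abs]
      congr 1
      rw [Fin.sum_univ_succ, Fin.sum_univ_succ]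
      simp only [if_true, Fin.succ_ne_zero, if_false]
      have : ∑ x : Fin M, (-(s * (1 - t) * (inner ℝ h (b x.succ) : ℝ) ^ 2 / 2) + 0 * (inner ℝ h (b x.succ) : ℝ)) = - (s / 2 * (1 - t)) * ∑ i : Fin M, (inner ℝ h (b i.succ) : ℝ) ^ 2 := by
        rw [Finset.mul_sum]; exact Finset.sum_congr rfl fun _ _ => by ring
      rw [this]; ring
    rw [hexp, Real.one_le_exp_iff]
    refine mul_nonneg (by positivity) ?_
    by_cases h0 : h = 0
    · subst h0; simp
    have hn : 0 < ‖h‖ := norm_pos_iff.2 h0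
    have e1 : (inner ℝ (Sp M h) τ : ℝ) / N = (inner ℝ h (b 0) : ℝ) / ‖h‖ := by
      unfold Sp
      rw [if_neg h0, inner_smul_left, hτb, inner_smul_right, ← hNdef, ← hq, ← hqq]
      simp only [conj_trivial]; field_simp
    rw [e1, div_pow] at hh
    have e2 : (1 - t) ≤ (inner ℝ h (b 0) : ℝ) ^ 2 / ‖h‖ ^ 2 := by linarith
    rw [le_div_iff₀ (by positivity)] at e2
    linarith
  have hmS : MeasurableSet {h | 1 - ((inner ℝ (Sp M h) τ : ℝ) / N) ^ 2 ≤ t} := by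
    refine measurableSet_le ?_ measurable_const
    have := (Sp_meas (M := M))
    fun_prop
  have g0 : ∀ k, ∫ x, F k x ∂(gaussianReal 0 (‖b k‖₊ ^ 2)) = (Real.sqrt (1 + (if k = 0 then -(s * t) else s * (1 - t))))⁻¹ := fun k => by
    simp only [F]
    have hp : 0 < 1 + (if k = 0 then -(s * t) else s * (1 - t)) := by
      split_ifs
      · rw [hst]; have : 0 < 1 / N := by positivity
        linarith
      · have : 0 ≤ s * (1 - t) := mul_nonneg hs0.le (by linarith)
        linarith
    rw [gauss1 _ _ _ (by rw [nb, mul_one]; exact hp), nb]; simp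
  have hI : Integrable (fun h => ∏ k, F k (inner ℝ h (b k))) (stdGaussian (EuclideanSpace ℝ (Fin (M+1)))) := by
    by_contra hni
    have hz := integral_undef hni
    rw [orth_int (fun k => b k) hw F hF] at hz
    simp only [g0] at hz
    rw [Finset.prod_eq_zero_iff] at hz
    obtain ⟨k, _, hk⟩ := hz
    have hp : 0 < 1 + (if k = 0 then -(s * t) else s * (1 - t)) := by
      split_ifs
      · rw [hst]; have : 0 < 1 / N := by positivity
        linarith
      · have : 0 ≤ s * (1 - t) := mul_nonneg hs0.le (by linarith)
        linarith
    exact (inv_pos.2 (Real.sqrt_pos.2 hp)).ne' hk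
  have h5 := integral_mono_of_nonneg (ae_of_all _ fun h => Set.indicator_nonneg (fun _ _ => zero_le_one) h) hI (ae_of_all _ key)
  rw [integral_indicator_const _ hmS, smul_eq_mul, mul_one, orth_int (fun k => b k) hw F hF] at h5
  refine h5.trans ?_
  simp only [g0]
  rw [Fin.prod_univ_succ]
  simp only [if_true, Fin.succ_ne_zero, if_false, Finset.prod_const, Finset.card_univ, Fintype.card_fin]
  have e1 : (Real.sqrt (1 + -(s * t)))⁻¹ = q := by
    rw [hst, show 1 + -(1 - 1 / N) = N⁻¹ by rw [one_div]; ring, Real.sqrt_inv, inv_inv]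
  rw [e1]
  have e2 : 1 + s * (1 - t) = (1 - (1 - t) / N) / t := by rw [mul_sub, hst, mul_one, hs]; field_simp; ring
  have e3 : (1 - 1 / N) / t ≤ 1 + s * (1 - t) := by
    rw [e2]; gcongr; linarith
  have e4 : (Real.sqrt (1 + s * (1 - t)))⁻¹ ≤ Real.sqrt t * Real.sqrt (1 + 1 / M) := by
    rw [← Real.sqrt_mul ht.le, ← Real.sqrt_inv]
    apply Real.sqrt_le_sqrt
    have : (t * (1 + 1 / M))⁻¹ = (1 - 1 / N) / t := by
      rw [hNM]; field_simp; ring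
    rw [inv_le_comm₀ (by have : 0 ≤ s * (1 - t) := mul_nonneg hs0.le (by linarith)
                         linarith) (by positivity), this]
    exact e3
  have e5 : Real.sqrt (1 + 1 / M) ^ M ≤ 2 := by
    refine abs_le_of_sq_le_sq' ?_ (by norm_num) |>.2
    rw [← pow_mul, mul_comm, pow_mul, Real.sq_sqrt (by positivity)]
    have : (1 + 1 / (M:ℝ)) ^ M ≤ Real.exp 1 := by
      have h7 := Real.add_one_le_exp (1 / (M:ℝ))
      calc (1 + 1 / (M:ℝ)) ^ M ≤ Real.exp (1 / M) ^ M := by gcongr; linarith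
        _ = Real.exp 1 := by rw [← Real.exp_nat_mul]; congr 1; field_simp
    linarith [Real.exp_one_lt_d9]
  calc q * (Real.sqrt (1 + s * (1 - t)))⁻¹ ^ M ≤ q * (Real.sqrt t * Real.sqrt (1 + 1 / M)) ^ M := by gcongr
    _ = q * Real.sqrt t ^ M * Real.sqrt (1 + 1 / M) ^ M := by rw [mul_pow]; ring
    _ ≤ q * Real.sqrt t ^ M * 2 := by gcongr
    _ = _ := by ring
end g8

section g9
set_option linter.unusedSectionVars false
variable {E : Type*} [NormedAddCommGroup E] [InnerProductSpace ℝ E] [FiniteDimensional ℝ E]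
  [MeasurableSpace E] [BorelSpace E]

variable {M : ℕ} {φ : EuclideanSpace ℝ (Fin (M+1)) → E} {f f1 f2 : ℝ → ℝ}

lemma Feat.wgt_cont (h : Feat (M+1) φ f f1 f2) (δ u x : ℝ) :
    Continuous (fun p : EuclideanSpace ℝ (Fin (M+1)) × E => wgt φ δ u x p.1 p.2) := by
  have h1 : Continuous (fun σ => fderiv ℝ φ σ) := h.smooth.continuous_fderiv one_ne_zero
  have h2 : Continuous (fun σ => ContinuousLinearMap.adjoint (fderiv ℝ φ σ)) := 
    (ContinuousLinearMap.adjoint (𝕜 := ℝ) (E := EuclideanSpace ℝ (Fin (M+1))) (F := E)).continuous.comp h1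
  have h3 : Continuous (fun p : EuclideanSpace ℝ (Fin (M+1)) × E => grd φ p.1 p.2) := by
    unfold grd
    exact (h2.comp continuous_fst).clm_apply continuous_snd
  have h4 := h.smooth.continuous
  unfold wgt
  fun_prop

/-- the integrated weight -/
def WW (φ : EuclideanSpace ℝ (Fin (M+1)) → E) (δ u x : ℝ) (g : E) : ℝ :=
  ∫ h, wgt φ δ u x (Sp M h) g ∂(stdGaussian (EuclideanSpace ℝ (Fin (M+1))))

lemma Feat.wgt_jm (h : Feat (M+1) φ f f1 f2) (δ u x : ℝ) :
    Measurable (fun p : EuclideanSpace ℝ (Fin (M+1)) × E => wgt φ δ u x (Sp M p.1) p.2) := by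
  have h1 : Measurable (fun p : EuclideanSpace ℝ (Fin (M+1)) × E => (Sp M p.1, p.2)) := (Sp_meas.comp measurable_fst).prodMk measurable_snd
  have h2 := (h.wgt_cont δ u x).measurable.comp h1
  simpa only [Function.comp_def] using h2

lemma bdd_int {α : Type*} [MeasurableSpace α] {μ : Measure α} [IsProbabilityMeasure μ] {F : α → ℝ} (hm : Measurable F) (h0 : ∀ a, 0 ≤ F a) (h1 : ∀ a, F a ≤ 1) : Integrable F μ :=
  Integrable.of_bound hm.aestronglyMeasurable 1 (ae_of_all _ fun a => by rw [Real.norm_of_nonneg (h0 a)]; exact h1 a)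

lemma Feat.WW_meas (h : Feat (M+1) φ f f1 f2) (δ u x : ℝ) : Measurable (WW φ δ u x) := by
  unfold WW
  have := (h.wgt_jm δ u x).comp (measurable_swap (α := E) (β := EuclideanSpace ℝ (Fin (M+1))))
  exact (StronglyMeasurable.integral_prod_right (ν := stdGaussian (EuclideanSpace ℝ (Fin (M+1)))) (f := fun g σ => wgt φ δ u x (Sp M σ) g) this.stronglyMeasurable).measurable

lemma Feat.wgt_mh (h : Feat (M+1) φ f f1 f2) (δ u x : ℝ) (g : E) : Measurable (fun z => wgt φ δ u x (Sp M z) g) := by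
  have h1 : Measurable (fun z : EuclideanSpace ℝ (Fin (M+1)) => (z, g)) := by fun_prop
  have h2 := (h.wgt_jm δ u x).comp h1
  simpa only [Function.comp_def] using h2
lemma Feat.wgt_mg (h : Feat (M+1) φ f f1 f2) (δ u x : ℝ) (z) : Measurable (fun g => wgt φ δ u x (Sp M z) g) := by
  have h1 : Measurable (fun g : E => (z, g)) := by fun_prop
  have h2 := (h.wgt_jm δ u x).comp h1
  simpa only [Function.comp_def] using h2

lemma WW_nonneg (δ u x : ℝ) (g : E) : 0 ≤ WW φ δ u x g := integral_nonneg fun _ => (wgt_pos _ _ _ _ _).le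

lemma Feat.WW_le {δ u x c : ℝ} (h : Feat (M+1) φ f f1 f2) (g : E) (hc : ∀ σ : EuclideanSpace ℝ (Fin (M+1)), (inner ℝ σ σ : ℝ) = (M+1:ℕ) → wgt φ δ u x σ g ≤ c) : WW φ δ u x g ≤ c := by
  have : ∫ h : EuclideanSpace ℝ (Fin (M+1)), c ∂(stdGaussian (EuclideanSpace ℝ (Fin (M+1)))) = c := by simp
  rw [← this]
  exact integral_mono (bdd_int (h.wgt_mh δ u x g) (fun _ => (wgt_pos _ _ _ _ _).le) (fun _ => wgt_le_one _ _ _ _ _)) (integrable_const _) fun z => hc _ (Sp_inner z)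

lemma Feat.WW_le_one (h : Feat (M+1) φ f f1 f2) (δ u x : ℝ) (g : E) : WW φ δ u x g ≤ 1 := h.WW_le g fun σ _ => wgt_le_one _ _ _ _ _

lemma Feat.WW_mean (h : Feat (M+1) φ f f1 f2) {δ : ℝ} (hδ : 0 < δ) (h1 : 0 < f1 1) (h2 : 0 ≤ f2 1) (y m : ℝ) :
    FM M δ (f 1) (f1 1) (f2 1) ((f 1 * y ^ 2 + 2 * f1 1 * y * m + (f1 1 + f2 1) * m ^ 2) / 2) ≤
    ∫ g, WW φ δ (f 1 * y + f1 1 * m) (f1 1 * y + (f1 1 + f2 1) * m) g ∂(stdGaussian E) := by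
  set u := f 1 * y + f1 1 * m
  set x := f1 1 * y + (f1 1 + f2 1) * m
  set F0 := FM M δ (f 1) (f1 1) (f2 1) ((f 1 * y ^ 2 + 2 * f1 1 * y * m + (f1 1 + f2 1) * m ^ 2) / 2)
  have hj := bdd_int (μ := (stdGaussian (EuclideanSpace ℝ (Fin (M+1)))).prod (stdGaussian E)) (h.wgt_jm δ u x) (fun _ => (wgt_pos _ _ _ _ _).le) (fun _ => wgt_le_one _ _ _ _ _)
  have e1 : ∫ g, WW φ δ u x g ∂(stdGaussian E) = ∫ z, ∫ g, wgt φ δ u x (Sp M z) g ∂(stdGaussian E) ∂(stdGaussian (EuclideanSpace ℝ (Fin (M+1)))) :=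
    (integral_integral_swap (f := fun z g => wgt φ δ u x (Sp M z) g) hj).symm
  rw [e1]
  have : ∫ h : EuclideanSpace ℝ (Fin (M+1)), F0 ∂(stdGaussian (EuclideanSpace ℝ (Fin (M+1)))) = F0 := by simp
  rw [← this]
  exact integral_mono (integrable_const _) hj.integral_prod_left fun z => h.first hδ (Sp_inner z) h1 h2 y m

lemma Feat.WW_sq (h : Feat (M+1) φ f f1 f2) (δ u x c : ℝ) (hc : ∀ z, ∫ z', ∫ g, wgt φ δ u x (Sp M z') g * wgt φ δ u x (Sp M z) g ∂(stdGaussian E) ∂(stdGaussian (EuclideanSpace ℝ (Fin (M+1)))) ≤ c) :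
    ∫ g, WW φ δ u x g ^ 2 ∂(stdGaussian E) ≤ c := by
  set μ := stdGaussian (EuclideanSpace ℝ (Fin (M+1)))
  have wp : ∀ σ g, 0 ≤ wgt φ δ u x σ g := fun σ g => (wgt_pos _ _ _ _ _).le
  have wl : ∀ σ g, wgt φ δ u x σ g ≤ 1 := fun σ g => wgt_le_one _ _ _ _ _
  have hj := bdd_int (μ := μ.prod (stdGaussian E)) (F := fun p => wgt φ δ u x (Sp M p.1) p.2 * WW φ δ u x p.2) ((h.wgt_jm δ u x).mul ((h.WW_meas δ u x).comp measurable_snd))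
    (fun _ => mul_nonneg (wp _ _) (WW_nonneg _ _ _ _)) (fun _ => mul_le_one₀ (wl _ _) (WW_nonneg _ _ _ _) (h.WW_le_one _ _ _ _))
  have e1 : ∫ g, WW φ δ u x g ^ 2 ∂(stdGaussian E) = ∫ z, ∫ g, wgt φ δ u x (Sp M z) g * WW φ δ u x g ∂(stdGaussian E) ∂μ := by
    rw [integral_integral_swap (f := fun z g => wgt φ δ u x (Sp M z) g * WW φ δ u x g) hj]
    refine integral_congr_ae (ae_of_all _ fun g => ?_)
    simp only
    rw [integral_mul_const, sq]; rfl
  rw [e1]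
  have : ∫ h : EuclideanSpace ℝ (Fin (M+1)), c ∂μ = c := by simp [μ]
  rw [← this]
  refine integral_mono hj.integral_prod_left (integrable_const _) fun z => ?_
  refine le_trans (le_of_eq ?_) (hc z)
  have hj2 := bdd_int (μ := μ.prod (stdGaussian E)) (F := fun p => wgt φ δ u x (Sp M p.1) p.2 * wgt φ δ u x (Sp M z) p.2) ((h.wgt_jm δ u x).mul ((h.wgt_mg δ u x z).comp measurable_snd))
    (fun _ => mul_nonneg (wp _ _) (wp _ _)) (fun _ => mul_le_one₀ (wl _ _) (wp _ _) (wl _ _))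
  rw [integral_integral_swap (f := fun z' g => wgt φ δ u x (Sp M z') g * wgt φ δ u x (Sp M z) g) hj2]
  refine integral_congr_ae (ae_of_all _ fun g => ?_)
  simp only
  rw [integral_mul_const, mul_comm]; rfl

lemma bins {η t : ℝ} {G : ℕ → ℝ} (ht1 : t ≤ 1) (K : ℕ) (hG : ∀ k, 0 ≤ G k) {w : ℝ} (hw : w ≤ 1)
    (hb : ∀ k, Real.exp (-((k+1 : ℕ) * η)) < t → w ≤ G k) :
    w ≤ (∑ k ∈ Finset.range K, G k * Set.indicator {t : ℝ | t ≤ Real.exp (-(k * η))} (fun _ => (1:ℝ)) t) + Set.indicator {t : ℝ | t ≤ Real.exp (-(K * η))} (fun _ => (1:ℝ)) t := by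
  induction K with
  | zero => simp [Set.indicator_apply, ht1, hw]
  | succ n ih =>
    rw [Finset.sum_range_succ]
    by_cases h1 : t ≤ Real.exp (-((n+1 : ℕ) * η))
    · have : Set.indicator {t : ℝ | t ≤ Real.exp (-((n+1 : ℕ) * η))} (fun _ => (1:ℝ)) t = 1 := by simp only [Set.indicator_apply, mem_ofPred_eq, h1, if_true]
      rw [this]
      have h2 : 0 ≤ ∑ k ∈ Finset.range n, G k * Set.indicator {t : ℝ | t ≤ Real.exp (-(k * η))} (fun _ => (1:ℝ)) t :=
        Finset.sum_nonneg fun k _ => mul_nonneg (hG k) (Set.indicator_nonneg (fun _ _ => zero_le_one) _)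
      have h3 : 0 ≤ G n * Set.indicator {t : ℝ | t ≤ Real.exp (-(n * η))} (fun _ => (1:ℝ)) t := mul_nonneg (hG n) (Set.indicator_nonneg (fun _ _ => zero_le_one) _)
      linarith
    · have h0 : Set.indicator {t : ℝ | t ≤ Real.exp (-((n+1 : ℕ) * η))} (fun _ => (1:ℝ)) t = 0 := by simp only [Set.indicator_apply, mem_ofPred_eq, h1, if_false]
      rw [h0]
      by_cases h2 : t ≤ Real.exp (-(n * η))
      · have : Set.indicator {t : ℝ | t ≤ Real.exp (-(n * η))} (fun _ => (1:ℝ)) t = 1 := by simp only [Set.indicator_apply, mem_ofPred_eq, h2, if_true]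
        rw [this]
        have h2 : 0 ≤ ∑ k ∈ Finset.range n, G k * Set.indicator {t : ℝ | t ≤ Real.exp (-(k * η))} (fun _ => (1:ℝ)) t :=
          Finset.sum_nonneg fun k _ => mul_nonneg (hG k) (Set.indicator_nonneg (fun _ _ => zero_le_one) _)
        have := hb n (not_le.1 h1)
        linarith
      · have : Set.indicator {t : ℝ | t ≤ Real.exp (-(n * η))} (fun _ => (1:ℝ)) t = 0 := by simp only [Set.indicator_apply, mem_ofPred_eq, h2, if_false]
        rw [this] at ih ⊢
        linarith

lemma Feat.WW_sq2 (h : Feat (M+1) φ f f1 f2) {δ u x Q ε η : ℝ} (hδ : 0 < δ) (hη : 0 ≤ η) (hM : 2 ≤ M) (h0 : 0 ≤ f 1) (h1 : 0 < f1 1) (h2 : 0 ≤ f2 1)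
    (hB : ∀ r, |r| ≤ 1 → |f1 r| ≤ f1 1)
    (hF : ∀ r ∈ Set.Ioo (-1 : ℝ) 1, ∃ a b c, FF δ (f 1) (f1 1) (f2 1) (f r) (f1 r) (f2 r) u x Q r a b c ≤ ε) (K : ℕ)
    (hK : Real.exp (-((M+1 : ℕ) / 2 * (K * η))) ≤ FM M δ (f 1) (f1 1) (f2 1) Q ^ 2) :
    ∫ g, WW φ δ u x g ^ 2 ∂(stdGaussian E) ≤
      2 * Real.sqrt (M+1 : ℕ) * Real.exp (K * η / 2) * (K * (CM δ (f 1) (f1 1) (f2 1) * Real.exp ((M+1:ℕ) * (ε + η / 2))) + 1) * FM M δ (f 1) (f1 1) (f2 1) Q ^ 2 := by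
  set F2 := FM M δ (f 1) (f1 1) (f2 1) Q ^ 2
  set C := CM δ (f 1) (f1 1) (f2 1)
  set N : ℝ := ((M+1 : ℕ) : ℝ) with hNdef
  have hN : 0 < N := by simp only [hNdef]; positivity
  have hNM : N = M + 1 := by simp [hNdef]
  have hC : 0 ≤ C := by simp only [C, CM]; positivity
  have hF2 : 0 ≤ F2 := sq_nonneg _
  refine h.WW_sq δ u x _ fun z => ?_
  set μ := stdGaussian (EuclideanSpace ℝ (Fin (M+1)))
  let t : EuclideanSpace ℝ (Fin (M+1)) → ℝ := fun z' => 1 - ((inner ℝ (Sp M z') (Sp M z) : ℝ) / N) ^ 2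
  have htm : Measurable t := by
    have := (Sp_meas (M := M))
    simp only [t]; fun_prop
  let G : ℕ → ℝ := fun k => C * Real.exp (N * ε) * Real.exp (N / 2 * ((k+1 : ℕ) * η)) * F2
  have hG : ∀ k, 0 ≤ G k := fun k => by simp only [G]; positivity
  have key : ∀ z', ∫ g, wgt φ δ u x (Sp M z') g * wgt φ δ u x (Sp M z) g ∂(stdGaussian E) ≤
      (∑ k ∈ Finset.range K, G k * Set.indicator {z | t z ≤ Real.exp (-(k * η))} (fun _ => (1:ℝ)) z') + Set.indicator {z | t z ≤ Real.exp (-(K * η))} (fun _ => (1:ℝ)) z' := fun z' => by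
    refine bins (η := η) (t := t z') (G := G) (by simp only [t]; linarith [sq_nonneg ((inner ℝ (Sp M z') (Sp M z) : ℝ) / N)]) K hG ?_ ?_
    · have : ∫ g : E, (1:ℝ) ∂(stdGaussian E) = 1 := by simp
      rw [← this]
      refine integral_mono_of_nonneg (ae_of_all _ fun g => mul_nonneg (wgt_pos _ _ _ _ _).le (wgt_pos _ _ _ _ _).le) (integrable_const _) (ae_of_all _ fun g => ?_)
      exact mul_le_one₀ (wgt_le_one _ _ _ _ _) (wgt_pos _ _ _ _ _).le (wgt_le_one _ _ _ _ _)
    · intro k hk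
      set r := (inner ℝ (Sp M z') (Sp M z) : ℝ) / N with hr
      have hr1 : r ^ 2 < 1 := by
        have := Real.exp_pos (-((k+1 : ℕ) * η))
        have h3 : 0 < 1 - r ^ 2 := this.trans hk
        linarith
      have hr2 : |r| < 1 := by rwa [sq_lt_one_iff_abs_lt_one] at hr1
      obtain ⟨a, b, c, hF'⟩ := hF r (abs_lt.1 hr2)
      refine (h.pairF hδ (Sp_inner z') (Sp_inner z) (by rw [hr, ← hNdef]; field_simp) (abs_lt.1 hr2) hM h0 h1 h2 (hB r hr2.le) hF').trans ?_
      simp only [G]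
      rw [← hNdef]
      gcongr
      have hlog : -((k+1 : ℕ) * η) ≤ Real.log (1 - r ^ 2) := by
        rw [Real.le_log_iff_exp_le (by linarith)]; exact hk.le
      have := mul_le_mul_of_nonneg_left hlog (show 0 ≤ N / 2 by positivity)
      linarith
  have hms : ∀ k : ℕ, MeasurableSet {z | t z ≤ Real.exp (-(k * η))} := fun k => measurableSet_le htm measurable_const
  have hPk : ∀ k : ℕ, μ.real {z | t z ≤ Real.exp (-(k * η))} ≤ 2 * Real.sqrt N * Real.exp (k * η / 2) * Real.exp (-(N / 2 * (k * η))) := fun k => by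
    refine (Sp_tail (Sp_inner z) (by omega) (Real.exp_pos _) (by rw [Real.exp_le_one_iff]; have : 0 ≤ k * η := by positivity
                                                                 linarith)).trans (le_of_eq ?_)
    rw [← hNdef, ← Real.exp_half, ← Real.exp_nat_mul, mul_assoc _ (Real.exp _) (Real.exp _), ← Real.exp_add]
    congr 2; rw [hNM]; ring
  have hint1 : ∀ k : ℕ, Integrable (fun z' => Set.indicator {z | t z ≤ Real.exp (-(k * η))} (fun _ => (1:ℝ)) z') μ := fun k => (integrable_const (1:ℝ)).indicator (hms k)
  refine (integral_mono_of_nonneg (ae_of_all _ fun z' => integral_nonneg fun g => mul_nonneg (wgt_pos _ _ _ _ _).le (wgt_pos _ _ _ _ _).le)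
    ((integrable_finsetSum _ fun k _ => (hint1 k).const_mul (G k)).add (hint1 K)) (ae_of_all _ key)).trans ?_
  simp only [Pi.add_apply]
  rw [integral_add (integrable_finsetSum _ fun k _ => (hint1 k).const_mul (G k)) (hint1 K), integral_finsetSum _ fun k _ => (hint1 k).const_mul (G k)]
  simp only [integral_const_mul]
  have hii : ∀ k : ℕ, ∫ z', Set.indicator {z | t z ≤ Real.exp (-(k * η))} (fun _ => (1:ℝ)) z' ∂μ = μ.real {z | t z ≤ Real.exp (-(k * η))} := fun k => by
    rw [integral_indicator_const _ (hms k), smul_eq_mul, mul_one]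
  simp only [hii]
  have hsum : ∑ k ∈ Finset.range K, G k * μ.real {z | t z ≤ Real.exp (-(k * η))} ≤ ∑ k ∈ Finset.range K, 2 * Real.sqrt N * Real.exp (K * η / 2) * (C * Real.exp (N * (ε + η / 2))) * F2 := by
    refine Finset.sum_le_sum fun k hk => ?_
    refine (mul_le_mul_of_nonneg_left (hPk k) (hG k)).trans ?_
    have e1 : G k * (2 * Real.sqrt N * Real.exp (k * η / 2) * Real.exp (-(N / 2 * (k * η)))) = 2 * Real.sqrt N * Real.exp (k * η / 2) * (C * Real.exp (N * (ε + η / 2))) * F2 := by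
      simp only [G]
      have : Real.exp (N * (ε + η / 2)) = Real.exp (N * ε) * Real.exp (N / 2 * ((k+1 : ℕ) * η)) * Real.exp (-(N / 2 * (k * η))) := by
        rw [← Real.exp_add, ← Real.exp_add]; congr 1; push_cast; ring
      rw [this]; ring
    rw [e1]
    have : (k:ℝ) ≤ K := by exact_mod_cast (Finset.mem_range.1 hk).le
    gcongr
  rw [Finset.sum_const, Finset.card_range, nsmul_eq_mul] at hsum
  have hlast := (hPk K).trans (mul_le_mul_of_nonneg_left hK (by positivity))
  refine (add_le_add hsum hlast).trans (le_of_eq ?_)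
  ring

lemma PZ {α : Type*} [MeasurableSpace α] {μ : Measure α} [IsProbabilityMeasure μ] {W : α → ℝ} (hm : Measurable W) (h0 : ∀ a, 0 ≤ W a) (h1 : ∀ a, W a ≤ 1) {F θ S : ℝ}
    (hF : F ≤ ∫ a, W a ∂μ) (hF0 : 0 < F) (hθ0 : 0 ≤ θ) (hθ : θ ≤ F / 2) (hS0 : 0 < S) (hS : ∫ a, W a ^ 2 ∂μ ≤ S * F ^ 2) : 1 / (4 * S) ≤ μ.real {a | θ < W a} := by
  have hms : MeasurableSet {a | θ < W a} := measurableSet_lt measurable_const hm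
  have hq : ∀ a, W a ≤ θ + (W a ^ 2 / (4 * (S * F)) + S * F * Set.indicator {a | θ < W a} (fun _ => (1:ℝ)) a) := fun a => by
    have hSF : 0 < S * F := by positivity
    by_cases hh : θ < W a
    · have e : Set.indicator {a | θ < W a} (fun _ => (1:ℝ)) a = 1 := by simp [Set.indicator_apply, hh]
      rw [e]
      have : W a ≤ W a ^ 2 / (4 * (S * F)) + S * F := by
        rw [div_add' _ _ _ (by positivity), le_div_iff₀ (by positivity)]
        linarith [sq_nonneg (W a - 2 * (S * F))]
      linarith
    · have e : Set.indicator {a | θ < W a} (fun _ => (1:ℝ)) a = 0 := by simp [Set.indicator_apply, hh]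
      rw [e]
      have : 0 ≤ W a ^ 2 / (4 * (S * F)) := by positivity
      linarith [not_lt.1 hh]
  have i1 : Integrable (fun a => W a ^ 2 / (4 * (S * F))) μ :=
    (bdd_int (hm.pow_const 2) (fun a => sq_nonneg _) (fun a => pow_le_one₀ (h0 a) (h1 a))).div_const _
  have i2 : Integrable (fun a => S * F * Set.indicator {a | θ < W a} (fun _ => (1:ℝ)) a) μ := ((integrable_const (1:ℝ)).indicator hms).const_mul _
  have h3 := integral_mono (bdd_int hm h0 h1) ((integrable_const θ).add (i1.add i2)) hq
  have h4 : ∫ a, (θ + (W a ^ 2 / (4 * (S * F)) + S * F * Set.indicator {a | θ < W a} (fun _ => (1:ℝ)) a)) ∂μ = θ + ((∫ a, W a ^ 2 ∂μ) / (4 * (S * F)) + S * F * μ.real {a | θ < W a}) := by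
    have i3 : Integrable (fun a => W a ^ 2 / (4 * (S * F)) + S * F * Set.indicator {a | θ < W a} (fun _ => (1:ℝ)) a) μ := i1.add i2
    rw [integral_add (integrable_const θ) i3, integral_add i1 i2, integral_div, integral_const_mul, integral_indicator_const _ hms]; simp
  simp only [Pi.add_apply] at h3
  rw [h4] at h3
  have h5 : (∫ a, W a ^ 2 ∂μ) / (4 * (S * F)) ≤ F / 4 := by
    rw [div_le_iff₀ (by positivity)]; refine hS.trans (le_of_eq ?_); ring
  have h6 : F * (1 / 4) ≤ F * (S * μ.real {a | θ < W a}) := by linarith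
  have h7 := le_of_mul_le_mul_left h6 hF0
  rw [div_le_iff₀ (by positivity)]
  linarith
end g9

section g10
set_option linter.unusedSectionVars false

lemma sphere_seq (M : ℕ) : ∃ d : ℕ → EuclideanSpace ℝ (Fin (M+1)), (∀ k, (inner ℝ (d k) (d k) : ℝ) = (M+1 : ℕ)) ∧
    ∀ h : EuclideanSpace ℝ (Fin (M+1)) → ℝ, Continuous h → ∀ A, (∀ k, h (d k) ≤ A) → ∀ σ, (inner ℝ σ σ : ℝ) = (M+1 : ℕ) → h σ ≤ A := by
  let S : Set (EuclideanSpace ℝ (Fin (M+1))) := {σ | (inner ℝ σ σ : ℝ) = (M+1 : ℕ)}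
  haveI : Nonempty S := ⟨⟨Sp M 0, Sp_inner 0⟩⟩
  refine ⟨fun k => (TopologicalSpace.denseSeq S k : S), fun k => (TopologicalSpace.denseSeq S k).2, fun h hc A hA σ hσ => ?_⟩
  have hcl : IsClosed {s : S | h s ≤ A} := isClosed_le (hc.comp continuous_subtype_val) continuous_const
  have h1 : Set.range (TopologicalSpace.denseSeq S) ⊆ {s : S | h s ≤ A} := by
    rintro _ ⟨k, rfl⟩; exact hA k
  have h2 := closure_minimal h1 hcl
  rw [(TopologicalSpace.denseRange_denseSeq S).closure_range] at h2
  exact h2 (Set.mem_univ ⟨σ, hσ⟩)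

variable {E : Type*} [NormedAddCommGroup E] [InnerProductSpace ℝ E] [FiniteDimensional ℝ E]
  [MeasurableSpace E] [BorelSpace E]

lemma conc_seq (b : ℕ → E) {s V A B : ℝ} (hs : 0 < s) (hV : ∀ i, (inner ℝ (b i) (b i) : ℝ) ≤ V) :
    (stdGaussian E).real {g | ∃ i, A ≤ inner ℝ g (b i)} * (stdGaussian E).real {g | ∀ i, inner ℝ g (b i) ≤ B} ≤ Real.exp (s ^ 2 * V - s * (A - B)) := by
  let U : ℕ → Set E := fun n => {g | A ≤ ⨆ i : Fin (n+1), inner ℝ g (b i)}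
  have hmono : Monotone U := by
    intro n m hnm g hg
    simp only [U, mem_ofPred_eq] at hg ⊢
    refine le_trans hg (ciSup_le fun i => ?_)
    exact le_ciSup (f := fun i : Fin (m+1) => (inner ℝ g (b i) : ℝ)) (Set.finite_range _).bddAbove ⟨i.1, by omega⟩
  have hU : {g : E | ∃ i, A ≤ (inner ℝ g (b i) : ℝ)} ⊆ ⋃ n, U n := by
    rintro g ⟨i, hi⟩
    refine Set.mem_iUnion.2 ⟨i, le_trans hi ?_⟩
    exact le_ciSup (f := fun j : Fin (i+1) => (inner ℝ g (b j) : ℝ)) (Set.finite_range _).bddAbove ⟨i, by omega⟩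
  have hn : ∀ n, (stdGaussian E).real (U n) * (stdGaussian E).real {g | ∀ i, inner ℝ g (b i) ≤ B} ≤ Real.exp (s ^ 2 * V - s * (A - B)) := fun n => by
    refine le_trans (mul_le_mul_of_nonneg_left ?_ measureReal_nonneg) (conc_prob (fun i : Fin (n+1) => b i) (A := A) (B := B) hs (fun i => hV i))
    refine measureReal_mono ?_
    intro g hg
    simp only [mem_ofPred_eq] at hg ⊢
    exact ciSup_le fun i => hg i
  have ht := tendsto_measure_iUnion_atTop (μ := stdGaussian E) hmono
  have ht2 : Tendsto (fun n => (stdGaussian E).real (U n)) atTop (nhds ((stdGaussian E).real (⋃ n, U n))) :=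
    (ENNReal.tendsto_toReal (measure_ne_top _ _)).comp ht
  have h3 := le_of_tendsto' (ht2.mul_const ((stdGaussian E).real {g | ∀ i, inner ℝ g (b i) ≤ B})) hn
  exact le_trans (mul_le_mul_of_nonneg_right (measureReal_mono hU) measureReal_nonneg) h3

variable {M : ℕ} {φ : EuclideanSpace ℝ (Fin (M+1)) → E} {f f1 f2 : ℝ → ℝ}

/-- second-moment constant -/
def SM (M K : ℕ) (δ n0 n1 n2 ε η : ℝ) : ℝ :=
  2 * Real.sqrt (M+1 : ℕ) * Real.exp (K * η / 2) * (K * (CM δ n0 n1 n2 * Real.exp ((M+1:ℕ) * (ε + η / 2))) + 1)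

lemma FM_pos (M : ℕ) {δ n0 n1 n2 : ℝ} (Q : ℝ) (hδ : 0 < δ) (h0 : 0 ≤ n0) (h1 : 0 ≤ n1) (h2 : 0 ≤ n2) : 0 < FM M δ n0 n1 n2 Q := by
  unfold FM; positivity

lemma Feat.lower (h : Feat (M+1) φ f f1 f2) {δ y m Q ε η ε' : ℝ} (hδ : 0 < δ) (hη : 0 ≤ η) (hM : 2 ≤ M) (h0 : 0 < f 1) (h1 : 0 < f1 1) (h2 : 0 ≤ f2 1)
    (hB : ∀ r, |r| ≤ 1 → |f1 r| ≤ f1 1) (hQ : Q = (f 1*y^2+2*f1 1*y*m+(f1 1+f2 1)*m^2)/2)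
    (hF : ∀ r ∈ Set.Ioo (-1 : ℝ) 1, ∃ a b c, FF δ (f 1) (f1 1) (f2 1) (f r) (f1 r) (f2 r) (f 1*y+f1 1*m) (f1 1*y+(f1 1+f2 1)*m) Q r a b c ≤ ε) (K : ℕ)
    (hK : Real.exp (-((M+1 : ℕ) / 2 * (K * η))) ≤ FM M δ (f 1) (f1 1) (f2 1) Q ^ 2) (hε' : 0 < ε')
    (hθ : Real.exp (-((M+1:ℕ) * ε' ^ 2 / (2 * δ ^ 2))) ≤ FM M δ (f 1) (f1 1) (f2 1) Q / 2) :
    (stdGaussian E).real {g | ∀ σ : EuclideanSpace ℝ (Fin (M+1)), (inner ℝ σ σ : ℝ) = (M+1 : ℕ) → (inner ℝ g (φ σ) : ℝ) ≤ (f 1*y+f1 1*m - 2 * ε') * (M+1:ℕ)} ≤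
      4 * SM M K δ (f 1) (f1 1) (f2 1) ε η * Real.exp (-((M+1:ℕ) * (ε' ^ 2 / (4 * f 1)))) := by
  set u := f 1*y+f1 1*m with hu
  set x := f1 1*y+(f1 1+f2 1)*m with hx
  set S := SM M K δ (f 1) (f1 1) (f2 1) ε η with hS
  set N : ℝ := ((M+1 : ℕ) : ℝ) with hNd
  have hN : 0 < N := by simp only [hNd]; positivity
  have hS0 : 0 < S := by
    simp only [hS, SM, CM]; rw [← hNd]; positivity
  have hFM := FM_pos M Q hδ h0.le h1.le h2
  have hm := h.WW_mean hδ h1 h2 y m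
  rw [← hQ, ← hu, ← hx] at hm
  have hsq := h.WW_sq2 (u := u) (x := x) hδ hη hM h0.le h1 h2 hB hF K hK
  have hp := PZ (h.WW_meas δ u x) (WW_nonneg δ u x) (h.WW_le_one δ u x) hm hFM (Real.exp_pos _).le hθ hS0 hsq
  obtain ⟨d, hd, hdd⟩ := sphere_seq M
  have hc := conc_seq (E := E) (fun i => φ (d i)) (s := ε' / (2 * f 1)) (V := N * f 1) (A := (u - ε') * N) (B := (u - 2 * ε') * N) (by positivity) (fun i => by
    rw [h.cov, hd, div_self hN.ne'])
  have hsub : {a | Real.exp (-(N * ε' ^ 2 / (2 * δ ^ 2))) < WW φ δ u x a} ⊆ {g | ∃ i, (u - ε') * N ≤ inner ℝ g (φ (d i))} := by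
    intro g hg
    by_contra hcon
    simp only [mem_ofPred_eq, not_exists, not_le] at hcon hg
    refine absurd hg (not_lt.2 (h.WW_le g fun σ hσ => ?_))
    have h3 := hdd (fun σ => inner ℝ g (φ σ)) (by have := h.smooth.continuous; fun_prop) ((u - ε') * N) (fun k => (hcon k).le) σ hσ
    unfold wgt
    rw [Real.exp_le_exp, neg_le_neg_iff, ← hNd]
    refine le_trans (le_of_eq (?_ : _ = N * ε' ^ 2 / (2 * δ ^ 2))) (div_le_div_of_nonneg_right (?_ : N * ε' ^ 2 ≤ _) (by positivity))
    · rfl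
    · have h4 : N * ε' ^ 2 ≤ (inner ℝ g (φ σ) - u * N) ^ 2 / N := by
        rw [le_div_iff₀ hN]
        have h5 : ε' * N ≤ u * N - inner ℝ g (φ σ) := by linarith
        have h6 := mul_self_le_mul_self (by positivity) h5
        linarith
      have := sq_nonneg ‖grd φ σ g - x • σ‖
      linarith
  have h7 := hp.trans (measureReal_mono hsub)
  have h8 : (stdGaussian E).real {g | ∀ σ : EuclideanSpace ℝ (Fin (M+1)), (inner ℝ σ σ : ℝ) = N → (inner ℝ g (φ σ) : ℝ) ≤ (u - 2 * ε') * N} ≤ (stdGaussian E).real {g | ∀ i, (inner ℝ g (φ (d i)) : ℝ) ≤ (u - 2 * ε') * N} :=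
    measureReal_mono fun g hg i => hg _ (hd i)
  refine h8.trans ?_
  have h9 := (mul_le_mul_of_nonneg_right h7 measureReal_nonneg).trans hc
  rw [div_mul_eq_mul_div, one_mul, div_le_iff₀ (by positivity)] at h9
  refine h9.trans (le_of_eq ?_)
  rw [mul_comm]; congr 2
  field_simp; ring
end g10

section g11

lemma ev_exp (C : ℝ) {a : ℝ} (ha : 0 < a) : ∀ᶠ M : ℕ in atTop, C * ((M+1 : ℕ) : ℝ) ≤ Real.exp (((M+1 : ℕ) : ℝ) * a) := by
  obtain ⟨n, hn⟩ := exists_nat_gt (2 * C / a ^ 2)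
  filter_upwards [eventually_ge_atTop n] with M hM
  set N : ℝ := ((M+1 : ℕ) : ℝ) with hN
  have hN0 : 0 < N := by simp only [hN]; positivity
  have h1 : 2 * C / a ^ 2 ≤ N := hn.le.trans (by rw [hN]; exact_mod_cast (by omega : n ≤ M + 1))
  rw [div_le_iff₀ (by positivity)] at h1
  have h2 := Real.quadratic_le_exp_of_nonneg (x := N * a) (by positivity)
  have h3 := mul_le_mul_of_nonneg_left h1 hN0.le
  have : 0 ≤ N * a := by positivity
  linarith

lemma ev_exp1 {C : ℝ} (hC : 0 ≤ C) {a : ℝ} (ha : 0 < a) : ∀ᶠ M : ℕ in atTop, C ≤ Real.exp (((M+1 : ℕ) : ℝ) * a) := by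
  filter_upwards [ev_exp C ha] with M hM
  refine le_trans ?_ hM
  have : (1:ℝ) ≤ ((M+1 : ℕ) : ℝ) := by push_cast; linarith [(Nat.cast_nonneg M : (0:ℝ) ≤ M)]
  exact le_mul_of_one_le_right hC this

lemma lower_asym {n0 n1 n2 δ Q ε η ε' : ℝ} (h0 : 0 < n0) (h1 : 0 < n1) (h2 : 0 ≤ n2) (hδ : 0 < δ) (hη : 0 < η) (hε : 0 ≤ ε) (hε' : 0 < ε')
    (hL : Real.log (1 + n1 / δ ^ 2) / 2 + Q < ε' ^ 2 / (2 * δ ^ 2)) (hs : ε + η / 2 ≤ ε' ^ 2 / (16 * n0)) :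
    ∃ K : ℕ, ∀ᶠ M : ℕ in atTop, Real.exp (-((M+1 : ℕ) / 2 * (K * η))) ≤ FM M δ n0 n1 n2 Q ^ 2 ∧
      Real.exp (-((M+1:ℕ) * ε' ^ 2 / (2 * δ ^ 2))) ≤ FM M δ n0 n1 n2 Q / 2 ∧
      4 * SM M K δ n0 n1 n2 ε η * Real.exp (-((M+1:ℕ) * (ε' ^ 2 / (4 * n0)))) ≤ Real.exp (-((M+1:ℕ) * (ε' ^ 2 / (16 * n0)))) := by
  set L := Real.log (1 + n1 / δ ^ 2) / 2 + Q with hLd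
  set c := (Real.sqrt (1 + 3 * (n1 + n2) / δ ^ 2))⁻¹ * (Real.sqrt (1 + 2 * n0 / δ ^ 2))⁻¹ with hc
  have hc0 : 0 < c := by rw [hc]; positivity
  have hbig : (1:ℝ) ≤ 1 + n1 / δ ^ 2 := by have : 0 ≤ n1 / δ ^ 2 := by positivity
                                           linarith
  have hlog := Real.log_nonneg hbig
  have hFM : ∀ M : ℕ, c * Real.exp (-((M+1 : ℕ) * L)) ≤ FM M δ n0 n1 n2 Q := fun M => by
    have e1 : (Real.sqrt (1 + n1 / δ ^ 2))⁻¹ ^ M = Real.exp (-(M * (Real.log (1 + n1 / δ ^ 2) / 2))) := by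
      rw [← Real.exp_log (show 0 < (Real.sqrt (1 + n1 / δ ^ 2))⁻¹ by positivity), ← Real.exp_nat_mul, Real.log_inv, Real.log_sqrt (by linarith)]
      congr 1; ring
    unfold FM
    rw [← hc, e1]
    have e2 : Real.exp (-(((M+1 : ℕ):ℝ) * L)) = Real.exp (-(((M+1 : ℕ):ℝ) * (Real.log (1 + n1 / δ ^ 2) / 2))) * Real.exp (-(((M+1 : ℕ):ℝ) * Q)) := by
      rw [← Real.exp_add]; congr 1; rw [hLd]; ring
    rw [e2]
    have e3 : Real.exp (-(((M+1 : ℕ):ℝ) * (Real.log (1 + n1 / δ ^ 2) / 2))) ≤ Real.exp (-(M * (Real.log (1 + n1 / δ ^ 2) / 2))) := by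
      rw [Real.exp_le_exp]; push_cast; linarith
    calc _ = c * Real.exp (-(((M+1 : ℕ):ℝ) * Q)) * Real.exp (-(((M+1 : ℕ):ℝ) * (Real.log (1 + n1 / δ ^ 2) / 2))) := by ring
      _ ≤ c * Real.exp (-(((M+1 : ℕ):ℝ) * Q)) * Real.exp (-(M * (Real.log (1 + n1 / δ ^ 2) / 2))) := by gcongr
      _ = _ := by ring
  obtain ⟨K, hK⟩ := exists_nat_gt ((2 * L + 1) * 2 / η)
  rw [div_lt_iff₀ hη] at hK
  refine ⟨K, ?_⟩
  have hCM : 0 < CM δ n0 n1 n2 := by unfold CM; positivity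
  have hD : 0 < ε' ^ 2 / (2 * δ ^ 2) - L := by linarith
  have ht : 0 < ε' ^ 2 / (8 * n0) := by positivity
  filter_upwards [ev_exp1 (C := 1 / c ^ 2) (by positivity) (one_pos), ev_exp1 (C := 2 / c) (by positivity) hD, ev_exp (8 * Real.exp (K * η / 2) * (K * CM δ n0 n1 n2 + 1)) ht] with M a1 a2 a3
  have hF := hFM M
  set N : ℝ := ((M+1 : ℕ) : ℝ) with hNd
  have hN : 1 ≤ N := by simp only [hNd]; push_cast; linarith [(Nat.cast_nonneg M : (0:ℝ) ≤ M)]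
  refine ⟨?_, ?_, ?_⟩
  · refine le_trans ?_ (pow_le_pow_left₀ (by positivity) hF 2)
    rw [div_le_iff₀ (by positivity)] at a1
    have : Real.exp (-(N / 2 * (K * η))) ≤ Real.exp (-N) * Real.exp (-(2 * (N * L))) := by
      rw [← Real.exp_add, Real.exp_le_exp]
      have := mul_le_mul_of_nonneg_left hK.le (by linarith : 0 ≤ N)
      linarith
    refine this.trans ?_
    have e : (c * Real.exp (-(N * L))) ^ 2 = c ^ 2 * Real.exp (-(2 * (N * L))) := by
      rw [mul_pow, ← Real.exp_nat_mul]; congr 2; push_cast; ring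
    rw [e]
    refine mul_le_mul_of_nonneg_right ?_ (Real.exp_pos _).le
    rw [Real.exp_neg, inv_le_iff_one_le_mul₀ (Real.exp_pos _)]
    simpa [mul_comm] using a1
  · refine le_trans ?_ (div_le_div_of_nonneg_right hF (by norm_num))
    have e : Real.exp (-(N * ε' ^ 2 / (2 * δ ^ 2))) = Real.exp (-(N * L)) * (Real.exp (N * (ε' ^ 2 / (2 * δ ^ 2) - L)))⁻¹ := by
      rw [← Real.exp_neg, ← Real.exp_add]; congr 1; ring
    rw [e]
    have := inv_anti₀ (by positivity) a2
    calc _ ≤ Real.exp (-(N * L)) * (2 / c)⁻¹ := by gcongr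
      _ = _ := by field_simp
  · have hsq : Real.sqrt N ≤ N := Real.sqrt_le_iff.2 ⟨by linarith, by nlinarith⟩
    have hS : SM M K δ n0 n1 n2 ε η ≤ 2 * N * Real.exp (K * η / 2) * (K * CM δ n0 n1 n2 + 1) * Real.exp (N * (ε' ^ 2 / (16 * n0))) := by
      unfold SM
      rw [← hNd]
      have g1 : 1 ≤ Real.exp (N * (ε' ^ 2 / (16 * n0))) := Real.one_le_exp (by positivity)
      have g2 : Real.exp (N * (ε + η / 2)) ≤ Real.exp (N * (ε' ^ 2 / (16 * n0))) := by gcongr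
      have g3 : K * (CM δ n0 n1 n2 * Real.exp (N * (ε + η / 2))) + 1 ≤ (K * CM δ n0 n1 n2 + 1) * Real.exp (N * (ε' ^ 2 / (16 * n0))) := by
        have := mul_le_mul_of_nonneg_left g2 (show 0 ≤ K * CM δ n0 n1 n2 by positivity)
        linarith
      calc _ ≤ 2 * N * Real.exp (K * η / 2) * ((K * CM δ n0 n1 n2 + 1) * Real.exp (N * (ε' ^ 2 / (16 * n0)))) := by
            gcongr
        _ = _ := by ring
    calc _ ≤ 4 * (2 * N * Real.exp (K * η / 2) * (K * CM δ n0 n1 n2 + 1) * Real.exp (N * (ε' ^ 2 / (16 * n0)))) * Real.exp (-(N * (ε' ^ 2 / (4 * n0)))) := by gcongr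
      _ = (8 * Real.exp (K * η / 2) * (K * CM δ n0 n1 n2 + 1) * N) * (Real.exp (N * (ε' ^ 2 / (16 * n0))) * Real.exp (-(N * (ε' ^ 2 / (4 * n0))))) := by ring
      _ ≤ Real.exp (N * (ε' ^ 2 / (8 * n0))) * (Real.exp (N * (ε' ^ 2 / (16 * n0))) * Real.exp (-(N * (ε' ^ 2 / (4 * n0))))) := by gcongr
      _ = _ := by
        rw [← Real.exp_add, ← Real.exp_add]; congr 1; field_simp; ring
end g11

section g12

/-- index set of the truncated disorder -/
abbrev TI (K N : ℕ) : Type := (p : Fin (K+1)) × (Fin p → Fin N)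

/-- feature map -/
def Phi (γ : ℕ → ℝ) (K N : ℕ) (σ : EuclideanSpace ℝ (Fin N)) : EuclideanSpace ℝ (TI K N) :=
  WithLp.toLp 2 fun x => if 2 ≤ (x.1 : ℕ) then γ x.1 * (Real.sqrt ((N:ℝ) ^ ((x.1:ℕ) - 1)))⁻¹ * ∏ k, σ (x.2 k) else 0

lemma nuF_fin (γ : ℕ → ℝ) (K : ℕ) (x : ℝ) : nuF (tr γ K) x = ∑ p : Fin (K+1), if 2 ≤ (p:ℕ) then γ p ^ 2 * x ^ (p:ℕ) else 0 := by
  unfold nuF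
  rw [tsum_eq_sum (s := Finset.range (K+1)), Finset.sum_range]
  · refine Finset.sum_congr rfl fun p _ => ?_
    have : (p:ℕ) ≤ K := by omega
    simp [tr, this]
  · intro p hp
    have : ¬ p ≤ K := by simpa using hp
    simp [tr, this]
lemma nuD1_fin (γ : ℕ → ℝ) (K : ℕ) (x : ℝ) : nuD1 (tr γ K) x = ∑ p : Fin (K+1), if 2 ≤ (p:ℕ) then γ p ^ 2 * (p:ℕ) * x ^ ((p:ℕ) - 1) else 0 := by
  unfold nuD1
  rw [tsum_eq_sum (s := Finset.range (K+1)), Finset.sum_range]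
  · refine Finset.sum_congr rfl fun p _ => ?_
    have : (p:ℕ) ≤ K := by omega
    simp [tr, this]
  · intro p hp
    have : ¬ p ≤ K := by simpa using hp
    simp [tr, this]
lemma nuD2_fin (γ : ℕ → ℝ) (K : ℕ) (x : ℝ) : nuD2 (tr γ K) x = ∑ p : Fin (K+1), if 2 ≤ (p:ℕ) then γ p ^ 2 * (p:ℕ) * (((p:ℕ):ℝ) - 1) * x ^ ((p:ℕ) - 2) else 0 := by
  unfold nuD2
  rw [tsum_eq_sum (s := Finset.range (K+1)), Finset.sum_range]
  · refine Finset.sum_congr rfl fun p _ => ?_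
    have : (p:ℕ) ≤ K := by omega
    simp [tr, this]
  · intro p hp
    have : ¬ p ≤ K := by simpa using hp
    simp [tr, this]

lemma Phi_feat (γ : ℕ → ℝ) (K N : ℕ) (hN : 0 < N) : Feat N (Phi γ K N) (nuF (tr γ K)) (nuD1 (tr γ K)) (nuD2 (tr γ K)) where
  smooth := by
    rw [contDiff_euclidean]
    intro x
    unfold Phi
    simp only
    split_ifs
    · refine contDiff_const.mul (contDiff_prod fun k _ => ?_)
      exact (contDiff_euclidean (n := 1) (f := fun σ : EuclideanSpace ℝ (Fin N) => σ)).1 contDiff_id (x.2 k)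
    · exact contDiff_const
  cov := fun σ τ => by
    have hN0 : (0:ℝ) < N := by exact_mod_cast hN
    rw [nuF_fin, Finset.mul_sum, PiLp.inner_apply, Fintype.sum_sigma]
    refine Finset.sum_congr rfl fun p _ => ?_
    by_cases hp : 2 ≤ (p:ℕ)
    · have e0 : ∀ i : Fin p → Fin N, (inner ℝ (Phi γ K N σ ⟨p, i⟩) (Phi γ K N τ ⟨p, i⟩) : ℝ) = γ p ^ 2 * ((N:ℝ) ^ ((p:ℕ) - 1))⁻¹ * ∏ k, (σ (i k) * τ (i k)) := fun i => by
        have e1 : (Real.sqrt ((N:ℝ) ^ ((p:ℕ) - 1)))⁻¹ * (Real.sqrt ((N:ℝ) ^ ((p:ℕ) - 1)))⁻¹ = ((N:ℝ) ^ ((p:ℕ) - 1))⁻¹ := by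
          rw [← mul_inv, Real.mul_self_sqrt (by positivity)]
        simp only [Phi, hp, if_true, Finset.prod_mul_distrib, ← e1, RCLike.inner_apply, conj_trivial]
        ring
      simp only [e0]
      rw [← Finset.mul_sum, ← Fintype.sum_pow (fun j : Fin N => σ j * τ j) (p:ℕ)]
      have e2 : (inner ℝ σ τ : ℝ) = ∑ j, σ j * τ j := by
        rw [PiLp.inner_apply]; refine Finset.sum_congr rfl fun j _ => ?_
        simp [mul_comm]
      rw [if_pos hp, e2, div_pow]
      obtain ⟨q, hq⟩ : ∃ q, (p:ℕ) = q + 1 := ⟨(p:ℕ) - 1, by omega⟩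
      rw [hq, Nat.add_sub_cancel]
      field_simp
      ring
    · simp [Phi, hp]
  d1 := fun x => by
    have e : nuF (tr γ K) = fun x => ∑ p : Fin (K+1), if 2 ≤ (p:ℕ) then γ p ^ 2 * x ^ (p:ℕ) else 0 := funext (nuF_fin γ K)
    rw [e, nuD1_fin]
    refine HasDerivAt.fun_sum fun p _ => ?_
    split_ifs
    · refine ((hasDerivAt_pow (p:ℕ) x).const_mul _).congr_deriv ?_
      ring
    · exact hasDerivAt_const _ _
  d2 := fun x => by
    have e : nuD1 (tr γ K) = fun x => ∑ p : Fin (K+1), if 2 ≤ (p:ℕ) then γ p ^ 2 * (p:ℕ) * x ^ ((p:ℕ) - 1) else 0 := funext (nuD1_fin γ K)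
    rw [e, nuD2_fin]
    refine HasDerivAt.fun_sum fun p _ => ?_
    split_ifs with hp
    · refine ((hasDerivAt_pow ((p:ℕ)-1) x).const_mul _).congr_deriv ?_
      have : (((p:ℕ) - 1 : ℕ) : ℝ) = ((p:ℕ):ℝ) - 1 := by rw [Nat.cast_sub (by omega)]; simp
      rw [this, show (p:ℕ) - 1 - 1 = (p:ℕ) - 2 by omega]
      ring
    · exact hasDerivAt_const _ _
  npos := hN

variable {ΩS : Type*} [MeasurableSpace ΩS]

/-- the disorder vector -/
def gv (J : Idx → ΩS → ℝ) (K N : ℕ) (ω : ΩS) : EuclideanSpace ℝ (TI K N) :=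
  WithLp.toLp 2 fun x => J (N, ⟨(x.1:ℕ), fun k => (x.2 k : ℕ)⟩) ω

lemma gv_inj (K N : ℕ) : Function.Injective (fun x : TI K N => ((N, ⟨(x.1:ℕ), fun k => (x.2 k : ℕ)⟩) : Idx)) := by
  rintro ⟨p, i⟩ ⟨q, j⟩ h
  simp only [Prod.mk.injEq, Sigma.mk.injEq, true_and] at h
  obtain ⟨h1, h2⟩ := h
  have h3 : p = q := Fin.ext h1
  subst h3
  have h4 := eq_of_heq h2
  have : i = j := by
    funext k; exact Fin.ext (congrFun h4 k)
  rw [this]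

lemma gv_meas {J : Idx → ΩS → ℝ} {P : Measure ΩS} (hJ : StdGaussianDisorder J P) (K N : ℕ) : Measurable (gv J K N) := by
  have h1 : Measurable (fun ω => fun x : TI K N => J (N, ⟨(x.1:ℕ), fun k => (x.2 k : ℕ)⟩) ω) := measurable_pi_lambda _ fun x => hJ.1 _
  have h2 : Measurable (WithLp.toLp 2 : (TI K N → ℝ) → EuclideanSpace ℝ (TI K N)) := by fun_prop
  exact h2.comp h1

lemma gv_law {J : Idx → ΩS → ℝ} {P : Measure ΩS} [IsProbabilityMeasure P] (hJ : StdGaussianDisorder J P) (K N : ℕ) : P.map (gv J K N) = stdGaussian (EuclideanSpace ℝ (TI K N)) := by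
  have h1 : Measurable (fun ω => fun x : TI K N => J (N, ⟨(x.1:ℕ), fun k => (x.2 k : ℕ)⟩) ω) := measurable_pi_lambda _ fun x => hJ.1 _
  have h2 : Measurable (WithLp.toLp 2 : (TI K N → ℝ) → EuclideanSpace ℝ (TI K N)) := by fun_prop
  have h3 : iIndepFun (fun x : TI K N => J (N, ⟨(x.1:ℕ), fun k => (x.2 k : ℕ)⟩)) P := hJ.2.1.precomp (gv_inj K N)
  have h4 := (iIndepFun_iff_map_fun_eq_pi_map (fun x => (hJ.1 _).aemeasurable)).1 h3
  have h5 : P.map (gv J K N) = (P.map (fun ω => fun x : TI K N => J (N, ⟨(x.1:ℕ), fun k => (x.2 k : ℕ)⟩) ω)).map (WithLp.toLp 2) := by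
    rw [Measure.map_map h2 h1]; rfl
  rw [h5, h4, ← map_pi_eq_stdGaussian]
  congr 2
  funext x
  exact hJ.2.2 _

lemma gv_real {J : Idx → ΩS → ℝ} {P : Measure ΩS} [IsProbabilityMeasure P] (hJ : StdGaussianDisorder J P) (K N : ℕ) {s : Set (EuclideanSpace ℝ (TI K N))} (hs : MeasurableSet s) :
    P (gv J K N ⁻¹' s) = stdGaussian (EuclideanSpace ℝ (TI K N)) s := by
  rw [← gv_law hJ K N, Measure.map_apply (gv_meas hJ K N) hs]

/-- the p-th homogeneous part -/
def Hp (J : Idx → ΩS → ℝ) (N p : ℕ) (ω : ΩS) (σ : EuclideanSpace ℝ (Fin N)) : ℝ :=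
  (Real.sqrt ((N : ℝ) ^ (p - 1)))⁻¹ * ∑ i : Fin p → Fin N, J (N, ⟨p, fun k => (i k : ℕ)⟩) ω * ∏ k, σ (i k)

lemma gv_inner (γ : ℕ → ℝ) (J : Idx → ΩS → ℝ) (K N : ℕ) (ω : ΩS) (σ : EuclideanSpace ℝ (Fin N)) :
    (inner ℝ (gv J K N ω) (Phi γ K N σ) : ℝ) = ∑ p ∈ Finset.range (K+1), if 2 ≤ p then γ p * Hp J N p ω σ else 0 := by
  rw [Finset.sum_range, PiLp.inner_apply, Fintype.sum_sigma]
  refine Finset.sum_congr rfl fun p _ => ?_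
  by_cases hp : 2 ≤ (p:ℕ)
  · simp only [Phi, gv, Hp, hp, if_true, RCLike.inner_apply, conj_trivial, Finset.mul_sum]
    refine Finset.sum_congr rfl fun i _ => ?_
    ring
  · simp [Phi, hp]

lemma HamN_eq (γ : ℕ → ℝ) (J : Idx → ΩS → ℝ) (N : ℕ) (ω : ΩS) (σ : EuclideanSpace ℝ (Fin N)) :
    HamN γ J N ω σ = ∑' p : ℕ, if 2 ≤ p then γ p * Hp J N p ω σ else 0 := by
  unfold HamN Hp
  refine tsum_congr fun p => ?_
  split_ifs
  · ring
  · rfl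
end g12

section g13
variable {ΩS : Type*} [MeasurableSpace ΩS]

lemma bc {P : Measure ΩS} {A : ℕ → Set ΩS} {c : ℝ} (hc : 0 < c) (h : ∀ᶠ M : ℕ in atTop, P (A M) ≤ ENNReal.ofReal (Real.exp (-((M+1 : ℕ) * c)))) :
    ∀ᵐ ω ∂P, ∀ᶠ M : ℕ in atTop, ω ∉ A M := by
  obtain ⟨M0, h0⟩ := eventually_atTop.1 h
  have hsum : Summable (fun M : ℕ => Real.exp (-((M+M0+1 : ℕ) * c))) := by
    have h1 : Summable (fun n : ℕ => Real.exp (n * (-c))) := Real.summable_exp_nat_mul_iff.2 (by linarith)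
    have h2 := (summable_nat_add_iff (M0 + 1)).2 h1
    refine h2.congr fun n => ?_
    congr 1; push_cast; ring
  have h3 : ∑' M, P (A (M + M0)) ≠ ⊤ := by
    refine ne_top_of_le_ne_top ?_ (ENNReal.tsum_le_tsum fun M => h0 (M + M0) (by omega))
    rw [← ENNReal.ofReal_tsum_of_nonneg (fun _ => (Real.exp_pos _).le) hsum]
    exact ENNReal.ofReal_ne_top
  filter_upwards [ae_eventually_notMem h3] with ω hω
  obtain ⟨M1, h1⟩ := eventually_atTop.1 hω
  refine eventually_atTop.2 ⟨M1 + M0, fun M hM => ?_⟩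
  have := h1 (M - M0) (by omega)
  rwa [Nat.sub_add_cancel (by omega)] at this

lemma exists_delta {δ0 c q a : ℝ} (hδ0 : 0 < δ0) (hc : 0 ≤ c) (ha : 0 < a) : ∃ δ, 0 < δ ∧ δ < δ0 ∧ Real.log (1 + c / δ ^ 2) / 2 + q < a / (2 * δ ^ 2) := by
  obtain ⟨n1, hn1⟩ := exists_nat_gt (4 * q / a)
  obtain ⟨n2, hn2⟩ := exists_nat_gt (1 / δ0 ^ 2)
  obtain ⟨M, h1, h2, h3⟩ := ((ev_exp (1 + c) (half_pos ha)).and ((eventually_ge_atTop n1).and (eventually_ge_atTop n2))).exists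
  set N : ℝ := ((M+1 : ℕ) : ℝ) with hNd
  have hN : 1 ≤ N := by simp only [hNd]; push_cast; linarith [(Nat.cast_nonneg M : (0:ℝ) ≤ M)]
  have hN1 : 4 * q / a < N := hn1.trans_le (by rw [hNd]; exact_mod_cast (by omega))
  have hN2 : 1 / δ0 ^ 2 < N := hn2.trans_le (by rw [hNd]; exact_mod_cast (by omega))
  have hd : ((Real.sqrt N)⁻¹) ^ 2 = N⁻¹ := by rw [inv_pow, Real.sq_sqrt (by linarith)]
  refine ⟨(Real.sqrt N)⁻¹, by positivity, ?_, ?_⟩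
  · refine lt_of_pow_lt_pow_left₀ 2 hδ0.le ?_
    rw [hd]
    rw [div_lt_iff₀ (by positivity)] at hN2
    rw [inv_lt_iff_one_lt_mul₀ (by linarith)]
    linarith
  · rw [hd]
    rw [div_lt_iff₀ ha] at hN1
    have h4 : Real.log (1 + c / N⁻¹) ≤ N * (a / 2) := by
      rw [Real.log_le_iff_le_exp (by positivity)]
      refine le_trans ?_ h1
      rw [div_inv_eq_mul]; nlinarith
    have : a / (2 * N⁻¹) = a * N / 2 := by field_simp
    rw [this]
    linarith

lemma lower_as {P : Measure ΩS} [IsProbabilityMeasure P] {J : Idx → ΩS → ℝ} (hJ : StdGaussianDisorder J P)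
    {γ : ℕ → ℝ} (hγ : GammaDecay γ) (hn : nuF γ 1 = 1) {y m : ℝ} (hp : Pars γ y m)
    (hPsi : ∀ r ∈ Ioo (-1:ℝ) 1, Psi0 γ r ≤ 0) {ε' : ℝ} (hε' : 0 < ε') :
    ∀ᶠ K in atTop, ∀ᵐ ω ∂P, ∀ᶠ M : ℕ in atTop, ∃ σ : EuclideanSpace ℝ (Fin (M+1)), (inner ℝ σ σ : ℝ) = (M+1 : ℕ) ∧
      (E0 γ - 3 * ε') * (M+1 : ℕ) < inner ℝ (gv J K (M+1) ω) (Phi γ K (M+1) σ) := by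
  obtain ⟨δ0, hδ0, hC⟩ := claimT hγ hn hp hPsi (ε := ε' ^ 2 / 64) (by positivity)
  have hn1 := hp.n1_ge
  have hn2 := hp.n12
  obtain ⟨δ, hδ, hδ1, hδ2⟩ := exists_delta (c := nuD1 γ 1 + 1) (q := Q1 γ y m + 1) (a := ε' ^ 2) hδ0 (by linarith) (by positivity)
  obtain ⟨B, hB⟩ := hC δ hδ hδ1
  obtain ⟨t0, t1, t2⟩ := u_tendsto hγ abs1
  have tu : Tendsto (fun K => nuF (tr γ K) 1 * y + nuD1 (tr γ K) 1 * m) atTop (nhds (E0 γ)) := by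
    have := (t0.mul_const y).add (t1.mul_const m)
    rw [hn, one_mul, ← hp.e] at this
    exact this
  have tQ : Tendsto (fun K => Q1 (tr γ K) y m) atTop (nhds (Q1 γ y m)) := by
    unfold Q1
    exact ((((t0.mul_const _).add (((t1.const_mul 2).mul_const y).mul_const m)).add ((t1.add t2).mul_const _)).div_const 2)
  filter_upwards [hB, t0.eventually_const_lt (show (0:ℝ) < nuF γ 1 by rw [hn]; norm_num), t0.eventually_lt_const (show nuF γ 1 < 2 by rw [hn]; norm_num),
    t1.eventually_const_lt (show (0:ℝ) < nuD1 γ 1 by linarith), t1.eventually_lt_const (show nuD1 γ 1 < nuD1 γ 1 + 1 by linarith),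
    t2.eventually_const_lt (show (0:ℝ) < nuD2 γ 1 by linarith), tu.eventually_const_lt (show E0 γ - ε' < E0 γ by linarith), tQ.eventually_lt_const (show Q1 γ y m < Q1 γ y m + 1 by linarith)] with K b0 b1 b2 b3 b4 b5 b6 b7
  have hL : Real.log (1 + nuD1 (tr γ K) 1 / δ ^ 2) / 2 + Q1 (tr γ K) y m < ε' ^ 2 / (2 * δ ^ 2) := by
    refine lt_of_le_of_lt ?_ hδ2
    have : Real.log (1 + nuD1 (tr γ K) 1 / δ ^ 2) ≤ Real.log (1 + (nuD1 γ 1 + 1) / δ ^ 2) := by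
      apply Real.log_le_log (by positivity)
      gcongr
    linarith
  have hs : ε' ^ 2 / 64 + (ε' ^ 2 / 32) / 2 ≤ ε' ^ 2 / (16 * nuF (tr γ K) 1) := by
    rw [le_div_iff₀ (by positivity)]
    have : 0 < ε' ^ 2 := by positivity
    nlinarith
  obtain ⟨Kb, hKb⟩ := lower_asym (n2 := nuD2 (tr γ K) 1) b1 b3 b5.le hδ (show 0 < ε' ^ 2 / 32 by positivity) (show 0 ≤ ε' ^ 2 / 64 by positivity) hε' hL hs
  have hbad : ∀ᶠ M : ℕ in atTop, P {ω | ∀ σ : EuclideanSpace ℝ (Fin (M+1)), (inner ℝ σ σ : ℝ) = (M+1 : ℕ) → (inner ℝ (gv J K (M+1) ω) (Phi γ K (M+1) σ) : ℝ) ≤ (nuF (tr γ K) 1*y+nuD1 (tr γ K) 1*m - 2 * ε') * (M+1:ℕ)} ≤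
      ENNReal.ofReal (Real.exp (-((M+1 : ℕ) * (ε' ^ 2 / (16 * nuF (tr γ K) 1))))) := by
    filter_upwards [hKb, eventually_ge_atTop 2] with M ⟨k1, k2, k3⟩ hM
    have hl := (Phi_feat γ K (M+1) (by omega)).lower (Q := Q1 (tr γ K) y m) (ε := ε' ^ 2 / 64) hδ (show 0 ≤ ε' ^ 2 / 32 by positivity) hM b1 b3 b5.le
      (fun r hr => (nuD1_abs_le (tr_decay hγ K) hr).trans (mul_le_of_le_one_left b3.le hr)) rfl
      (fun r hr => by
        obtain ⟨a, b, c, _, _, _, hF⟩ := b0 r hr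
        exact ⟨a, b, c, hF⟩) Kb k1 hε' k2
    have hl2 := hl.trans k3
    have h1 := Measure.le_map_apply (μ := P) (gv_meas hJ K (M+1)).aemeasurable {g | ∀ σ : EuclideanSpace ℝ (Fin (M+1)), (inner ℝ σ σ : ℝ) = (M+1 : ℕ) → (inner ℝ g (Phi γ K (M+1) σ) : ℝ) ≤ (nuF (tr γ K) 1*y+nuD1 (tr γ K) 1*m - 2 * ε') * (M+1:ℕ)}
    rw [gv_law hJ] at h1
    refine le_trans h1 ?_
    rw [← ofReal_measureReal (measure_ne_top _ _)]
    exact ENNReal.ofReal_le_ofReal hl2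
  filter_upwards [bc (by positivity) hbad] with ω hω
  filter_upwards [hω] with M hM
  simp only [mem_ofPred_eq, not_forall, not_le] at hM
  obtain ⟨σ, hσ, h⟩ := hM
  refine ⟨σ, hσ, lt_of_le_of_lt ?_ h⟩
  exact mul_le_mul_of_nonneg_right (by linarith) (Nat.cast_nonneg _)
end g13

section g14
set_option linter.unusedSectionVars false

lemma exp_sq_int (N : ℕ) {s : ℝ} (hs : s < 1) :
    Integrable (fun g : EuclideanSpace ℝ (Fin N) => Real.exp (s / 2 * ‖g‖ ^ 2)) (stdGaussian (EuclideanSpace ℝ (Fin N))) ∧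
    ∫ g : EuclideanSpace ℝ (Fin N), Real.exp (s / 2 * ‖g‖ ^ 2) ∂(stdGaussian (EuclideanSpace ℝ (Fin N))) = Real.exp (N * (-(Real.log (1 - s) / 2))) := by
  have h2 : Measurable (WithLp.toLp 2 : (Fin N → ℝ) → EuclideanSpace ℝ (Fin N)) := by fun_prop
  have hm : Measurable (fun g : EuclideanSpace ℝ (Fin N) => Real.exp (s / 2 * ‖g‖ ^ 2)) := by fun_prop
  have e : ∫ g : EuclideanSpace ℝ (Fin N), Real.exp (s / 2 * ‖g‖ ^ 2) ∂(stdGaussian (EuclideanSpace ℝ (Fin N))) = Real.exp (N * (-(Real.log (1 - s) / 2))) := by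
    rw [← map_pi_eq_stdGaussian, integral_map h2.aemeasurable hm.aestronglyMeasurable]
    have e1 : ∀ x : Fin N → ℝ, Real.exp (s / 2 * ‖(WithLp.toLp 2 x : EuclideanSpace ℝ (Fin N))‖ ^ 2) = ∏ i, Real.exp (-((-s) * (x i) ^ 2 / 2) + 0 * x i) := fun x => by
      rw [← Real.exp_sum, EuclideanSpace.real_norm_sq_eq, Finset.mul_sum]
      congr 1
      refine Finset.sum_congr rfl fun i _ => ?_
      simp only
      ring
    simp only [e1]
    rw [integral_fintype_prod_eq_pow (ι := Fin N) (fun x : ℝ => Real.exp (-((-s) * x ^ 2 / 2) + 0 * x)), gauss1 1 (-s) 0 (by simp; linarith), Fintype.card_fin, Real.exp_nat_mul]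
    congr 1
    have h3 : 0 < 1 - s := by linarith
    rw [Real.exp_neg, ← Real.log_sqrt h3.le, Real.exp_log (Real.sqrt_pos.2 h3)]
    simp [sub_eq_add_neg]
  refine ⟨?_, e⟩
  by_contra hc
  rw [integral_undef hc] at e
  exact (Real.exp_pos _).ne e

variable {E : Type*} [NormedAddCommGroup E] [InnerProductSpace ℝ E] [FiniteDimensional ℝ E]
  [MeasurableSpace E] [BorelSpace E]
variable {M : ℕ} {φ : EuclideanSpace ℝ (Fin (M+1)) → E} {f f1 f2 : ℝ → ℝ}

/-- upper exponent -/
def RR (n0 n1 y m : ℝ) : ℝ := -(y ^ 2 * (n1 - n0) / 2) + y / (2 * m) - Real.log (1 - y * m * n1) / 2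

lemma Feat.upper_int (h : Feat (M+1) φ f f1 f2) (ht : ∀ r, |r| ≤ 1 → f1 1 * r ≤ f r + (f1 1 - f 1)) (h1 : 0 < f1 1) {y m : ℝ} (hy : 0 < y) (hm : 0 < m) (hs : y * m * f1 1 < 1)
    {n : ℕ} (d : Fin (n+1) → EuclideanSpace ℝ (Fin (M+1))) (hd : ∀ i, (inner ℝ (d i) (d i) : ℝ) = (M+1:ℕ)) :
    ∫ g, Real.exp (y * ⨆ i, inner ℝ g (φ (d i))) ∂(stdGaussian E) ≤ Real.exp ((M+1:ℕ) * RR (f 1) (f1 1) y m) := by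
  set N : ℝ := ((M+1 : ℕ) : ℝ) with hNd
  have hN : 0 < N := by simp only [hNd]; positivity
  have hsl := slepian_fin (E1 := EuclideanSpace ℝ (Fin (M+1))) (E2 := E) (fun i => Real.sqrt (f1 1) • d i) (fun i => φ (d i)) hy (N * (f1 1 - f 1))
    (fun i => by
      rw [h.cov, hd, div_self hN.ne', inner_smul_left, inner_smul_right, hd, conj_trivial, ← mul_assoc, Real.mul_self_sqrt h1.le]; ring)
    (fun i j => by
      rw [h.cov, inner_smul_left, inner_smul_right, conj_trivial, ← mul_assoc, Real.mul_self_sqrt h1.le, ← hNd]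
      have hr : |(inner ℝ (d i) (d j) : ℝ) / N| ≤ 1 := by
        have hni : ∀ i, ‖d i‖ ^ 2 = N := fun i => by rw [← real_inner_self_eq_norm_sq, hd]
        rw [abs_div, abs_of_pos hN, div_le_one hN]
        have := abs_real_inner_le_norm (d i) (d j)
        nlinarith [hni i, hni j, sq_nonneg (‖d i‖ - ‖d j‖)]
      have h3 := mul_le_mul_of_nonneg_left (ht _ hr) hN.le
      have h4 : N * (f1 1 * ((inner ℝ (d i) (d j) : ℝ) / N)) = f1 1 * inner ℝ (d i) (d j) := by field_simp
      rw [h4] at h3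
      linarith)
  refine hsl.trans ?_
  obtain ⟨i1, i2⟩ := exp_sq_int (M+1) hs
  have h5 : ∫ g, Real.exp (y * ⨆ i, inner ℝ g (Real.sqrt (f1 1) • d i)) ∂(stdGaussian (EuclideanSpace ℝ (Fin (M+1)))) ≤ ∫ g : EuclideanSpace ℝ (Fin (M+1)), Real.exp (N * (y / (2 * m))) * Real.exp (y * m * f1 1 / 2 * ‖g‖ ^ 2) ∂(stdGaussian (EuclideanSpace ℝ (Fin (M+1)))) := by
    refine integral_mono ((sup_EG (fun i => Real.sqrt (f1 1) • d i) y).integrable ?_ _) (i1.const_mul _) fun g => ?_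
    · exact ((sup_meas (fun i => Real.sqrt (f1 1) • d i)).const_mul y).exp
    · simp only
      rw [← Real.exp_add, Real.exp_le_exp]
      have h6 : (⨆ i, (inner ℝ g (Real.sqrt (f1 1) • d i) : ℝ)) ≤ N / (2 * m) + m * f1 1 / 2 * ‖g‖ ^ 2 := by
        refine ciSup_le fun i => ?_
        rw [inner_smul_right]
        have h7 := sq_nonneg ‖(Real.sqrt (f1 1) * m) • g - d i‖
        have h8 := real_inner_self_eq_norm_sq ((Real.sqrt (f1 1) * m) • g - d i)
        have h9 : (0:ℝ) ≤ ‖(Real.sqrt (f1 1) * m) • g - d i‖ ^ 2 := sq_nonneg _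
        rw [norm_sub_sq_real, norm_smul, ← real_inner_self_eq_norm_sq (d i), hd, inner_smul_left, mul_pow, Real.norm_eq_abs, sq_abs, mul_pow, Real.sq_sqrt h1.le, conj_trivial] at h9
        have : Real.sqrt (f1 1) * (inner ℝ g (d i) : ℝ) ≤ (N + m ^ 2 * f1 1 * ‖g‖ ^ 2) / (2 * m) := by
          rw [le_div_iff₀ (by positivity)]; linarith
        refine this.trans (le_of_eq ?_)
        field_simp
      have := mul_le_mul_of_nonneg_left h6 hy.le
      refine this.trans (le_of_eq ?_)
      ring
  rw [integral_const_mul, i2, ← hNd, ← Real.exp_add] at h5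
  refine (mul_le_mul_of_nonneg_left h5 (Real.exp_pos _).le).trans (le_of_eq ?_)
  rw [← Real.exp_add]; congr 1; unfold RR; ring

lemma Feat.upper (h : Feat (M+1) φ f f1 f2) (ht : ∀ r, |r| ≤ 1 → f1 1 * r ≤ f r + (f1 1 - f 1)) (h1 : 0 < f1 1) {y m : ℝ} (hy : 0 < y) (hm : 0 < m) (hs : y * m * f1 1 < 1) (A : ℝ) :
    (stdGaussian E) {g | ∃ σ : EuclideanSpace ℝ (Fin (M+1)), (inner ℝ σ σ : ℝ) = (M+1 : ℕ) ∧ A * (M+1:ℕ) < inner ℝ g (φ σ)} ≤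
      ENNReal.ofReal (Real.exp ((M+1:ℕ) * (RR (f 1) (f1 1) y m - y * A))) := by
  obtain ⟨d, hd, hdd⟩ := sphere_seq M
  set N : ℝ := ((M+1 : ℕ) : ℝ) with hNd
  let U : ℕ → Set E := fun n => {g | A * N ≤ ⨆ i : Fin (n+1), inner ℝ g (φ (d i))}
  have hmono : Monotone U := by
    intro n m hnm g hg
    simp only [U, mem_ofPred_eq] at hg ⊢
    refine le_trans hg (ciSup_le fun i => ?_)
    exact le_ciSup (f := fun i : Fin (m+1) => (inner ℝ g (φ (d i)) : ℝ)) (Set.finite_range _).bddAbove ⟨i.1, by omega⟩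
  have hU : {g | ∃ σ : EuclideanSpace ℝ (Fin (M+1)), (inner ℝ σ σ : ℝ) = N ∧ A * N < inner ℝ g (φ σ)} ⊆ ⋃ n, U n := by
    rintro g ⟨σ, hσ, hlt⟩
    have : ∃ k, A * N < inner ℝ g (φ (d k)) := by
      by_contra hcon
      simp only [not_exists, not_lt] at hcon
      exact absurd hlt (not_lt.2 (hdd (fun σ => inner ℝ g (φ σ)) (by have := h.smooth.continuous; fun_prop) _ hcon σ hσ))
    obtain ⟨k, hk⟩ := this
    refine Set.mem_iUnion.2 ⟨k, ?_⟩
    simp only [U, mem_ofPred_eq]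
    refine le_trans hk.le ?_
    exact le_ciSup (f := fun j : Fin (k+1) => (inner ℝ g (φ (d j)) : ℝ)) (Set.finite_range _).bddAbove ⟨k, by omega⟩
  refine (measure_mono hU).trans ?_
  refine le_of_tendsto' (tendsto_measure_iUnion_atTop hmono) fun n => ?_
  rw [Function.comp_apply, ← ofReal_measureReal (measure_ne_top _ _)]
  apply ENNReal.ofReal_le_ofReal
  have hup := h.upper_int ht h1 hy hm hs (fun i : Fin (n+1) => d i) (fun i => hd i)
  have hint : Integrable (fun g => Real.exp (y * ⨆ i : Fin (n+1), inner ℝ g (φ (d i)))) (stdGaussian E) :=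
    (sup_EG (fun i : Fin (n+1) => φ (d i)) y).integrable (((sup_meas (fun i : Fin (n+1) => φ (d i))).const_mul y).exp) _
  have hmk := mul_meas_ge_le_integral_of_nonneg (ae_of_all _ fun g => (Real.exp_pos _).le) hint (Real.exp (y * (A * N)))
  have hsub : (stdGaussian E).real (U n) ≤ (stdGaussian E).real {g | Real.exp (y * (A * N)) ≤ Real.exp (y * ⨆ i : Fin (n+1), inner ℝ g (φ (d i)))} := by
    refine measureReal_mono fun g hg => ?_
    simp only [U, mem_ofPred_eq] at hg ⊢
    rw [Real.exp_le_exp]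
    exact mul_le_mul_of_nonneg_left hg hy.le
  have h2 := (mul_le_mul_of_nonneg_left hsub (Real.exp_pos (y * (A * N))).le).trans (hmk.trans hup)
  rw [← le_div_iff₀' (Real.exp_pos _), ← Real.exp_sub] at h2
  refine h2.trans (le_of_eq ?_)
  congr 1; ring
end g14

section g15
variable {ΩS : Type*} [MeasurableSpace ΩS]

lemma upper_P {P : Measure ΩS} [IsProbabilityMeasure P] {J : Idx → ΩS → ℝ} (hJ : StdGaussianDisorder J P)
    {γ : ℕ → ℝ} (hγ : GammaDecay γ) (K M : ℕ) (h1 : 0 < nuD1 (tr γ K) 1) {y m : ℝ} (hy : 0 < y) (hm : 0 < m) (hs : y * m * nuD1 (tr γ K) 1 < 1) (A : ℝ) :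
    P {ω | ∃ σ : EuclideanSpace ℝ (Fin (M+1)), (inner ℝ σ σ : ℝ) = (M+1 : ℕ) ∧ A * (M+1:ℕ) < inner ℝ (gv J K (M+1) ω) (Phi γ K (M+1) σ)} ≤
      ENNReal.ofReal (Real.exp ((M+1:ℕ) * (RR (nuF (tr γ K) 1) (nuD1 (tr γ K) 1) y m - y * A))) := by
  have hl := (Phi_feat γ K (M+1) (by omega)).upper (fun r hr => nu_tangent (tr_decay hγ K) hr) h1 hy hm hs A
  have h2 := Measure.le_map_apply (μ := P) (gv_meas hJ K (M+1)).aemeasurable {g | ∃ σ : EuclideanSpace ℝ (Fin (M+1)), (inner ℝ σ σ : ℝ) = (M+1 : ℕ) ∧ A * (M+1:ℕ) < inner ℝ g (Phi γ K (M+1) σ)}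
  rw [gv_law hJ] at h2
  exact le_trans h2 hl

lemma upper_as {P : Measure ΩS} [IsProbabilityMeasure P] {J : Idx → ΩS → ℝ} (hJ : StdGaussianDisorder J P)
    {γ : ℕ → ℝ} (hγ : GammaDecay γ) (hn : nuF γ 1 = 1) {y m : ℝ} (hp : Pars γ y m) {ε : ℝ} (hε : 0 < ε) :
    ∀ᶠ K in atTop, ∀ᵐ ω ∂P, ∀ᶠ M : ℕ in atTop, ∀ σ : EuclideanSpace ℝ (Fin (M+1)), (inner ℝ σ σ : ℝ) = (M+1 : ℕ) →
      (inner ℝ (gv J K (M+1) ω) (Phi γ K (M+1) σ) : ℝ) ≤ (E0 γ + ε) * (M+1 : ℕ) := by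
  obtain ⟨t0, t1, t2⟩ := u_tendsto hγ abs1
  have hn1 := hp.n1_ge
  have hy := hp.y_pos
  have hm := hp.m_pos
  have hrel := hp.rel
  have h1m : 1 - y * m * nuD1 γ 1 = nuD1 γ 1 * m ^ 2 := by linarith
  have hpos : 0 < nuD1 γ 1 * m ^ 2 := by positivity
  have hR : RR (nuF γ 1) (nuD1 γ 1) y m = y * E0 γ := by
    have e1 : y / (2 * m) = y * nuD1 γ 1 * (y + m) / 2 := by
      rw [div_eq_iff (by positivity)]
      linear_combination (-y) * hrel
    have := hp.ye
    have e2 := hp.e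
    unfold RR
    rw [h1m, hn, e1]
    have e3 : y * E0 γ = y * (y + nuD1 γ 1 * m) := by rw [e2]
    linarith
  have tR : Tendsto (fun K => RR (nuF (tr γ K) 1) (nuD1 (tr γ K) 1) y m) atTop (nhds (y * E0 γ)) := by
    rw [← hR]
    unfold RR
    have := ((t1.const_mul (y*m)).const_sub 1).log (by rw [h1m]; exact hpos.ne')
    exact (((((t1.sub t0).const_mul (y^2)).div_const 2).neg).add_const _).sub (this.div_const 2)
  filter_upwards [t1.eventually_const_lt (show (0:ℝ) < nuD1 γ 1 by linarith), (t1.const_mul (y*m)).eventually_lt_const (show y * m * nuD1 γ 1 < 1 by linarith),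
    tR.eventually_lt_const (show y * E0 γ < y * E0 γ + y * ε / 2 by linarith [mul_pos hy hε])] with K b1 b2 b3
  have hbad : ∀ᶠ M : ℕ in atTop, P {ω | ∃ σ : EuclideanSpace ℝ (Fin (M+1)), (inner ℝ σ σ : ℝ) = (M+1 : ℕ) ∧ (E0 γ + ε) * (M+1:ℕ) < inner ℝ (gv J K (M+1) ω) (Phi γ K (M+1) σ)} ≤
      ENNReal.ofReal (Real.exp (-((M+1 : ℕ) * (y * ε / 2)))) := by
    refine Eventually.of_forall fun M => (upper_P hJ hγ K M b1 hy hm b2 _).trans (ENNReal.ofReal_le_ofReal (Real.exp_le_exp.2 ?_))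
    rw [← mul_neg]
    exact mul_le_mul_of_nonneg_left (by linarith) (Nat.cast_nonneg _)
  filter_upwards [bc (by positivity) hbad] with ω hω
  filter_upwards [hω] with M hM σ hσ
  simp only [mem_ofPred_eq, not_exists, not_and, not_lt] at hM
  exact hM σ hσ

/-- the pure p coefficients -/
def pg (p : ℕ) : ℕ → ℝ := fun q => if q = p then 1 else 0

lemma pg_decay (p : ℕ) : GammaDecay (pg p) := by
  refine ⟨fun q => by unfold pg; split_ifs <;> norm_num, 1/2, by norm_num, by norm_num, ?_⟩
  filter_upwards [eventually_gt_atTop p] with q hq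
  unfold pg
  rw [if_neg (by omega)]
  positivity

lemma pg_nuF {p : ℕ} (hp : 2 ≤ p) : nuF (tr (pg p) p) 1 = 1 := by
  unfold nuF
  rw [tsum_eq_single p]
  · simp [hp, tr, pg]
  · intro q hq; simp [tr, pg, hq]

lemma pg_nuD1 {p : ℕ} (hp : 2 ≤ p) : nuD1 (tr (pg p) p) 1 = p := by
  unfold nuD1
  rw [tsum_eq_single p]
  · simp [hp, tr, pg]
  · intro q hq; simp [tr, pg, hq]

lemma pg_inner (J : Idx → ΩS → ℝ) {p : ℕ} (hp : 2 ≤ p) (N : ℕ) (ω : ΩS) (σ : EuclideanSpace ℝ (Fin N)) :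
    (inner ℝ (gv J p N ω) (Phi (pg p) p N σ) : ℝ) = Hp J N p ω σ := by
  rw [gv_inner, Finset.sum_eq_single p]
  · simp [hp, pg]
  · intro q _ hq; simp [pg, hq]
  · intro h; simp at h

lemma pure_P {P : Measure ΩS} [IsProbabilityMeasure P] {J : Idx → ΩS → ℝ} (hJ : StdGaussianDisorder J P) (M : ℕ) {p : ℕ} (hp : 2 ≤ p) :
    P {ω | ∃ σ : EuclideanSpace ℝ (Fin (M+1)), (inner ℝ σ σ : ℝ) = (M+1 : ℕ) ∧ ((3 + p) * p : ℝ) * (M+1:ℕ) < Hp J (M+1) p ω σ} ≤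
      ENNReal.ofReal (Real.exp (-((M+1:ℕ) * (1 + p)))) := by
  have hp' : (2:ℝ) ≤ p := by exact_mod_cast hp
  set s := Real.sqrt p with hs
  have hs2 : s ^ 2 = p := Real.sq_sqrt (by linarith)
  have hs0 : 0 < s := Real.sqrt_pos.2 (by linarith)
  have hs1 : 1 ≤ s := by nlinarith
  have hyp : 1 / s * (1 / (2 * s)) * nuD1 (tr (pg p) p) 1 = 1 / 2 := by
    rw [pg_nuD1 hp, ← hs2]; field_simp
  have h := upper_P hJ (pg_decay p) p M (by rw [pg_nuD1 hp]; linarith) (y := 1 / s) (m := 1 / (2 * s)) (by positivity) (by positivity) (by rw [hyp]; norm_num) ((3 + p) * p)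
  simp only [pg_inner J hp] at h
  refine h.trans (ENNReal.ofReal_le_ofReal (Real.exp_le_exp.2 ?_))
  rw [← mul_neg]
  refine mul_le_mul_of_nonneg_left ?_ (Nat.cast_nonneg _)
  unfold RR
  rw [hyp, pg_nuF hp, pg_nuD1 hp]
  have e1 : 1 / s / (2 * (1 / (2 * s))) = 1 := by field_simp
  have e2 : 1 / s * ((3 + p) * p) = (3 + p) * s := by rw [← hs2]; field_simp
  have e3 : Real.log (1 - 1/2) = - Real.log 2 := by
    rw [← Real.log_inv]; norm_num
  have e4 := Real.log_two_lt_d9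
  have e5 : 0 ≤ (1 / s) ^ 2 * ((p:ℝ) - 1) / 2 := by
    have : (0:ℝ) ≤ p - 1 := by linarith
    positivity
  rw [e1, e2, e3]
  have e6 : (3 + p : ℝ) * 1 ≤ (3 + p) * s := mul_le_mul_of_nonneg_left hs1 (by linarith)
  linarith

lemma pure_as {P : Measure ΩS} [IsProbabilityMeasure P] {J : Idx → ΩS → ℝ} (hJ : StdGaussianDisorder J P) :
    ∀ᵐ ω ∂P, ∀ᶠ M : ℕ in atTop, ∀ p, 2 ≤ p → ∀ σ : EuclideanSpace ℝ (Fin (M+1)), (inner ℝ σ σ : ℝ) = (M+1 : ℕ) →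
      Hp J (M+1) p ω σ ≤ ((3 + p) * p : ℝ) * (M+1:ℕ) := by
  set A : ℕ → ℕ → Set ΩS := fun M p => {ω | ∃ σ : EuclideanSpace ℝ (Fin (M+1)), (inner ℝ σ σ : ℝ) = (M+1 : ℕ) ∧ ((3 + p) * p : ℝ) * (M+1:ℕ) < Hp J (M+1) p ω σ} with hA
  have hbad : ∀ᶠ M : ℕ in atTop, P (⋃ p : ℕ, A M (p + 2)) ≤ ENNReal.ofReal (Real.exp (-((M+1 : ℕ) * 1))) := by
    refine Eventually.of_forall fun M => (measure_iUnion_le _).trans ?_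
    set N : ℝ := ((M+1:ℕ):ℝ) with hNd
    have hN : 1 ≤ N := by simp only [hNd]; push_cast; linarith [(Nat.cast_nonneg M : (0:ℝ) ≤ M)]
    have hb : ∀ p : ℕ, P (A M (p+2)) ≤ ENNReal.ofReal (Real.exp (-(N * 1)) * ((1/2) * (1/2) ^ p)) := by
      intro p
      refine (pure_P hJ M (p := p+2) (by omega)).trans (ENNReal.ofReal_le_ofReal ?_)
      have : Real.exp (-(N * (1 + ((p+2:ℕ):ℝ)))) = Real.exp (-(N*1)) * Real.exp (-N * ((p+2:ℕ):ℝ)) := by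
        rw [← Real.exp_add]; congr 1; ring
      rw [this]
      refine mul_le_mul_of_nonneg_left ?_ (Real.exp_pos _).le
      have h2 : Real.exp (-N) ≤ 1/2 := by
        have h3 : Real.exp (-N) ≤ Real.exp (-1) := Real.exp_le_exp.2 (by linarith)
        have h4 := Real.exp_neg_one_lt_d9
        linarith
      rw [mul_comm, Real.exp_nat_mul]
      calc Real.exp (-N) ^ (p+2) ≤ (1/2) ^ (p+2) := pow_le_pow_left₀ (Real.exp_pos _).le h2 _
        _ ≤ 1/2 * (1/2) ^ p := by
          rw [pow_add]; nlinarith [show (0:ℝ) < (1/2)^p by positivity]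
    refine (ENNReal.tsum_le_tsum hb).trans ?_
    have hsum := ((summable_geometric_two).mul_left (1/2:ℝ)).mul_left (Real.exp (-(N*1)))
    rw [← ENNReal.ofReal_tsum_of_nonneg (fun _ => by positivity) hsum]
    refine ENNReal.ofReal_le_ofReal ?_
    rw [tsum_mul_left, tsum_mul_left, tsum_geometric_two]
    norm_num
  filter_upwards [bc one_pos hbad] with ω hω
  filter_upwards [hω] with M hM p hp σ hσ
  by_contra hcon
  refine hM (mem_iUnion.2 ⟨p - 2, ?_⟩)
  rw [Nat.sub_add_cancel hp]
  simp only [hA, mem_ofPred_eq]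
  exact ⟨σ, hσ, not_le.1 hcon⟩

lemma neg_disorder {P : Measure ΩS} {J : Idx → ΩS → ℝ} (hJ : StdGaussianDisorder J P) : StdGaussianDisorder (fun i ω => - J i ω) P := by
  obtain ⟨h1, h2, h3⟩ := hJ
  refine ⟨fun i => (h1 i).neg, ?_, fun i => ?_⟩
  · exact h2.comp (fun _ => fun x : ℝ => -x) (fun _ => measurable_neg)
  · have := Measure.map_map (μ := P) (measurable_neg (G := ℝ)) (h1 i)
    rw [h3 i, gaussianReal_map_neg, neg_zero] at this
    exact this.symm

lemma Hp_neg (J : Idx → ΩS → ℝ) (N p : ℕ) (ω : ΩS) (σ : EuclideanSpace ℝ (Fin N)) : Hp (fun i ω => - J i ω) N p ω σ = - Hp J N p ω σ := by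
  simp [Hp]

lemma HamN_neg (γ : ℕ → ℝ) (J : Idx → ΩS → ℝ) (N : ℕ) (ω : ΩS) (σ : EuclideanSpace ℝ (Fin N)) : HamN γ (fun i ω => - J i ω) N ω σ = - HamN γ J N ω σ := by
  rw [HamN_eq, HamN_eq, ← tsum_neg]
  refine tsum_congr fun p => ?_
  split_ifs
  · rw [Hp_neg]; ring
  · simp

lemma tail_as {P : Measure ΩS} [IsProbabilityMeasure P] {J : Idx → ΩS → ℝ} (hJ : StdGaussianDisorder J P)
    {γ : ℕ → ℝ} (hγ : GammaDecay γ) {ε : ℝ} (hε : 0 < ε) :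
    ∀ᶠ K in atTop, ∀ᵐ ω ∂P, ∀ᶠ M : ℕ in atTop, ∀ σ : EuclideanSpace ℝ (Fin (M+1)), (inner ℝ σ σ : ℝ) = (M+1 : ℕ) →
      |HamN γ J (M+1) ω σ - inner ℝ (gv J K (M+1) ω) (Phi γ K (M+1) σ)| ≤ ε * (M+1 : ℕ) := by
  have hS : Summable (fun p : ℕ => γ p * ((3 + p) * p)) := by
    refine (((summ1 hγ 1).mul_left 3).add (summ1 hγ 2)).congr fun p => ?_
    ring
  have hT := tendsto_sum_nat_add (fun p : ℕ => γ p * ((3 + p) * p))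
  have hT1 := (tendsto_add_atTop_iff_nat 1).2 hT
  filter_upwards [hT1.eventually_lt_const hε] with K hK
  filter_upwards [pure_as hJ, pure_as (neg_disorder hJ)] with ω h1 h2
  filter_upwards [h1, h2] with M k1 k2 σ hσ
  set N : ℝ := ((M+1:ℕ):ℝ) with hNd
  set a : ℕ → ℝ := fun p => if 2 ≤ p then γ p * Hp J (M+1) p ω σ else 0 with ha
  have hab : ∀ p, ‖a p‖ ≤ (γ p * ((3 + p) * p)) * N := by
    intro p
    have hg := hγ.1 p
    simp only [ha]
    split_ifs with hp
    · have q1 := k1 p hp σ hσ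
      have q2 := k2 p hp σ hσ
      rw [Hp_neg] at q2
      rw [norm_mul, Real.norm_eq_abs, Real.norm_eq_abs, abs_of_nonneg hg, mul_assoc]
      exact mul_le_mul_of_nonneg_left (abs_le.2 ⟨by linarith, q1⟩) hg
    · rw [norm_zero]; positivity
  have hsN := hS.mul_right N
  have hsa : Summable a := Summable.of_norm_bounded hsN hab
  rw [HamN_eq, gv_inner]
  have := hsa.sum_add_tsum_nat_add (K+1)
  rw [← this, add_sub_cancel_left, ← Real.norm_eq_abs]
  have hs1 := (summable_nat_add_iff (K+1)).2 hsN
  refine (tsum_of_norm_bounded hs1.hasSum fun i => hab (i + (K+1))).trans ?_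
  rw [tsum_mul_right]
  exact mul_le_mul_of_nonneg_right hK.le (Nat.cast_nonneg _)
end g15

/-- Under Condition M, the ground state satisfies
GS_N/N → −E₀(ν) almost surely. -/
theorem ground_state_limit
    {ΩS : Type*} [MeasurableSpace ΩS] (P : Measure ΩS) [IsProbabilityMeasure P]
    (γ : ℕ → ℝ) (hγ : GammaDecay γ) (hnorm : nuF γ 1 = 1) (hM : ConditionM γ)
    (J : Idx → ΩS → ℝ) (hJ : StdGaussianDisorder J P) :
    ∀ᵐ ω ∂P, Tendsto (fun N : ℕ => GS γ J N ω / N) atTop (nhds (-(E0 γ))) := by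
  obtain ⟨hmix, hpl, -, hmax, -, -⟩ := hM
  obtain ⟨y, m, hp⟩ := exists_pars hγ hnorm hmix hpl
  have h0 := Psi0_zero hγ hnorm hmix hp
  have hPsi : ∀ r ∈ Ioo (-1:ℝ) 1, Psi0 γ r ≤ 0 := by
    intro r hr
    by_cases h : r = 0
    · rw [h, h0]
    · have := hmax r hr h
      rw [h0] at this
      exact this.le
  have hJ' := neg_disorder hJ
  have key : ∀ n : ℕ, ∀ᵐ ω ∂P, ∀ᶠ M : ℕ in atTop, |GS γ J (M+1) ω / ((M+1:ℕ):ℝ) - (-(E0 γ))| ≤ 4 * (1 / ((n:ℝ) + 1)) := by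
    intro n
    have hε : (0:ℝ) < 1 / ((n:ℝ) + 1) := by positivity
    set ε : ℝ := 1 / ((n:ℝ) + 1)
    obtain ⟨K, a1, a2, a3⟩ := ((lower_as hJ' hγ hnorm hp hPsi hε).and ((upper_as hJ' hγ hnorm hp hε).and (tail_as hJ' hγ hε))).exists
    filter_upwards [a1, a2, a3] with ω b1 b2 b3
    filter_upwards [b1, b2, b3] with M c1 c2 c3
    set N : ℝ := ((M+1:ℕ):ℝ) with hNd
    have hN : 0 < N := by rw [hNd]; positivity
    have hlow : ∀ σ : EuclideanSpace ℝ (Fin (M+1)), ‖σ‖ = Real.sqrt N → -(E0 γ + 2 * ε) * N ≤ HamN γ J (M+1) ω σ := by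
      intro σ hσ
      have hs : (inner ℝ σ σ : ℝ) = N := by
        rw [real_inner_self_eq_norm_sq, hσ, Real.sq_sqrt hN.le]
      have d1 := c2 σ hs
      have d2 := (abs_le.1 (c3 σ hs)).2
      rw [HamN_neg] at d2
      linarith
    obtain ⟨σ0, hs0, e1⟩ := c1
    have hσ0 : ‖σ0‖ = Real.sqrt N := by
      rw [← hs0, real_inner_self_eq_norm_sq, Real.sqrt_sq (norm_nonneg _)]
    have e2 := (abs_le.1 (c3 σ0 hs0)).1
    rw [HamN_neg] at e2
    have g1 : GS γ J (M+1) ω ≤ HamN γ J (M+1) ω σ0 := by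
      refine csInf_le ⟨-(E0 γ + 2 * ε) * N, ?_⟩ ⟨σ0, ?_, rfl⟩
      · rintro _ ⟨σ, hσ, rfl⟩
        simp only [mem_ofPred_eq] at hσ
        exact hlow σ hσ
      · simp only [mem_ofPred_eq]; exact hσ0
    have g2 : -(E0 γ + 2 * ε) * N ≤ GS γ J (M+1) ω := by
      refine le_csInf ⟨_, σ0, ?_, rfl⟩ ?_
      · simp only [mem_ofPred_eq]; exact hσ0
      · rintro _ ⟨σ, hσ, rfl⟩
        simp only [mem_ofPred_eq] at hσ
        exact hlow σ hσ
    have f1 : GS γ J (M+1) ω / N ≤ -(E0 γ) + 4 * ε := by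
      rw [div_le_iff₀ hN]; linarith
    have f2 : -(E0 γ + 2 * ε) ≤ GS γ J (M+1) ω / N := by
      rw [le_div_iff₀ hN]; exact g2
    rw [abs_le]
    constructor <;> linarith
  filter_upwards [ae_all_iff.2 key] with ω hω
  refine (tendsto_add_atTop_iff_nat 1).1 ?_
  rw [Metric.tendsto_atTop]
  intro e he
  obtain ⟨n, hn⟩ := exists_nat_one_div_lt (show 0 < e / 4 by linarith)
  obtain ⟨M0, hM0⟩ := eventually_atTop.1 (hω n)
  refine ⟨M0, fun M hM => ?_⟩
  rw [Real.dist_eq]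
  exact (hM0 M hM).trans_lt (by linarith)

end SpinGlass
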